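/- Let d ≥ 2 and α ∈ (0, 1/3). There exists a vector field u : [0,1] × T^d → ℝ^d which is divergence-free (in the sense of distributions), belongs to C^0([0,1]; C^α(T^d)) ∩ C^α([0,1]; C^0(T^d)), and has the following property. For every ε > 0 there is a constant c = c(d, α, ε) > 0 such that: for every zero-mean initial datum θ_in ∈ L²(T^d) possessing a square-integrable weak gradient (θ_in ∈ H¹(T^d)), and for every family (θ^κ)_{κ∈(0,1]} of solutions of the advection–diffusion equation ∂_t θ^κ + u·∇θ^κ = κΔθ^κ on (0,1]×T^d (θ^κ continuous on [0,1]×T^d with θ^κ(0,·) = θ_in, and C¹ in time, C² in space on (0,1]×T^d, solving the equation pointwise), one has limsup_{κ→0} κ ∫_0^1 ∫_{T^d} |∇θ^κ(t,x)|² dx dt ≥ ϱ ‖θ_in‖²_{L²(T^d)}, where ϱ = c · L_in^{2(1+α)/(1−α) + ε} and L_in := ‖θ_in‖_{L²(T^d)} / ‖∇θ_in‖_{L²(T^d)}. -/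

import Mathlib

open MeasureTheory Real Topology Filter

noncomputable section

/-- Spatial partial derivative `∂_i f` (via the Fréchet derivative). -/
def pd {d : ℕ} (f : (Fin d → ℝ) → ℝ) (i : Fin d) (x : Fin d → ℝ) : ℝ :=
  fderiv ℝ f x (Pi.single i 1)

/-- The unit box `[0,1]^d`, a fundamental domain for the torus `T^d = ℝ^d/ℤ^d`. -/
def box (d : ℕ) : Set (Fin d → ℝ) := Set.Icc 0 1

/-- `ℤ^d`-periodicity in the space variable (functions on the torus `T^d`). -/
def SpacePeriodic {d : ℕ} (f : (Fin d → ℝ) → ℝ) : Prop :=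
  ∀ (x : Fin d → ℝ) (k : Fin d → ℤ), f (x + fun i => (k i : ℝ)) = f x

/-- Squared length of the spatial gradient, `|∇f|²(x)`. -/
def gradSq {d : ℕ} (f : (Fin d → ℝ) → ℝ) (x : Fin d → ℝ) : ℝ :=
  ∑ i, (pd f i x) ^ 2

/-- Squared `L²(T^d)` norm. -/
def l2sq {d : ℕ} (f : (Fin d → ℝ) → ℝ) : ℝ := ∫ x in box d, (f x) ^ 2

/-- The dissipation `∫_0^t ‖∇θ(s,·)‖²_{L²(T^d)} ds`. -/
def dissipUpTo {d : ℕ} (θ : ℝ → (Fin d → ℝ) → ℝ) (t : ℝ) : ℝ :=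
  ∫ s in Set.Icc (0:ℝ) t, ∫ x in box d, gradSq (θ s) x

/-- The dissipation `∫_0^1 ∫_{T^d} |∇θ|² dx dt`. -/
def dissip {d : ℕ} (θ : ℝ → (Fin d → ℝ) → ℝ) : ℝ := dissipUpTo θ 1

/-- A solution of the advection–diffusion equation `∂_t θ + u·∇θ = κΔθ` on
`(0,1] × T^d` with initial datum `θ_in`: continuous on `[0,1] × T^d`, spatially
periodic, `C¹` in time and `C²` in space on `(0,1] × T^d`, solving the equation
pointwise there. -/
structure IsAdvDiffSol {d : ℕ} (u : ℝ → (Fin d → ℝ) → Fin d → ℝ) (κ : ℝ)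
    (θin : (Fin d → ℝ) → ℝ) (θ : ℝ → (Fin d → ℝ) → ℝ) : Prop where
  periodic : ∀ t, SpacePeriodic (θ t)
  cont : ContinuousOn (fun p : ℝ × (Fin d → ℝ) => θ p.1 p.2)
    (Set.Icc 0 1 ×ˢ Set.univ)
  init : ∀ x, θ 0 x = θin x
  timeDiff : ∀ t ∈ Set.Ioc (0:ℝ) 1, ∀ x, DifferentiableAt ℝ (fun s => θ s x) t
  spaceC2 : ∀ t ∈ Set.Ioc (0:ℝ) 1, ContDiff ℝ 2 (θ t)
  eqn : ∀ t ∈ Set.Ioc (0:ℝ) 1, ∀ x,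
    deriv (fun s => θ s x) t + ∑ i, u t x i * pd (θ t) i x
      = κ * ∑ i, pd (pd (θ t) i) i x

/-- `u ∈ C^0_t C^α_x ∩ C^α_t C^0_x` on `[0,1] × T^d`: continuity plus uniform
Hölder bounds in space and in time. -/
def HolderVF {d : ℕ} (α : ℝ) (u : ℝ → (Fin d → ℝ) → Fin d → ℝ) : Prop :=
  Continuous (fun p : ℝ × (Fin d → ℝ) => u p.1 p.2) ∧
  ∃ A : ℝ, ∀ s ∈ Set.Icc (0:ℝ) 1, ∀ t ∈ Set.Icc (0:ℝ) 1, ∀ x y : Fin d → ℝ,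
    ‖u t x - u t y‖ ≤ A * ‖x - y‖ ^ α ∧ ‖u t x - u s x‖ ≤ A * |t - s| ^ α

/-- `u(t,·)` is divergence-free on `T^d` in the sense of distributions:
`∫_{T^d} u(t,x)·∇φ(x) dx = 0` for every smooth periodic `φ`. -/
def WeakDivFree {d : ℕ} (u : ℝ → (Fin d → ℝ) → Fin d → ℝ) : Prop :=
  ∀ t ∈ Set.Icc (0:ℝ) 1, ∀ φ : (Fin d → ℝ) → ℝ, ContDiff ℝ (⊤ : ℕ∞) φ →
    SpacePeriodic φ → (∫ x in box d, ∑ i, u t x i * pd φ i x) = 0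

/-- `g` is the (square-integrable) weak gradient of `f` on `T^d`:
`∫ f div ψ = −∫ g·ψ` for all smooth periodic vector fields `ψ`. -/
def HasWeakGradient {d : ℕ} (f : (Fin d → ℝ) → ℝ)
    (g : (Fin d → ℝ) → Fin d → ℝ) : Prop :=
  ∀ ψ : (Fin d → ℝ) → Fin d → ℝ,
    (∀ i, ContDiff ℝ (⊤ : ℕ∞) fun x => ψ x i) →
    (∀ i, SpacePeriodic fun x => ψ x i) →
    (∫ x in box d, f x * ∑ i, pd (fun y => ψ y i) i x)
      = - ∫ x in box d, ∑ i, g x i * ψ x i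

notation "pz" => (by positivity)

lemma mll {a b c : ℝ} (h : b ≤ c) (ha : 0 ≤ a) : a * b ≤ a * c := mul_le_mul_of_nonneg_left h ha
lemma mlr {a b c : ℝ} (h : b ≤ c) (ha : 0 ≤ a) : b * a ≤ c * a := mul_le_mul_of_nonneg_right h ha

section
abbrev Vd (d : ℕ) := Fin d → ℝ

abbrev ev {d : ℕ} (j : Fin d) : Vd d := Pi.single j (1:ℝ)

structure CP {d : ℕ} (f : Vd d → ℝ) : Prop where
  c : Continuous f
  p : SpacePeriodic f

def ip {d : ℕ} (f g : Vd d → ℝ) : ℝ := ∫ x in box d, f x * g x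

def nm {d : ℕ} (f : Vd d → ℝ) : ℝ := √(l2sq f)

variable {d : ℕ}

lemma box_compact : IsCompact (box d) := isCompact_Icc

lemma ion {f : Vd d → ℝ} (hf : Continuous f) : IntegrableOn f (box d) :=
  hf.continuousOn.integrableOn_compact box_compact

lemma box_ae : (box d) =ᵐ[volume] ZSpan.fundamentalDomain (Pi.basisFun ℝ (Fin d)) := by
  rw [ZSpan.fundamentalDomain_pi_basisFun]
  have := Measure.univ_pi_Ico_ae_eq_Icc (μ := fun _ : Fin d => (volume : Measure ℝ))
    (f := fun _ => 0) (g := fun _ => 1)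
  exact this.symm

lemma vol_box : volume (box d) =1 := by
  have : box d = Set.Icc (fun _ => 0) (fun _ => 1) := rfl
  rw [this, Real.volume_Icc_pi]; simp

lemma vol_box_real : volume.real (box d) =1 := by simp [Measure.real, vol_box]

instance : IsProbabilityMeasure (volume.restrict (box d)) :=
  ⟨by simp [vol_box]⟩

lemma int_trans {f : Vd d → ℝ} (hf : SpacePeriodic f) (v : Vd d) :
    ∫ x in box d, f (x + v) = ∫ x in box d, f x := by
  have hfd := ZSpan.isAddFundamentalDomain (Pi.basisFun ℝ (Fin d)) volume
  rw [setIntegral_congr_set box_ae, setIntegral_congr_set box_ae]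
  have h2 := hfd.vadd_of_comm v
  have hinv : ∀ (g : (Submodule.span ℤ (Set.range (Pi.basisFun ℝ (Fin d))))) (x : Vd d),
      f (g +ᵥ x) = f x := by
    rintro ⟨g, hg⟩ x
    rw [Module.Basis.mem_span_iff_repr_mem] at hg
    choose k hk using hg
    have : g = fun i => (k i : ℝ) := by
      ext i; have := hk i; simpa using this.symm
    change f (g + x) = f x
    rw [add_comm, this, hf]
  have : VAddInvariantMeasure (Submodule.span ℤ (Set.range (Pi.basisFun ℝ (Fin d)))) (Vd d)
      volume := ⟨fun g s _ => measure_preimage_add volume (g : Vd d) s⟩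
  rw [hfd.setIntegral_eq h2 hinv]
  set S := ZSpan.fundamentalDomain (Pi.basisFun ℝ (Fin d))
  have hm : MeasurePreserving (fun x : Vd d => x + v) volume volume :=
    measurePreserving_add_right volume v
  refine Eq.trans ?_ (hm.setIntegral_preimage_emb (MeasurableEquiv.addRight v).measurableEmbedding f _)
  congr 2
  ext x
  constructor
  · intro h; exact ⟨x, h, by simp [add_comm]⟩
  · rintro ⟨y, hy, h⟩
    have h' : v + y = x + v := h
    rw [add_comm] at h'
    exact add_right_cancel h' ▸ hy

lemma per1 {f : Vd d → ℝ} (hf : SpacePeriodic f) (x : Vd d) (j : Fin d) :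
    f (x + ev j) = f x := by
  have := hf x (Pi.single j 1)
  rw [← this]; congr 2; ext i
  by_cases h : i = j
  · subst h; simp
  · simp [h]

lemma per_line {f : Vd d → ℝ} (hf : SpacePeriodic f) (x : Vd d) (j : Fin d) :
    Function.Periodic (fun r : ℝ => f (x + r • ev j)) 1 := by
  intro r
  change f (x + (r+1) • ev j) = f (x + r • ev j)
  rw [add_smul, one_smul, ← add_assoc, per1 hf]

lemma CP.trans {f : Vd d → ℝ} (hf : CP f) (v : Vd d) : CP (fun x => f (x + v)) :=
  ⟨hf.c.comp (by fun_prop), fun x k => by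
    rw [show x + (fun i => (k i : ℝ)) + v = x + v + (fun i => (k i : ℝ)) by abel, hf.p]⟩

lemma swap_box {F : ℝ → Vd d → ℝ} (hF : Continuous (Function.uncurry F)) (a b : ℝ) :
    ∫ x in box d, ∫ r in a..b, F r x = ∫ r in a..b, ∫ x in box d, F r x := by
  have key : ∀ a b : ℝ, IntegrableOn (Function.uncurry F) (Set.Icc a b ×ˢ box d)
      (volume.prod volume) := fun a b =>
    hF.continuousOn.integrableOn_compact (isCompact_Icc.prod box_compact)
  have key2 : ∀ a b : ℝ, Integrable (Function.uncurry F)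
      ((volume.restrict (Set.Ioc a b)).prod (volume.restrict (box d))) := by
    intro a b
    rw [Measure.prod_restrict]
    exact (key a b).mono_set (Set.prod_mono Set.Ioc_subset_Icc_self le_rfl)
  rcases le_total a b with h | h
  · simp only [intervalIntegral.integral_of_le h]
    exact (integral_integral_swap (key2 a b)).symm
  · simp only [intervalIntegral.integral_of_ge h]
    rw [integral_neg, integral_integral_swap (key2 b a)]

lemma int_avg {f : Vd d → ℝ} (hf : CP f) (j : Fin d) :
    ∫ x in box d, ∫ r in (0:ℝ)..1, f (x + r • ev j) = ∫ x in box d, f x := by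
  rw [swap_box (F := fun r x => f (x + r • ev j)) (by have := hf.c; fun_prop)]
  simp [int_trans hf.p]

lemma int_shear {f w : Vd d → ℝ} (hf : CP f) (hw : CP w) (j : Fin d)
    (hwj : ∀ x (r : ℝ), w (x + r • ev j) = w x) :
    CP (fun x => f (x + w x • ev j)) ∧
    ∫ x in box d, f (x + w x • ev j) = ∫ x in box d, f x := by
  have hF : CP (fun x => f (x + w x • ev j)) := by
    refine ⟨by have := hf.c; have := hw.c; fun_prop, fun x k => ?_⟩
    rw [hw.p, add_right_comm, hf.p]
  refine ⟨hF, ?_⟩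
  rw [← int_avg hF j, ← int_avg hf j]
  congr 1; ext x
  simp only [hwj]
  have h1 : ∀ r : ℝ, f (x + r • ev j + w x • ev j) = (fun s : ℝ => f (x + s • ev j)) (r + w x) := by
    intro r; simp only [add_smul, add_assoc]
  simp only [h1]
  rw [intervalIntegral.integral_comp_add_right (fun s : ℝ => f (x + s • ev j))]
  have := (per_line hf.p x j).intervalIntegral_add_eq (w x) 0
  simpa [add_comm] using this

lemma pd_line {f : Vd d → ℝ} (hf : Differentiable ℝ f) (j : Fin d) (x : Vd d) (r : ℝ) :
    HasDerivAt (fun r : ℝ => f (x + r • ev j)) (pd f j (x + r • ev j)) r := by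
  have h1 : HasDerivAt (fun r : ℝ => x + r • ev j) (ev j) r := by
    simpa using ((hasDerivAt_id r).smul_const (ev j)).const_add x
  exact (hf _).hasFDerivAt.comp_hasDerivAt r h1

lemma per_fderiv {f : Vd d → ℝ} (hf : SpacePeriodic f) (x : Vd d) (k : Fin d → ℤ) :
    fderiv ℝ f (x + fun i => (k i : ℝ)) = fderiv ℝ f x := by
  have : f = fun x => f (x + fun i => (k i : ℝ)) := by ext y; rw [hf]
  conv_rhs => rw [this]
  rw [fderiv_comp_add_right]

lemma per_pd {f : Vd d → ℝ} (hf : SpacePeriodic f) (j : Fin d) : SpacePeriodic (pd f j) := by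
  intro x k; simp only [pd, per_fderiv hf]

lemma CP_pd {f : Vd d → ℝ} (hf : ContDiff ℝ 1 f) (hp : SpacePeriodic f) (j : Fin d) :
    CP (pd f j) :=
  ⟨by have := hf.continuous_fderiv one_ne_zero; unfold pd; fun_prop, per_pd hp j⟩

lemma int_w_pd {w f : Vd d → ℝ} (hw : CP w) (hf : ContDiff ℝ 1 f) (hp : SpacePeriodic f)
    (j : Fin d) (hwj : ∀ x (r : ℝ), w (x + r • ev j) = w x) :
    ∫ x in box d, w x * pd f j x =0 := by
  have hpd := CP_pd hf hp j
  have hF : CP (fun x => w x * pd f j x) :=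
    ⟨hw.c.mul hpd.c, fun x k => by simp only [hw.p x k, hpd.p x k]⟩
  rw [← int_avg hF j]
  have : ∀ x : Vd d, ∫ r in (0:ℝ)..1, w (x + r • ev j) * pd f j (x + r • ev j) =0 := by
    intro x
    simp only [hwj, intervalIntegral.integral_const_mul]
    rw [intervalIntegral.integral_eq_sub_of_hasDerivAt (f := fun r : ℝ => f (x + r • ev j))
      (fun r _ => pd_line (hf.differentiable one_ne_zero) j x r)]
    · have := per1 hp x j
      simp [this]
    · have := hpd.c
      exact Continuous.intervalIntegrable (by fun_prop) _ _
  simp [this]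

lemma pd_mul {f g : Vd d → ℝ} (hf : Differentiable ℝ f) (hg : Differentiable ℝ g) (j : Fin d)
    (x : Vd d) : pd (fun x => f x * g x) j x = f x * pd g j x + g x * pd f j x := by
  unfold pd
  rw [fderiv_fun_mul (hf x) (hg x)]
  simp [smul_eq_mul]

lemma SpacePeriodic.mul {f g : Vd d → ℝ} (hf : SpacePeriodic f) (hg : SpacePeriodic g) :
    SpacePeriodic (fun x => f x * g x) := fun x k => by simp only [hf x k, hg x k]

lemma SpacePeriodic.sub {f g : Vd d → ℝ} (hf : SpacePeriodic f) (hg : SpacePeriodic g) :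
    SpacePeriodic (fun x => f x - g x) := fun x k => by simp only [hf x k, hg x k]

lemma SpacePeriodic.add {f g : Vd d → ℝ} (hf : SpacePeriodic f) (hg : SpacePeriodic g) :
    SpacePeriodic (fun x => f x + g x) := fun x k => by simp only [hf x k, hg x k]

lemma SpacePeriodic.smul {f : Vd d → ℝ} (hf : SpacePeriodic f) (c : ℝ) :
    SpacePeriodic (fun x => c * f x) := fun x k => by simp only [hf x k]

lemma CP.mul {f g : Vd d → ℝ} (hf : CP f) (hg : CP g) : CP (fun x => f x * g x) :=
  ⟨hf.c.mul hg.c, hf.p.mul hg.p⟩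

lemma CP.sub {f g : Vd d → ℝ} (hf : CP f) (hg : CP g) : CP (fun x => f x - g x) :=
  ⟨hf.c.sub hg.c, hf.p.sub hg.p⟩

lemma CP.add {f g : Vd d → ℝ} (hf : CP f) (hg : CP g) : CP (fun x => f x + g x) :=
  ⟨hf.c.add hg.c, hf.p.add hg.p⟩

lemma CP.smul {f : Vd d → ℝ} (hf : CP f) (c : ℝ) : CP (fun x => c * f x) :=
  ⟨hf.c.const_mul c, hf.p.smul c⟩

lemma CP.sum {ι : Type*} (s : Finset ι) {f : ι → Vd d → ℝ} (hf : ∀ i, CP (f i)) :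
    CP (fun x => ∑ i ∈ s, f i x) :=
  ⟨continuous_finsetSum _ fun i _ => (hf i).c, fun x k => by simp only [(hf _).p x k]⟩

lemma ibp {f g w : Vd d → ℝ} (hf : ContDiff ℝ 1 f) (hfp : SpacePeriodic f) (hg : ContDiff ℝ 1 g)
    (hgp : SpacePeriodic g) (hw : CP w) (j : Fin d) (hwj : ∀ x (r : ℝ), w (x + r • ev j) = w x) :
    ∫ x in box d, w x * pd f j x * g x = - ∫ x in box d, w x * f x * pd g j x := by
  have h := int_w_pd hw (hf.mul hg) (hfp.mul hgp) j hwj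
  simp only [pd_mul (hf.differentiable one_ne_zero) (hg.differentiable one_ne_zero), mul_add] at h
  have c1 := (CP_pd hf hfp j).c
  have c2 := (CP_pd hg hgp j).c
  have := hw.c; have := hf.continuous; have := hg.continuous
  rw [integral_add (ion (by fun_prop)) (ion (by fun_prop))] at h
  have e1 : ∫ x in box d, w x * pd f j x * g x = ∫ x in box d, w x * (g x * pd f j x) := by
    congr 1; ext x; ring
  have e2 : ∫ x in box d, w x * f x * pd g j x = ∫ x in box d, w x * (f x * pd g j x) := by
    congr 1; ext x; ring
  rw [e1, e2]; linarith

lemma ibp_ip {f g : Vd d → ℝ} (hf : ContDiff ℝ 1 f) (hfp : SpacePeriodic f) (hg : ContDiff ℝ 1 g)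
    (hgp : SpacePeriodic g) (j : Fin d) : ip (pd f j) g = - ip f (pd g j) := by
  have := ibp hf hfp hg hgp (w := fun _ => 1) ⟨continuous_const, fun _ _ => rfl⟩ j (fun _ _ => rfl)
  simpa [ip] using this

end

section
variable {d : ℕ}

lemma ip_comm (f g : Vd d → ℝ) : ip f g = ip g f := by simp only [ip, mul_comm]

lemma ip_add {f g h : Vd d → ℝ} (hf : Continuous f) (hg : Continuous g) (hh : Continuous h) :
    ip (fun x => f x + g x) h = ip f h + ip g h := by
  unfold ip
  rw [← integral_add (ion (by fun_prop)) (ion (by fun_prop))]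
  simp only [add_mul]

lemma ip_sub {f g h : Vd d → ℝ} (hf : Continuous f) (hg : Continuous g) (hh : Continuous h) :
    ip (fun x => f x - g x) h = ip f h - ip g h := by
  unfold ip
  rw [← integral_sub (ion (by fun_prop)) (ion (by fun_prop))]
  simp only [sub_mul]

lemma ip_smul (c : ℝ) (f h : Vd d → ℝ) : ip (fun x => c * f x) h = c * ip f h := by
  unfold ip
  rw [← integral_const_mul]; simp only [mul_assoc]

lemma ip_sum {ι : Type*} (s : Finset ι) {f : ι → Vd d → ℝ} {g : Vd d → ℝ}
    (hf : ∀ i, Continuous (f i)) (hg : Continuous g) :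
    ip (fun x => ∑ i ∈ s, f i x) g = ∑ i ∈ s, ip (f i) g := by
  unfold ip
  rw [← integral_finsetSum (f := fun i x => f i x * g x) _
    fun i _ => ion ((hf i).mul hg)]
  simp only [Finset.sum_mul]

lemma l2sq_eq (f : Vd d → ℝ) : l2sq f = ip f f := by simp only [l2sq, ip, sq]

lemma l2sq_nonneg (f : Vd d → ℝ) : 0 ≤ l2sq f := integral_nonneg fun x => sq_nonneg _

lemma nm_nonneg (f : Vd d → ℝ) : 0 ≤ nm f := sqrt_nonneg _

lemma nm_sq (f : Vd d → ℝ) : nm f^2 = ip f f := by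
  rw [nm, sq_sqrt (l2sq_nonneg f), l2sq_eq]

lemma cauchy {f g : Vd d → ℝ} (hf : Continuous f) (hg : Continuous g) :
    |ip f g| ≤ nm f * nm g := by
  have h : ∀ s : ℝ, 0 ≤ ip g g * (s * s) + (2 * ip f g) * s + ip f f := by
    intro s
    have h0 := l2sq_nonneg (fun x => f x + s * g x)
    rw [l2sq_eq, ip_add hf (by fun_prop) (by fun_prop), ip_smul, ip_comm f, ip_comm g,
      ip_add hf (by fun_prop) (by fun_prop), ip_add hf (by fun_prop) (by fun_prop),
      ip_smul, ip_smul, ip_comm g f] at h0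
    linarith
  have h1 := discrim_le_zero h
  unfold discrim at h1
  apply abs_le_of_sq_le_sq' _ (by positivity [nm_nonneg f, nm_nonneg g]) |> abs_le.mpr
  rw [mul_pow, nm_sq, nm_sq]; nlinarith

lemma ip_le {f g : Vd d → ℝ} (hf : Continuous f) (hg : Continuous g) : ip f g ≤ nm f * nm g :=
  (le_abs_self _).trans (cauchy hf hg)

lemma nm_add_sq {f g : Vd d → ℝ} (hf : Continuous f) (hg : Continuous g) :
    nm (fun x => f x + g x)^2 = nm f^2+2 * ip f g + nm g^2 := by
  rw [nm_sq, nm_sq, nm_sq, ip_add hf hg (by fun_prop), ip_comm f, ip_comm g,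
    ip_add hf hg hf, ip_add hf hg hg, ip_comm g f]; ring

lemma nm_sub_sq {f g : Vd d → ℝ} (hf : Continuous f) (hg : Continuous g) :
    nm (fun x => f x - g x)^2 = nm f^2 - 2 * ip f g + nm g^2 := by
  rw [nm_sq, nm_sq, nm_sq, ip_sub hf hg (by fun_prop), ip_comm f, ip_comm g,
    ip_sub hf hg hf, ip_sub hf hg hg, ip_comm g f]; ring

lemma nm_add {f g : Vd d → ℝ} (hf : Continuous f) (hg : Continuous g) :
    nm (fun x => f x + g x) ≤ nm f + nm g := by
  apply le_of_sq_le_sq _ (add_nonneg (nm_nonneg f) (nm_nonneg g))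
  rw [nm_add_sq hf hg]; nlinarith [ip_le hf hg]

lemma nm_sub {f g : Vd d → ℝ} (hf : Continuous f) (hg : Continuous g) :
    nm (fun x => f x - g x) ≤ nm f + nm g := by
  apply le_of_sq_le_sq _ (add_nonneg (nm_nonneg f) (nm_nonneg g))
  rw [nm_sub_sq hf hg]; nlinarith [(abs_le.1 (cauchy hf hg)).1]

lemma nm_smul (c : ℝ) (f : Vd d → ℝ) : nm (fun x => c * f x) = |c| * nm f := by
  rw [← sq_eq_sq₀ (nm_nonneg _) (mul_nonneg (abs_nonneg c) (nm_nonneg f)), mul_pow, nm_sq, nm_sq,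
    ip_smul, ip_comm, ip_smul, sq_abs]; ring

lemma nm_tri {f g h : Vd d → ℝ} (hf : Continuous f) (hg : Continuous g) (hh : Continuous h) :
    nm (fun x => f x - h x) ≤ nm (fun x => f x - g x) + nm (fun x => g x - h x) := by
  have := nm_add (f := fun x => f x - g x) (g := fun x => g x - h x) (by fun_prop) (by fun_prop)
  simpa using this

lemma nm_sub_comm (f g : Vd d → ℝ) : nm (fun x => f x - g x) = nm (fun x => g x - f x) := by
  unfold nm l2sq; congr 2; ext x; ring

lemma nm_mono {f g : Vd d → ℝ} (hf : Continuous f) (hg : Continuous g) (h : ∀ x, |f x| ≤ |g x|) :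
    nm f ≤ nm g := by
  apply sqrt_le_sqrt
  exact integral_mono (ion (by fun_prop)) (ion (by fun_prop)) fun x => sq_le_sq.2 (h x)

lemma nm_const (c : ℝ) : nm (fun _ : Vd d => c) = |c| := by
  unfold nm l2sq; simp [vol_box_real, sqrt_sq_eq_abs]

lemma nm_le {f : Vd d → ℝ} (hf : Continuous f) {c : ℝ} (h : ∀ x, |f x| ≤ c) : nm f ≤ c := by
  have hc : 0 ≤ c := (abs_nonneg _).trans (h 0)
  have := nm_mono hf continuous_const (g := fun _ => c) (fun x => (h x).trans (le_abs_self c))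
  rwa [nm_const, abs_of_nonneg hc] at this

lemma nm_trans {f : Vd d → ℝ} (hf : CP f) (v : Vd d) : nm (fun x => f (x + v)) = nm f := by
  unfold nm l2sq
  rw [int_trans (f := fun x => f x^2) (fun x k => by simp only [hf.p x k])]

lemma nm_shear {f w : Vd d → ℝ} (hf : CP f) (hw : CP w) (j : Fin d)
    (hwj : ∀ x (r : ℝ), w (x + r • ev j) = w x) :
    nm (fun x => f (x + w x • ev j)) = nm f := by
  unfold nm l2sq
  rw [(int_shear (f := fun x => f x^2) ⟨hf.c.pow 2, fun x k => by simp only [hf.p x k]⟩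
    hw j hwj).2]

lemma cont_lineint {f : Vd d → ℝ} (hf : Continuous f) (v : Vd d) (a b : ℝ) :
    Continuous (fun x => ∫ s in a..b, f (x + s • v)) := by
  apply intervalIntegral.continuous_parametric_intervalIntegral_of_continuous'
  fun_prop

lemma CP_lineint {f : Vd d → ℝ} (hf : CP f) (v : Vd d) (a b : ℝ) :
    CP (fun x => ∫ s in a..b, f (x + s • v)) :=
  ⟨cont_lineint hf.c v a b, fun x k => by
    have : ∀ s : ℝ, x + (fun i => (k i : ℝ)) + s • v = x + s • v + (fun i => (k i : ℝ)) := by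
      intro s; abel
    simp only [this, hf.p _ k]⟩

lemma nm_lineint {f : Vd d → ℝ} (hf : CP f) (v : Vd d) {a b : ℝ} (hab : a ≤ b) :
    nm (fun x => ∫ s in a..b, f (x + s • v)) ≤ (b - a) * nm f := by
  set Y := fun x => ∫ s in a..b, f (x + s • v) with hY
  have hc : Continuous Y := cont_lineint hf.c v a b
  have hfc := hf.c
  have h1 : nm Y^2 = ∫ s in a..b, ip (fun x => f (x + s • v)) Y := by
    unfold ip
    rw [nm_sq, ip, ← swap_box (F := fun s x => f (x + s • v) * Y x) (by fun_prop)]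
    congr 1; ext x
    rw [intervalIntegral.integral_mul_const]
  have h2 : ‖∫ s in a..b, ip (fun x => f (x + s • v)) Y‖ ≤ (nm f * nm Y) * |b - a| := by
    apply intervalIntegral.norm_integral_le_of_norm_le_const
    intro s _
    have := cauchy (f := fun x => f (x + s • v)) (g := Y) (by fun_prop) hc
    rwa [nm_trans hf] at this
  rw [← h1, norm_of_nonneg (sq_nonneg _), abs_of_nonneg (by linarith)] at h2
  rcases (nm_nonneg Y).eq_or_lt with h | h
  · rw [← h]; exact mul_nonneg (by linarith) (nm_nonneg f)
  · by_contra hh; push Not at hh; nlinarith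

lemma line_diff {f : Vd d → ℝ} (hf : ContDiff ℝ 1 f) (j : Fin d) (x : Vd d) (r : ℝ) :
    f (x + r • ev j) - f x = ∫ s in (0:ℝ)..r, pd f j (x + s • ev j) := by
  rw [intervalIntegral.integral_eq_sub_of_hasDerivAt (f := fun r : ℝ => f (x + r • ev j))
      (fun r _ => pd_line (hf.differentiable one_ne_zero) j x r)]
  · simp
  · have := hf.continuous_fderiv one_ne_zero
    unfold pd
    exact Continuous.intervalIntegrable (by fun_prop) _ _

lemma nm_line_diff {f : Vd d → ℝ} (hf : ContDiff ℝ 1 f) (hp : SpacePeriodic f) (j : Fin d)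
    {r : ℝ} (hr : 0 ≤ r) : nm (fun x => f (x + r • ev j) - f x) ≤ r * nm (pd f j) := by
  simp only [line_diff hf]
  simpa using nm_lineint (CP_pd hf hp j) (ev j) hr

lemma CP.bdd {f : Vd d → ℝ} (hf : CP f) : ∃ C : ℝ, 0 ≤ C ∧ ∀ x, |f x| ≤ C := by
  obtain ⟨C, hC⟩ := (box_compact (d := d)).exists_bound_of_continuousOn hf.c.continuousOn
  refine ⟨C, (norm_nonneg _).trans (hC 0 ⟨le_rfl, fun i => by simp⟩), fun x => ?_⟩
  have h := hf.p (fun i => Int.fract (x i)) (fun i => ⌊x i⌋)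
  have h2 : ((fun i => Int.fract (x i)) + fun i => (⌊x i⌋ : ℝ)) = x := by
    ext i; simp [Int.fract_add_floor]
  rw [h2] at h; rw [h]
  exact hC _ ⟨fun i => Int.fract_nonneg _, fun i => (Int.fract_lt_one _).le⟩

lemma exists_box (x : Vd d) : ∃ k : Fin d → ℤ, x + (fun i => (k i : ℝ)) ∈ box d := by
  refine ⟨fun i => -⌊x i⌋, fun i => ?_, fun i => ?_⟩
  · have := Int.floor_le (x i); simp; linarith
  · have := Int.lt_floor_add_one (x i); simp; linarith

lemma CP.uc {f : Vd d → ℝ} (hf : CP f) {ε : ℝ} (hε : 0 < ε) :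
    ∃ δ > 0, ∀ x y : Vd d, ‖x - y‖ < δ → |f x - f y| < ε := by
  have hK : IsCompact (Metric.closedBall (0 : Vd d) 3) := isCompact_closedBall _ _
  have hu := hK.uniformContinuousOn_of_continuous hf.c.continuousOn
  rw [Metric.uniformContinuousOn_iff] at hu
  obtain ⟨δ, hδ, h⟩ := hu ε hε
  refine ⟨min δ 1, lt_min hδ one_pos, fun x y hxy => ?_⟩
  obtain ⟨k, hk⟩ := exists_box x
  have hx : ‖x + fun i => (k i : ℝ)‖ ≤1 := by
    rw [pi_norm_le_iff_of_nonneg zero_le_one]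
    intro i
    rw [norm_of_nonneg (hk.1 i)]; exact hk.2 i
  have hxy1 : ‖x - y‖ <1 := hxy.trans_le (min_le_right _ _)
  have hy : ‖y + fun i => (k i : ℝ)‖ ≤2 := by
    have : (y + fun i => (k i : ℝ)) = (x + fun i => (k i : ℝ)) - (x - y) := by abel
    rw [this]; exact (norm_sub_le _ _).trans (by linarith)
  have := h (x + fun i => (k i : ℝ)) (by simp; linarith) (y + fun i => (k i : ℝ))
    (by simp; linarith)
    (by rw [dist_eq_norm, add_sub_add_right_eq_sub]; exact hxy.trans_le (min_le_left _ _))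
  rwa [hf.p, hf.p, Real.dist_eq] at this

end

section
variable {d : ℕ}

def bump {d : ℕ} (δ : ℝ) (hδ : 0 < δ) : ContDiffBump (0 : Vd d) :=
  ⟨δ/2, δ, by linarith, by linarith⟩

def moll {d : ℕ} (δ : ℝ) (hδ : 0 < δ) (f : Vd d → ℝ) (x : Vd d) : ℝ :=
  ∫ t, (bump δ hδ).normed volume t * f (x - t)

lemma moll_eq (δ : ℝ) (hδ : 0 < δ) (f : Vd d → ℝ) :
    moll δ hδ f = convolution ((bump δ hδ).normed volume) f (ContinuousLinearMap.lsmul ℝ ℝ) volume := by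
  ext x; simp [moll, convolution]

lemma moll_smooth {δ : ℝ} (hδ : 0 < δ) {f : Vd d → ℝ} (hf : Continuous f) :
    ContDiff ℝ (⊤ : ℕ∞) (moll δ hδ f) := by
  rw [moll_eq]
  exact (bump δ hδ).hasCompactSupport_normed.contDiff_convolution_left _
    (bump δ hδ).contDiff_normed hf.locallyIntegrable

lemma moll_per {δ : ℝ} (hδ : 0 < δ) {f : Vd d → ℝ} (hf : SpacePeriodic f) :
    SpacePeriodic (moll δ hδ f) := by
  intro x k
  unfold moll
  congr 1; ext t
  rw [add_sub_right_comm, hf]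

lemma moll_close {δ ε : ℝ} (hδ : 0 < δ) {f : Vd d → ℝ} (hf : Continuous f)
    (h : ∀ x y : Vd d, ‖x - y‖ < δ → |f x - f y| < ε) (x : Vd d) : |moll δ hδ f x - f x| ≤ ε := by
  rw [moll_eq, ← Real.dist_eq]
  apply (bump δ hδ).dist_normed_convolution_le hf.aestronglyMeasurable
  intro y hy
  rw [Real.dist_eq]
  exact (h y x (by rw [← dist_eq_norm]; exact hy)).le

lemma moll_ip {δ : ℝ} (hδ : 0 < δ) {f ψ : Vd d → ℝ} (hf : Continuous f) (hψ : Continuous ψ) :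
    ip (moll δ hδ f) ψ =
      ∫ t, (bump (d := d) δ hδ).normed volume t * ip (fun x => f (x - t)) ψ := by
  set η := (bump (d := d) δ hδ).normed volume with hη
  have hηc : Continuous η := (bump δ hδ).continuous_normed
  have hs : ∀ t, t ∉ Metric.closedBall (0 : Vd d) δ → η t =0 := by
    intro t ht
    by_contra h
    have : t ∈ Function.support η := h
    rw [hη, ContDiffBump.support_normed_eq] at this
    exact ht (Metric.ball_subset_closedBall this)
  unfold ip moll
  simp only [← integral_mul_const, ← integral_const_mul]
  have h1 : ∀ F : Vd d → ℝ, (∀ t, η t =0 → F t =0) → ∫ t, F t =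
      ∫ t in Metric.closedBall (0 : Vd d) δ, F t := by
    intro F hF
    exact (setIntegral_eq_integral_of_forall_compl_eq_zero fun t ht => hF t (hs t ht)).symm
  have e1 : ∀ x : Vd d, ∫ t, η t * f (x - t) * ψ x =
      ∫ t in Metric.closedBall (0 : Vd d) δ, η t * f (x - t) * ψ x :=
    fun x => h1 _ fun t ht => by simp [ht]
  rw [h1 _ (fun t ht => by simp [ht])]
  simp only [← hη, e1]
  rw [integral_integral_swap]
  · simp only [mul_assoc]
  · rw [Measure.prod_restrict]
    apply ContinuousOn.integrableOn_compact (box_compact.prod (isCompact_closedBall _ _))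
    apply Continuous.continuousOn
    fun_prop

lemma eta_int {δ : ℝ} (hδ : 0 < δ) : ∫ t, (bump (d := d) δ hδ).normed volume t =1 :=
  (bump δ hδ).integral_normed

lemma approxC2 {f : Vd d → ℝ} (hf : CP f) {ε : ℝ} (hε : 0 < ε) :
    ∃ g : Vd d → ℝ, ContDiff ℝ 2 g ∧ SpacePeriodic g ∧ ∀ x, |g x - f x| ≤ ε := by
  obtain ⟨δ, hδ, h⟩ := hf.uc hε
  exact ⟨moll δ hδ f, (moll_smooth hδ hf.c).of_le (WithTop.coe_le_coe.2 le_top), moll_per hδ hf.p,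
    moll_close hδ hf.c h⟩

lemma young_inv {A B I : ℝ} (hA : 0 ≤ A) (hB : 0 ≤ B)
    (h : ∀ s : ℝ, 0 < s → I ≤ s/2 * A^2+1 / (2 * s) * B^2) : I ≤ A * B := by
  rcases hA.eq_or_lt with rfl | hA'
  · by_contra hI
    push Not at hI
    have hI0 : 0 < I := by linarith
    have := h (B^2 / I+1) pz
    have h3 : 1 / (2 * (B^2 / I+1)) * B^2 < I := by
      rw [div_mul_eq_mul_div, one_mul, div_lt_iff₀ pz]
      have : I * (2 * (B^2 / I+1)) =2 * B^2+2 * I := by field_simp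
      nlinarith [sq_nonneg B]
    linarith
  rcases hB.eq_or_lt with rfl | hB'
  · by_contra hI
    push Not at hI
    have hI0 : 0 < I := by linarith
    have := h (I / A^2) pz
    have h3 : I / A^2/2 * A^2 = I/2 := by field_simp
    linarith
  · have := h (B / A) pz
    have e : B / A/2 * A^2+1 / (2 * (B / A)) * B^2 = A * B := by field_simp; ring
    linarith

lemma weak_ip_le {g : Vd d → Fin d → ℝ} (hg : IntegrableOn (fun x => ∑ i, (g x i)^2) (box d))
    {v : Vd d → ℝ} (hv : Continuous v) (l : Fin d) :
    |∫ x in box d, g x l * v x| ≤ √(∫ x in box d, ∑ i, (g x i)^2) * nm v := by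
  set Γ := √(∫ x in box d, ∑ i, (g x i)^2) with hΓ
  have hn : 0 ≤ ∫ x in box d, ∑ i, (g x i)^2 :=
    integral_nonneg fun x => Finset.sum_nonneg fun i _ => sq_nonneg _
  have hΓ2 : Γ^2 = ∫ x in box d, ∑ i, (g x i)^2 := sq_sqrt hn
  have hΓ0 : 0 ≤ Γ := sqrt_nonneg _
  have key : ∀ s : ℝ, 0 < s → |∫ x in box d, g x l * v x| ≤ s/2 * Γ^2+1 / (2 * s) * nm v^2 := by
    intro s hs
    rw [hΓ2, nm_sq, ip, ← integral_const_mul, ← integral_const_mul,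
      ← integral_add (hg.const_mul _) (ion (by fun_prop))]
    rw [← Real.norm_eq_abs]
    apply norm_integral_le_of_norm_le ((hg.const_mul _).add (ion (by fun_prop)))
    filter_upwards with x
    have h1 : (g x l)^2 ≤ ∑ i, (g x i)^2 :=
      Finset.single_le_sum (f := fun i => (g x i)^2) (fun i _ => sq_nonneg _) (Finset.mem_univ l)
    have h2 : |g x l * v x| ≤ s/2 * (g x l)^2+1 / (2 * s) * (v x * v x) := by
      have e : s/2 * (g x l)^2+1 / (2 * s) * (v x * v x) =
        ((s * g x l)^2 + v x^2) / (2 * s) := by field_simp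
      rw [e, le_div_iff₀ pz, abs_mul]
      have e1 := sq_abs (g x l)
      have e2 := sq_abs (v x)
      have e3 : (s * g x l)^2 = s^2 * |g x l| ^ 2 := by rw [e1]; ring
      rw [e3, ← e2]
      nlinarith [sq_nonneg (s * |g x l| - |v x|)]
    rw [norm_eq_abs]
    refine h2.trans ?_
    have : s/2 * (g x l)^2 ≤ s/2 * ∑ i, (g x i)^2 :=
      mll h1 pz
    simpa using this
  exact young_inv hΓ0 (nm_nonneg v) key


lemma pd_trans (v : Vd d → ℝ) (t : Vd d) (l : Fin d) (x : Vd d) :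
    pd (fun y => v (y + t)) l x = pd v l (x + t) := by
  unfold pd; rw [fderiv_comp_add_right]

lemma weak_pd {f : Vd d → ℝ} {g : Vd d → Fin d → ℝ} (hw : HasWeakGradient f g) {v : Vd d → ℝ}
    (hv : ContDiff ℝ (⊤ : ℕ∞) v) (hp : SpacePeriodic v) (l : Fin d) :
    ∫ x in box d, f x * pd v l x = - ∫ x in box d, g x l * v x := by
  have := hw (fun x i => if i = l then v x else 0)
    (fun i => by by_cases h : i = l <;> simp [h, hv, contDiff_const])
    (fun i => by by_cases h : i = l <;> simp [h, hp]; intro x k; simp)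
  have e1 : ∀ x, ∑ i, pd (fun y => if i = l then v y else 0) i x = pd v l x := by
    intro x
    rw [Finset.sum_eq_single l]
    · simp
    · intro i _ hi; simp [hi, pd]
    · simp
  simp only [e1] at this
  simpa using this

lemma smooth_pd {v : Vd d → ℝ} (hv : ContDiff ℝ (⊤ : ℕ∞) v) (l : Fin d) :
    ContDiff ℝ (⊤ : ℕ∞) (pd v l) := by
  have : ContDiff ℝ (⊤ : ℕ∞) (fderiv ℝ v) := hv.fderiv_right (by simp)
  exact this.clm_apply contDiff_const

lemma prep {f : Vd d → ℝ} {g : Vd d → Fin d → ℝ} (hf : CP f)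
    (hg : IntegrableOn (fun x => ∑ i, (g x i)^2) (box d)) (hw : HasWeakGradient f g)
    (h0 : ∫ x in box d, f x =0) {ε : ℝ} (hε : 0 < ε) :
    ∃ f0 : Vd d → ℝ, ContDiff ℝ 2 f0 ∧ SpacePeriodic f0 ∧ (∀ x, |f0 x - f x| ≤ ε) ∧
      (∫ x in box d, f0 x =0) ∧ ∀ l, nm (pd f0 l) ≤ √(∫ x in box d, ∑ i, (g x i)^2) := by
  obtain ⟨δ, hδ, h⟩ := hf.uc hε
  set f0 := moll δ hδ f with hf0
  have hs : ContDiff ℝ (⊤ : ℕ∞) f0 := moll_smooth hδ hf.c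
  have hs1 : ContDiff ℝ 1 f0 := hs.of_le (WithTop.coe_le_coe.2 le_top)
  have hp : SpacePeriodic f0 := moll_per hδ hf.p
  refine ⟨f0, hs.of_le (WithTop.coe_le_coe.2 le_top), hp, moll_close hδ hf.c h, ?_, fun l => ?_⟩
  · have := moll_ip hδ hf.c (ψ := fun _ => 1) continuous_const
    simp only [ip, mul_one, sub_eq_add_neg, int_trans hf.p, h0] at this
    simpa using this
  · set v := pd f0 l with hv
    have hvs : ContDiff ℝ (⊤ : ℕ∞) v := smooth_pd hs l
    have hvp : SpacePeriodic v := per_pd hp l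
    have hv1 : ContDiff ℝ 1 v := hvs.of_le (WithTop.coe_le_coe.2 le_top)
    set Γ := √(∫ x in box d, ∑ i, (g x i)^2)
    have e1 : nm v^2 = - ip f0 (pd v l) := by
      rw [nm_sq, ← ibp_ip hs1 hp hv1 hvp l]
    rw [hf0, moll_ip hδ hf.c (CP_pd hv1 hvp l).c] at e1
    have e2 : ∀ t : Vd d, |ip (fun x => f (x - t)) (pd v l)| ≤ Γ * nm v := by
      intro t
      have a1 : ip (fun x => f (x - t)) (pd v l) = ∫ x in box d, f x * pd (fun y => v (y + t)) l x := by
        simp only [pd_trans]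
        rw [← int_trans (f := fun x => f x * pd v l (x + t)) _ (-t)]
        · simp [ip, sub_eq_add_neg]
        · exact hf.p.mul (CP.trans (CP_pd hv1 hvp l) t).p
      rw [a1, weak_pd hw (v := fun y => v (y + t)) (hvs.comp (by fun_prop)) (CP.trans ⟨hv1.continuous, hvp⟩ t).p, abs_neg]
      have := weak_ip_le hg (v := fun y => v (y + t)) (hv1.continuous.comp (by fun_prop)) l
      rwa [nm_trans ⟨hv1.continuous, hvp⟩] at this
    have e3 : nm v^2 ≤ Γ * nm v := by
      rw [e1]
      refine (neg_le_abs _).trans ?_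
      rw [← norm_eq_abs]
      have := norm_integral_le_of_norm_le
        (f := fun t => (bump (d := d) δ hδ).normed volume t * ip (fun x => f (x - t)) (pd v l))
        (g := fun t => (bump (d := d) δ hδ).normed volume t * (Γ * nm v))
        (μ := volume)
        ((bump δ hδ).integrable_normed.mul_const _)
        (by
          filter_upwards with t
          rw [norm_mul, norm_of_nonneg ((bump δ hδ).nonneg_normed t)]
          exact mll (e2 t) ((bump δ hδ).nonneg_normed t))
      rwa [integral_mul_const, eta_int, one_mul] at this
    rcases (nm_nonneg v).eq_or_lt with h | h
    · rw [← h]; exact sqrt_nonneg _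
    · exact le_of_mul_le_mul_right (by rw [← sq]; exact e3) h

end

section
variable {d : ℕ}

lemma C1_pd {f : Vd d → ℝ} (hf : ContDiff ℝ 2 f) (l : Fin d) : ContDiff ℝ 1 (pd f l) := by
  have : ContDiff ℝ 1 (fderiv ℝ f) := hf.fderiv_right (by norm_num)
  exact this.clm_apply contDiff_const

lemma second_le {f : Vd d → ℝ} (hf : ContDiff ℝ 2 f) {x : Vd d} (hx : IsLocalMax f x)
    (i : Fin d) : pd (pd f i) i x ≤0 := by
  by_contra h
  push Not at h
  set g := fun r : ℝ => f (x + r • ev i) with hg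
  have hd1 : deriv g = fun r => pd f i (x + r • ev i) := by
    ext r; exact (pd_line (hf.differentiable two_ne_zero) i x r).deriv
  have hd2 : deriv (deriv g) 0 = pd (pd f i) i x := by
    rw [hd1]
    have := (pd_line ((C1_pd hf i).differentiable one_ne_zero) i x 0).deriv
    simpa using this
  have hmax : IsLocalMax g 0 := by
    have hc : ContinuousAt (fun r : ℝ => x + r • ev i) 0 := by fun_prop
    have hx' : IsLocalMax f (x + (0:ℝ) • ev i) := by simpa using hx
    exact hc.eventually hx'
  have hmin : IsLocalMin g 0 := by
    apply isLocalMin_of_deriv_deriv_pos (by rw [hd2]; exact h) hmax.deriv_eq_zero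
    have := hf.continuous
    fun_prop
  have hconst : g =ᶠ[𝓝 0] fun _ => g 0 := by
    filter_upwards [hmax, hmin] with r h1 h2 using le_antisymm h1 h2
  have h3 : deriv (deriv g) 0 =0 := by
    have := hconst.deriv.deriv_eq
    rw [this]; simp
  linarith

lemma left_max {g : ℝ → ℝ} {t0 t : ℝ} (h : t0 < t) (hd : DifferentiableAt ℝ g t)
    (hm : ∀ s ∈ Set.Ioo t0 t, g s ≤ g t) : 0 ≤ deriv g t := by
  have h1 := (hasDerivAt_iff_tendsto_slope_left_right.1 hd.hasDerivAt).1
  apply ge_of_tendsto h1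
  filter_upwards [Ioo_mem_nhdsLT h] with s hs
  rw [slope_def_field]
  exact div_nonneg_of_nonpos (by linarith [hm s hs]) (by linarith [hs.2])

lemma maxp {u : ℝ → Vd d → Fin d → ℝ} {κ t0 t1 S : ℝ} (hκ : 0 ≤ κ) {w : ℝ → Vd d → ℝ}
    (h01 : t0 ≤ t1)
    (hp : ∀ t, SpacePeriodic (w t))
    (hc : ContinuousOn (fun p : ℝ × Vd d => w p.1 p.2) (Set.Icc t0 t1 ×ˢ Set.univ))
    (hd : ∀ t ∈ Set.Ioc t0 t1, ∀ x, DifferentiableAt ℝ (fun s => w s x) t)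
    (h2 : ∀ t ∈ Set.Ioc t0 t1, ContDiff ℝ 2 (w t))
    (hle : ∀ t ∈ Set.Ioc t0 t1, ∀ x, deriv (fun s => w s x) t + ∑ i, u t x i * pd (w t) i x
      - κ * ∑ i, pd (pd (w t) i) i x ≤ S)
    (h0 : ∀ x, w t0 x ≤0) : ∀ x, w t1 x ≤ S * (t1 - t0) := by
  intro x
  apply le_of_forall_pos_le_add
  intro ε hε
  set η := ε / (t1 - t0+1) with hη
  have hη0 : 0 < η := div_pos hε (by linarith)
  have hηε : η * (t1 - t0) ≤ ε := by
    rw [hη, div_mul_eq_mul_div, div_le_iff₀ (by linarith)]; nlinarith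
  set V := fun p : ℝ × Vd d => w p.1 p.2 - (S + η) * (p.1 - t0) with hV
  have hVc : ContinuousOn V (Set.Icc t0 t1 ×ˢ box d) :=
    (hc.mono (Set.prod_mono le_rfl (Set.subset_univ _))).sub (by fun_prop)
  obtain ⟨⟨t, y⟩, ⟨ht, hy⟩, hmax⟩ := (isCompact_Icc.prod (box_compact (d := d))).exists_isMaxOn
    ⟨(t0, 0), ⟨⟨le_rfl, h01⟩, ⟨le_rfl, fun i => by simp⟩⟩⟩ hVc
  have hmax' : ∀ s ∈ Set.Icc t0 t1, ∀ z, V (s, z) ≤ V (t, y) := by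
    intro s hs z
    obtain ⟨k, hk⟩ := exists_box z
    have := hmax (show (s, z + fun i => (k i : ℝ)) ∈ _ from ⟨hs, hk⟩)
    simpa [hV, hp s z k] using this
  suffices V (t, y) ≤0 by
    have h := hmax' t1 ⟨h01, le_rfl⟩ x
    simp only [hV] at h this
    nlinarith
  rcases ht.1.eq_or_lt with h | h
  · have h : t0 = t := h
    simp only [hV]; rw [← h]; simpa using h0 y
  · exfalso
    have htm : t ∈ Set.Ioc t0 t1 := ⟨h, ht.2⟩
    have hle' := hle t htm y
    have hlm : IsLocalMax (w t) y := by
      apply Filter.Eventually.of_forall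
      intro z
      have := hmax' t ht z
      simp only [hV] at this
      linarith
    have hpd : ∀ i, pd (w t) i y =0 := by
      intro i; simp [pd, hlm.fderiv_eq_zero]
    have hsum : ∑ i, pd (pd (w t) i) i y ≤0 :=
      Finset.sum_nonpos fun i _ => second_le (h2 t htm) hlm i
    have hdw := hd t htm y
    have hder := left_max (g := fun s => w s y - (S + η) * (s - t0)) h (by fun_prop)
      (fun s hs => hmax' s ⟨hs.1.le, hs.2.le.trans ht.2⟩ y)
    have hder2 : deriv (fun s => w s y - (S + η) * (s - t0)) t
        = deriv (fun s => w s y) t - (S + η) := by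
      have := hdw.hasDerivAt.fun_sub (((hasDerivAt_id t).sub_const t0).const_mul (S + η))
      simpa using this.deriv
    simp only [hpd, mul_zero, Finset.sum_const_zero] at hle'
    nlinarith

lemma unif_t {F : ℝ → Vd d → ℝ} (hF : Continuous (fun p : ℝ × Vd d => F p.1 p.2))
    (hp : ∀ t, SpacePeriodic (F t)) (t0 : ℝ) {ε : ℝ} (hε : 0 < ε) :
    ∃ δ > 0, ∀ t, |t - t0| < δ → ∀ x, |F t x - F t0 x| < ε := by
  have hu := (isCompact_Icc (a := t0 - 1) (b := t0+1)).prod (box_compact (d := d))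
    |>.uniformContinuousOn_of_continuous hF.continuousOn
  rw [Metric.uniformContinuousOn_iff] at hu
  obtain ⟨δ, hδ, h⟩ := hu ε hε
  refine ⟨min δ 1, lt_min hδ one_pos, fun t ht x => ?_⟩
  obtain ⟨k, hk⟩ := exists_box x
  have h1 := abs_lt.1 (ht.trans_le (min_le_right _ _))
  have := h (t, x + fun i => (k i : ℝ)) ⟨⟨by linarith, by linarith⟩, hk⟩
    (t0, x + fun i => (k i : ℝ)) ⟨⟨by linarith, by linarith⟩, hk⟩
    (by rw [Prod.dist_eq]; simpa [Real.dist_eq, hδ] using ht.trans_le (min_le_left _ _))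
  rwa [hp, hp, Real.dist_eq] at this

lemma pd_comb {f g ρ : Vd d → ℝ} (hf : Differentiable ℝ f) (hg : Differentiable ℝ g)
    (hρ : Differentiable ℝ ρ) (c s : ℝ) (i : Fin d) :
    pd (fun x => s * (f x - g x - c * ρ x)) i =
      fun x => s * (pd f i x - pd g i x - c * pd ρ i x) := by
  ext x
  have := (((hf x).hasFDerivAt.sub (hg x).hasFDerivAt).sub ((hρ x).hasFDerivAt.const_mul c)).const_mul s
  unfold pd
  have h := this.fderiv
  simp only [Pi.sub_apply] at h
  rw [h]
  simp

def rhs {d : ℕ} (u : ℝ → Vd d → Fin d → ℝ) (κ : ℝ) (θ : ℝ → Vd d → ℝ) (t : ℝ) (x : Vd d) : ℝ :=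
  κ * ∑ i, pd (pd (θ t) i) i x - ∑ i, u t x i * pd (θ t) i x

lemma cu {u : ℝ → Vd d → Fin d → ℝ} (hu : Continuous (fun p : ℝ × Vd d => u p.1 p.2))
    {g : Fin d → Vd d → ℝ} (hg : ∀ i, Continuous (g i)) :
    Continuous (fun p : ℝ × Vd d => ∑ i, u p.1 p.2 i * g i p.2) := by
  apply continuous_finsetSum
  intro i _
  exact ((continuous_apply i).comp hu).mul ((hg i).comp continuous_snd)

lemma CP_lap {f : Vd d → ℝ} (hf : ContDiff ℝ 2 f) (hp : SpacePeriodic f) :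
    CP (fun x => ∑ i, pd (pd f i) i x) :=
  CP.sum _ fun i => CP_pd (C1_pd hf i) (per_pd hp i) i

lemma CP_adv {u : ℝ → Vd d → Fin d → ℝ} (hu : Continuous (fun p : ℝ × Vd d => u p.1 p.2))
    (hup : ∀ t i, SpacePeriodic fun x => u t x i) {f : Vd d → ℝ} (hf : ContDiff ℝ 1 f)
    (hp : SpacePeriodic f) (t : ℝ) : CP (fun x => ∑ i, u t x i * pd f i x) := by
  refine ⟨(cu hu fun i => (CP_pd hf hp i).c).comp (Continuous.prodMk_right t), fun x k => ?_⟩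
  simp only [hup _ _ x k, per_pd hp _ x k]

lemma CP_rhs {u : ℝ → Vd d → Fin d → ℝ} {κ : ℝ} {θ : ℝ → Vd d → ℝ}
    (hu : Continuous (fun p : ℝ × Vd d => u p.1 p.2))
    (hup : ∀ t i, SpacePeriodic fun x => u t x i) {t : ℝ} (h2 : ContDiff ℝ 2 (θ t))
    (hp : SpacePeriodic (θ t)) : CP (rhs u κ θ t) :=
  ((CP_lap h2 hp).smul κ).sub (CP_adv hu hup (h2.of_le (by norm_num)) hp t)

lemma unif_deriv {u : ℝ → Vd d → Fin d → ℝ} {κ : ℝ} (hκ : 0 ≤ κ) {θin : Vd d → ℝ}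
    {θ : ℝ → Vd d → ℝ} (sol : IsAdvDiffSol u κ θin θ)
    (hu : Continuous (fun p : ℝ × Vd d => u p.1 p.2))
    (hup : ∀ t i, SpacePeriodic fun x => u t x i) {t0 : ℝ} (ht0 : t0 ∈ Set.Ioo (0:ℝ) 1)
    {ε : ℝ} (hε : 0 < ε) :
    ∃ h0 > 0, ∀ t ∈ Set.Icc t0 (t0 + h0),
      ∀ x, |θ t x - θ t0 x - (t - t0) * rhs u κ θ t0 x| ≤ ε * (t - t0) := by
  have hf2 := sol.spaceC2 t0 ⟨ht0.1, ht0.2.le⟩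
  set f := θ t0 with hf
  have hfp : SpacePeriodic f := sol.periodic t0
  have hf1 : ContDiff ℝ 1 f := hf2.of_le (by norm_num)
  have hr0 : CP (rhs u κ θ t0) := CP_rhs hu hup hf2 hfp
  obtain ⟨ρ, hρ2, hρp, hρ⟩ := approxC2 hr0 (show 0 < ε/8 by linarith)
  have hρ1 : ContDiff ℝ 1 ρ := hρ2.of_le (by norm_num)
  obtain ⟨δ1, hδ1, h1⟩ := unif_t (F := fun t x => ∑ i, u t x i * pd f i x)
    (cu hu fun i => (CP_pd hf1 hfp i).c) (fun t => (CP_adv hu hup hf1 hfp t).p) t0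
    (show 0 < ε/8 by linarith)
  obtain ⟨δ2, hδ2, h2⟩ := unif_t (F := fun t x => ∑ i, u t x i * pd ρ i x)
    (cu hu fun i => (CP_pd hρ1 hρp i).c) (fun t => (CP_adv hu hup hρ1 hρp t).p) t0 one_pos
  obtain ⟨C1, hC1, hb1⟩ := (CP_adv hu hup hρ1 hρp t0).bdd
  obtain ⟨C2, hC2, hb2⟩ := ((CP_lap hρ2 hρp).smul κ).bdd
  set C := C1 + C2+1 with hC
  have hCpos : 0 < C := by positivity
  set h0 := min (min (δ1/2) (δ2/2)) (min (1 - t0) (ε/8 / C)) with hh0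
  have h0pos : 0 < h0 := by
    have := ht0.2
    refine lt_min (lt_min (by linarith) (by linarith)) (lt_min (by linarith) pz)
  have l1 : h0 ≤ δ1/2 := (min_le_left _ _).trans (min_le_left _ _)
  have l2 : h0 ≤ δ2/2 := (min_le_left _ _).trans (min_le_right _ _)
  have l3 : h0 ≤1 - t0 := (min_le_right _ _).trans (min_le_left _ _)
  have l4 : h0 * C ≤ ε/8 := by
    rw [← le_div_iff₀ hCpos]; exact (min_le_right _ _).trans (min_le_right _ _)
  refine ⟨h0, h0pos, fun t ht x => ?_⟩
  have key : ∀ s : ℝ, |s| =1 → ∀ x, s * (θ t x - f x - (t - t0) * ρ x) ≤ ε/2 * (t - t0) := by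
    intro s hs
    apply maxp (u := u) hκ (w := fun t x => s * (θ t x - f x - (t - t0) * ρ x)) ht.1
    · intro t
      exact (((sol.periodic t).sub hfp).sub (hρp.smul _)).smul s
    · have hcc := hf1.continuous
      have hcc2 := hρ1.continuous
      have hs := sol.cont.mono (show Set.Icc t0 t ×ˢ (Set.univ : Set (Vd d)) ⊆
        Set.Icc 0 1 ×ˢ Set.univ from Set.prod_mono (Set.Icc_subset_Icc ht0.1.le
          (by linarith [ht.2])) le_rfl)
      exact continuousOn_const.mul ((hs.sub (by fun_prop)).sub (by fun_prop))
    · intro r hr x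
      have := sol.timeDiff r ⟨ht0.1.trans hr.1, by linarith [hr.2, ht.2]⟩ x
      fun_prop
    · intro r hr
      have := sol.spaceC2 r ⟨ht0.1.trans hr.1, by linarith [hr.2, ht.2]⟩
      fun_prop
    · intro r hr x
      have hr' : r ∈ Set.Ioc (0:ℝ) 1 := ⟨ht0.1.trans hr.1, by linarith [hr.2, ht.2]⟩
      have hd := sol.timeDiff r hr' x
      have h2r := sol.spaceC2 r hr'
      have e1 : deriv (fun t => s * (θ t x - f x - (t - t0) * ρ x)) r =
          s * (deriv (fun t => θ t x) r - ρ x) := by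
        have := ((hd.hasDerivAt.sub_const (f x)).sub
          (((hasDerivAt_id r).sub_const t0).mul_const (ρ x))).const_mul s
        simpa using this.deriv
      have e2 : ∀ i, pd (fun x => s * (θ r x - f x - (r - t0) * ρ x)) i = _ := fun i =>
        pd_comb (h2r.differentiable two_ne_zero) (hf2.differentiable two_ne_zero)
          (hρ2.differentiable two_ne_zero) (r - t0) s i
      have e3 : ∀ i, pd (fun x => s * (pd (θ r) i x - pd f i x - (r - t0) * pd ρ i x)) i = _ :=
        fun i => pd_comb ((C1_pd h2r i).differentiable one_ne_zero)
          ((C1_pd hf2 i).differentiable one_ne_zero)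
          ((C1_pd hρ2 i).differentiable one_ne_zero) (r - t0) s i
      rw [e1]
      simp only [e2, e3]
      have eq := sol.eqn r hr' x
      have a1 := h1 r (by rw [abs_of_pos (by linarith [hr.1])]; linarith [hr.2, ht.2]) x
      have a2 := h2 r (by rw [abs_of_pos (by linarith [hr.1])]; linarith [hr.2, ht.2]) x
      have a3 := hb1 x
      have a4 := hb2 x
      have a5 := hρ x
      simp only [rhs] at a5
      have s1 : ∑ i, u r x i * (s * (pd (θ r) i x - pd f i x - (r - t0) * pd ρ i x)) =
          s * (∑ i, u r x i * pd (θ r) i x - ∑ i, u r x i * pd f i x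
            - (r - t0) * ∑ i, u r x i * pd ρ i x) := by
        rw [Finset.mul_sum, ← Finset.sum_sub_distrib, ← Finset.sum_sub_distrib, Finset.mul_sum]
        exact Finset.sum_congr rfl fun i _ => by ring
      have s2 : ∑ i, s * (pd (pd (θ r) i) i x - pd (pd f i) i x - (r - t0) * pd (pd ρ i) i x) =
          s * (∑ i, pd (pd (θ r) i) i x - ∑ i, pd (pd f i) i x
            - (r - t0) * ∑ i, pd (pd ρ i) i x) := by
        rw [Finset.mul_sum, ← Finset.sum_sub_distrib, ← Finset.sum_sub_distrib, Finset.mul_sum]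
      rw [s1, s2]
      generalize ∑ i, u r x i * pd (θ r) i x = A1 at *
      generalize ∑ i, u r x i * pd f i x = A2 at *
      generalize ∑ i, u r x i * pd ρ i x = A3 at *
      generalize ∑ i, u t0 x i * pd ρ i x = A4 at *
      rw [← hf] at a5
      generalize ∑ i, u t0 x i * pd f i x = A5 at *
      generalize ∑ i, pd (pd (θ r) i) i x = B1 at *
      generalize ∑ i, pd (pd f i) i x = B2 at *
      generalize ∑ i, pd (pd ρ i) i x = B3 at *
      have b1 : s * (deriv (fun t => θ t x) r - ρ x) + s * (A1 - A2 - (r - t0) * A3) -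
          κ * (s * (B1 - B2 - (r - t0) * B3)) =
          s * (-(ρ x - (κ * B2 - A5)) - (A2 - A5) - (r - t0) * (A3 - κ * B3)) := by
        linear_combination s * eq
      rw [b1]
      refine (le_abs_self _).trans ?_
      rw [abs_mul, hs, one_mul]
      have b2 : |A3 - κ * B3| ≤ C := by
        have : A3 - κ * B3 = (A3 - A4) + A4 - κ * B3 := by ring
        rw [this]
        refine (abs_sub _ _).trans ?_
        have := abs_add_le (A3 - A4) A4
        linarith
      have b3 : |(r - t0) * (A3 - κ * B3)| ≤ ε/8 := by
        rw [abs_mul, abs_of_pos (by linarith [hr.1])]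
        refine (mul_le_mul (by linarith [hr.2, ht.2]) b2 (abs_nonneg _) h0pos.le).trans l4
      have b4 := abs_sub (-(ρ x - (κ * B2 - A5)) - (A2 - A5)) ((r - t0) * (A3 - κ * B3))
      have b5 := abs_sub (-(ρ x - (κ * B2 - A5))) (A2 - A5)
      rw [abs_neg] at b5
      linarith
    · intro x; simp [hf]
  have k1 := key 1 (by simp) x
  have k2 := key (-1) (by simp) x
  have k3 := abs_le.1 (hρ x)
  have ht' : 0 ≤ t - t0 := by linarith [ht.1]
  rw [abs_le]
  constructor <;> nlinarith

end

section
variable {d : ℕ}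

def Shear {d : ℕ} (v : Vd d → Fin d → ℝ) : Prop :=
  ∃ (j : Fin d) (w : Vd d → ℝ), CP w ∧ (∀ x (r : ℝ), w (x + r • ev j) = w x) ∧
    v = fun x => Pi.single j (w x)

structure Sys {d : ℕ} (u : ℝ → Vd d → Fin d → ℝ) (κ : ℝ) (θin : Vd d → ℝ)
    (θ : ℝ → Vd d → ℝ) : Prop where
  sol : IsAdvDiffSol u κ θin θ
  kp : 0 < κ
  hu : Continuous (fun p : ℝ × Vd d => u p.1 p.2)
  sh : ∀ t, Shear (u t)

lemma Shear.per {v : Vd d → Fin d → ℝ} (h : Shear v) (i : Fin d) :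
    SpacePeriodic fun x => v x i := by
  obtain ⟨j, w, hw, _, rfl⟩ := h
  intro x k
  simp only [hw.p x k]

lemma sum_single (j : Fin d) (a : ℝ) (b : Fin d → ℝ) :
    ∑ i, (Pi.single j a : Fin d → ℝ) i * b i = a * b j := by
  rw [Finset.sum_eq_single j] <;> simp +contextual

def UD {d : ℕ} (F : ℝ → Vd d → ℝ) (r : Vd d → ℝ) (t0 : ℝ) : Prop :=
  CP (F t0) ∧ CP r ∧ ∀ ε > 0, ∃ h0 > 0, ∀ t ∈ Set.Icc t0 (t0 + h0), Continuous (F t) ∧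
    ∀ x, |F t x - F t0 x - (t - t0) * r x| ≤ ε * (t - t0)

lemma UD.int {F : ℝ → Vd d → ℝ} {r : Vd d → ℝ} {t0 : ℝ} (h : UD F r t0) :
    HasDerivWithinAt (fun t => ∫ x in box d, F t x) (∫ x in box d, r x) (Set.Ioi t0) t0 := by
  obtain ⟨hF, hr, h⟩ := h
  rw [hasDerivWithinAt_iff_isLittleO, Asymptotics.isLittleO_iff]
  intro ε hε
  obtain ⟨h0, hh0, h⟩ := h ε hε
  filter_upwards [Ioo_mem_nhdsGT (show t0 < t0 + h0 by linarith)] with t ht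
  obtain ⟨hc, hb⟩ := h t ⟨ht.1.le, ht.2.le⟩
  rw [smul_eq_mul, ← integral_const_mul, ← integral_sub (ion hc) (ion hF.c),
    ← integral_sub (ion (by have := hF.c; fun_prop)) (ion (by have := hr.c; fun_prop)),
    norm_of_nonneg (show 0 ≤ t - t0 by linarith [ht.1])]
  have := norm_setIntegral_le_of_norm_le_const (μ := volume) (s := box d)
    (f := fun x => F t x - F t0 x - (t - t0) * r x) (by simp [vol_box]) (fun x _ => hb x)
  simpa [vol_box_real] using this

lemma UD.mul_const {F : ℝ → Vd d → ℝ} {r φ : Vd d → ℝ} {t0 : ℝ} (h : UD F r t0) (hφ : CP φ) :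
    UD (fun t x => F t x * φ x) (fun x => r x * φ x) t0 := by
  obtain ⟨hF, hr, h⟩ := h
  refine ⟨hF.mul hφ, hr.mul hφ, fun ε hε => ?_⟩
  obtain ⟨C, hC, hb⟩ := hφ.bdd
  obtain ⟨h0, hh0, h⟩ := h (ε / (C+1)) pz
  refine ⟨h0, hh0, fun t ht => ⟨(h t ht).1.mul hφ.c, fun x => ?_⟩⟩
  have e : F t x * φ x - F t0 x * φ x - (t - t0) * (r x * φ x) =
    (F t x - F t0 x - (t - t0) * r x) * φ x := by ring
  rw [e, abs_mul]
  have h1 := (h t ht).2 x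
  have h2 : 0 ≤ t - t0 := by linarith [ht.1]
  calc _ ≤ ε / (C+1) * (t - t0) * (C+1) := by
        apply mul_le_mul h1 (by linarith [hb x]) (abs_nonneg _) pz
    _ = _ := by field_simp

lemma UD.sub_const {F : ℝ → Vd d → ℝ} {r g : Vd d → ℝ} {t0 : ℝ} (h : UD F r t0) (hg : CP g) :
    UD (fun t x => F t x - g x) r t0 := by
  obtain ⟨hF, hr, h⟩ := h
  refine ⟨hF.sub hg, hr, fun ε hε => ?_⟩
  obtain ⟨h0, hh0, h⟩ := h ε hε
  refine ⟨h0, hh0, fun t ht => ⟨(h t ht).1.sub hg.c, fun x => ?_⟩⟩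
  simpa using (h t ht).2 x

lemma UD.sq {F : ℝ → Vd d → ℝ} {r : Vd d → ℝ} {t0 : ℝ} (h : UD F r t0) :
    UD (fun t x => F t x * F t x) (fun x => 2 * (r x * F t0 x)) t0 := by
  have hF := h.1
  have hr := h.2.1
  refine ⟨hF.mul hF, (hr.mul hF).smul 2, fun ε hε => ?_⟩
  obtain ⟨C, hC, hb⟩ := hr.bdd
  obtain ⟨h1, hh1, h1'⟩ := (h.mul_const hF).2.2 (ε/4) pz
  obtain ⟨h2, hh2, h2'⟩ := h.2.2 1 one_pos
  refine ⟨min (min h1 h2) (ε/4 / (C+1)^2), by positivity, fun t ht => ?_⟩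
  have l1 : t ≤ t0 + h1 := ht.2.trans (by gcongr; exact (min_le_left _ _).trans (min_le_left _ _))
  have l2 : t ≤ t0 + h2 := ht.2.trans (by gcongr; exact (min_le_left _ _).trans (min_le_right _ _))
  have l3 : (t - t0) * (C+1)^2 ≤ ε/4 := by
    rw [← le_div_iff₀ pz]
    linarith [ht.2, min_le_right (min h1 h2) (ε/4 / (C+1)^2)]
  obtain ⟨c1, b1⟩ := h1' t ⟨ht.1, l1⟩
  obtain ⟨c2, b2⟩ := h2' t ⟨ht.1, l2⟩
  refine ⟨c2.mul c2, fun x => ?_⟩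
  have ht0 : 0 ≤ t - t0 := by linarith [ht.1]
  have e : F t x * F t x - F t0 x * F t0 x - (t - t0) * (2 * (r x * F t0 x)) =
    2 * (F t x * F t0 x - F t0 x * F t0 x - (t - t0) * (r x * F t0 x)) +
      (F t x - F t0 x)^2 := by ring
  have b3 : |F t x - F t0 x| ≤ (t - t0) * (C+1) := by
    have a1 := abs_le.1 (b2 x)
    have a2 := abs_le.1 (hb x)
    rw [abs_le]; constructor <;> nlinarith
  have b4 : (F t x - F t0 x)^2 ≤ ε/4 * (t - t0) := by
    rw [← sq_abs]
    calc _ ≤ ((t - t0) * (C+1))^2 := by gcongr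
      _ = (t - t0) * (C+1)^2 * (t - t0) := by ring
      _ ≤ _ := by gcongr
  have b5 := abs_le.1 (b1 x)
  rw [e, abs_le]
  have := sq_nonneg (F t x - F t0 x)
  constructor <;> nlinarith

namespace Sys
variable {u : ℝ → Vd d → Fin d → ℝ} {κ : ℝ} {θin : Vd d → ℝ} {θ : ℝ → Vd d → ℝ}

lemma hup (S : Sys u κ θin θ) : ∀ t i, SpacePeriodic fun x => u t x i := fun t i => (S.sh t).per i

lemma cp (S : Sys u κ θin θ) {t : ℝ} (ht : t ∈ Set.Icc (0:ℝ) 1) : CP (θ t) :=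
  ⟨by
    have := S.sol.cont.comp (f := fun x : Vd d => (t, x)) (s := Set.univ) (by fun_prop)
      (fun x _ => ⟨ht, trivial⟩)
    rw [continuousOn_univ] at this
    exact this, S.sol.periodic t⟩

lemma c2 (S : Sys u κ θin θ) {t : ℝ} (ht : t ∈ Set.Ioo (0:ℝ) 1) : ContDiff ℝ 2 (θ t) :=
  S.sol.spaceC2 t ⟨ht.1, ht.2.le⟩

lemma ud (S : Sys u κ θin θ) {t : ℝ} (ht : t ∈ Set.Ioo (0:ℝ) 1) : UD θ (rhs u κ θ t) t := by
  refine ⟨S.cp ⟨ht.1.le, ht.2.le⟩, CP_rhs S.hu S.hup (S.c2 ht) (S.sol.periodic t), fun ε hε => ?_⟩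
  obtain ⟨h0, hh0, h⟩ := unif_deriv S.kp.le S.sol S.hu S.hup ht hε
  have := ht.2
  refine ⟨min h0 (1 - t), lt_min hh0 (by linarith), fun s hs => ⟨(S.cp ⟨?_, ?_⟩).c, h s ⟨hs.1, ?_⟩⟩⟩
  · linarith [ht.1, hs.1]
  · linarith [hs.2, min_le_right h0 (1 - t)]
  · linarith [hs.2, min_le_left h0 (1 - t)]

lemma contInt (S : Sys u κ θin θ) {F : ℝ → Vd d → ℝ}
    (hF : ContinuousOn (fun p : ℝ × Vd d => F p.1 p.2) (Set.Icc 0 1 ×ˢ Set.univ)) :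
    ContinuousOn (fun t => ∫ x in box d, F t x) (Set.Icc 0 1) := by
  obtain ⟨C, hC⟩ := ((isCompact_Icc (a := (0:ℝ)) (b := 1)).prod
    (box_compact (d := d))).exists_bound_of_continuousOn
    (hF.mono (Set.prod_mono le_rfl (Set.subset_univ _)))
  apply continuousOn_of_dominated (bound := fun _ => C)
  · intro t ht
    have := hF.comp (f := fun x : Vd d => (t, x)) (s := Set.univ) (by fun_prop)
      (fun x _ => ⟨ht, trivial⟩)
    rw [continuousOn_univ] at this
    exact Continuous.aestronglyMeasurable this
  · intro t ht
    filter_upwards [ae_restrict_mem (measurableSet_Icc : MeasurableSet (box d))] with x hx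
    exact hC (t, x) ⟨ht, hx⟩
  · exact integrable_const _
  · filter_upwards with x
    exact hF.comp (f := fun t : ℝ => (t, x)) (by fun_prop) (fun t ht => ⟨ht, trivial⟩)

lemma contSubSq (S : Sys u κ θin θ) {g : Vd d → ℝ} (hg : Continuous g) :
    ContinuousOn (fun t => nm (fun x => θ t x - g x)^2) (Set.Icc 0 1) := by
  simp only [nm_sq, ip]
  have := S.sol.cont
  exact S.contInt ((this.sub (by fun_prop)).mul (this.sub (by fun_prop)))

def gr {d : ℕ} (θ : ℝ → Vd d → ℝ) (t : ℝ) : ℝ := ∑ i, nm (pd (θ t) i)^2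

lemma gr_nonneg (t : ℝ) : 0 ≤ gr θ t := Finset.sum_nonneg fun i _ => sq_nonneg _

lemma ip_rhs (S : Sys u κ θin θ) {t : ℝ} (ht : t ∈ Set.Ioo (0:ℝ) 1) {g : Vd d → ℝ}
    (hg : ContDiff ℝ 1 g) (hgp : SpacePeriodic g) :
    ip (rhs u κ θ t) g = - κ * ∑ i, ip (pd (θ t) i) (pd g i)
      - ip (fun x => ∑ i, u t x i * pd (θ t) i x) g := by
  have h2 := S.c2 ht
  have hp := S.sol.periodic t
  have h1 : ContDiff ℝ 1 (θ t) := h2.of_le (by norm_num)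
  unfold rhs
  rw [ip_sub ((CP_lap h2 hp).smul κ).c (CP_adv S.hu S.hup h1 hp t).c hg.continuous, ip_smul,
    ip_sum _ (fun i => (CP_pd (C1_pd h2 i) (per_pd hp i) i).c) hg.continuous]
  simp only [ibp_ip (C1_pd h2 _) (per_pd hp _) hg hgp, Finset.sum_neg_distrib]
  ring

lemma adv_skew (S : Sys u κ θin θ) (t : ℝ) {f : Vd d → ℝ} (hf : ContDiff ℝ 1 f)
    (hfp : SpacePeriodic f) : ip (fun x => ∑ i, u t x i * pd f i x) f =0 := by
  obtain ⟨j, w, hw, hj, hu⟩ := S.sh t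
  have := ibp hf hfp hf hfp hw j hj
  have e1 : ∫ x in box d, w x * f x * pd f j x = ∫ x in box d, w x * pd f j x * f x := by
    congr 1; ext x; ring
  simp only [hu, sum_single, ip]
  linarith

lemma dE (S : Sys u κ θin θ) {t : ℝ} (ht : t ∈ Set.Ioo (0:ℝ) 1) :
    HasDerivWithinAt (fun t => nm (θ t)^2) (- 2 * κ * gr θ t) (Set.Ioi t) t := by
  have h := (S.ud ht).sq.int
  have h1 : ContDiff ℝ 1 (θ t) := (S.c2 ht).of_le (by norm_num)
  have e := S.ip_rhs ht h1 (S.sol.periodic t)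
  rw [S.adv_skew t h1 (S.sol.periodic t)] at e
  simp only [nm_sq]
  refine HasDerivWithinAt.congr_deriv (f' := ∫ x in box d, 2 * (rhs u κ θ t x * θ t x)) h ?_
  rw [integral_const_mul]
  change 2 * ip (rhs u κ θ t) (θ t) = _
  rw [e, gr]; simp only [nm_sq]; ring

lemma contE (S : Sys u κ θin θ) : ContinuousOn (fun t => nm (θ t)^2) (Set.Icc 0 1) := by
  simpa using S.contSubSq (g := fun _ => 0) continuous_const

end Sys

lemma right_le {f f' : ℝ → ℝ} {a b B : ℝ} (hab : a ≤ b) (hf : ContinuousOn f (Set.Icc a b))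
    (hd : ∀ t ∈ Set.Ioo a b, HasDerivWithinAt f (f' t) (Set.Ioi t) t)
    (hB : ∀ t ∈ Set.Ioo a b, f' t ≤ B) : f b - f a ≤ B * (b - a) := by
  have := intervalIntegral.sub_le_integral_of_hasDeriv_right_of_le hab hf hd
    (φ := fun _ => B) (integrableOn_const (by simp)) hB
  simpa [mul_comm] using this

namespace Sys
variable {u : ℝ → Vd d → Fin d → ℝ} {κ : ℝ} {θin : Vd d → ℝ} {θ : ℝ → Vd d → ℝ}

lemma E_anti (S : Sys u κ θin θ) {a b : ℝ} (ha : 0 ≤ a) (hab : a ≤ b) (hb : b ≤1) :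
    nm (θ b)^2 ≤ nm (θ a)^2 := by
  have hs : Set.Icc a b ⊆ Set.Icc 0 1 := Set.Icc_subset_Icc ha hb
  have := right_le (B := 0) hab (S.contE.mono hs)
    (fun t ht => S.dE ⟨ha.trans_lt ht.1, ht.2.trans_le hb⟩)
    (fun t _ => by have := gr_nonneg (θ := θ) t; have := S.kp; nlinarith [mul_nonneg S.kp.le (gr_nonneg (θ := θ) t)])
  linarith

lemma nm_anti (S : Sys u κ θin θ) {a b : ℝ} (ha : 0 ≤ a) (hab : a ≤ b) (hb : b ≤1) :
    nm (θ b) ≤ nm (θ a) :=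
  le_of_sq_le_sq (S.E_anti ha hab hb) (nm_nonneg _)

lemma dissip_eq (S : Sys u κ θin θ) :
    κ * dissip θ = (nm (θ 0)^2 - nm (θ 1)^2)/2 := by
  have hd : ∀ t ∈ Set.Ioo (0:ℝ) 1, HasDerivWithinAt (fun t => - nm (θ t)^2) (2 * κ * gr θ t)
      (Set.Ioi t) t := fun t ht => by
    have := (S.dE ht).neg
    exact this.congr_deriv (by ring)
  have hc : ContinuousOn (fun t => - nm (θ t)^2) (Set.Icc 0 1) := S.contE.neg
  have hi := intervalIntegral.integrableOn_deriv_right_of_nonneg hc hd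
    (fun t _ => mul_nonneg (mul_nonneg zero_le_two S.kp.le) (gr_nonneg t))
  have h := intervalIntegral.integral_eq_sub_of_hasDeriv_right_of_le zero_le_one hc hd
    ((intervalIntegrable_iff_integrableOn_Ioc_of_le zero_le_one).2 hi)
  rw [intervalIntegral.integral_const_mul, intervalIntegral.integral_of_le zero_le_one,
    integral_Ioc_eq_integral_Ioo] at h
  have e : dissip θ = ∫ t in Set.Ioo (0:ℝ) 1, gr θ t := by
    unfold dissip dissipUpTo
    rw [integral_Icc_eq_integral_Ioo]
    refine setIntegral_congr_fun measurableSet_Ioo fun t ht => ?_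
    have h1 : ContDiff ℝ 1 (θ t) := (S.c2 ht).of_le (by norm_num)
    simp only [gr, nm_sq, ip, gradSq, ← sq]
    exact integral_finsetSum _ fun i _ => ion ((CP_pd h1 (S.sol.periodic t) i).c.pow 2)
  rw [e]; linarith

lemma disturb (S : Sys u κ θin θ) {f0 : Vd d → ℝ} (hf : ContDiff ℝ 2 f0) (hfp : SpacePeriodic f0)
    {T U Γ : ℝ} (hT0 : 0 ≤ T) (hT : T ≤1) (hU0 : 0 ≤ U) (hΓ : ∀ l, nm (pd f0 l) ≤ Γ)
    (hΓ0 : 0 ≤ Γ)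
    (hU : ∀ t ∈ Set.Ioo 0 T, ∀ x i, |u t x i| ≤ U) :
    nm (fun x => θ T x - f0 x) ≤
      2 * U * Γ * T + √(nm (fun x => θ 0 x - f0 x)^2 + κ * d * Γ^2) := by
  set y := fun t => nm (fun x => θ t x - f0 x)^2 with hy
  have hf1 : ContDiff ℝ 1 f0 := hf.of_le (by norm_num)
  have hyc : ContinuousOn y (Set.Icc 0 1) := S.contSubSq hf.continuous
  have hyd : ∀ t ∈ Set.Ioo (0:ℝ) 1, HasDerivWithinAt y
      (2 * ip (rhs u κ θ t) (fun x => θ t x - f0 x)) (Set.Ioi t) t := fun t ht => by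
    have h := ((S.ud ht).sub_const ⟨hf.continuous, hfp⟩).sq.int
    simp only [hy, nm_sq]
    refine HasDerivWithinAt.congr_deriv h ?_
    rw [integral_const_mul]; rfl
  have hk := S.kp
  have hb : ∀ t ∈ Set.Ioo (0:ℝ) T, 2 * ip (rhs u κ θ t) (fun x => θ t x - f0 x) ≤
      2 * U * Γ * √(y t) + κ * d * Γ^2 := by
    intro t ht
    have ht' : t ∈ Set.Ioo (0:ℝ) 1 := ⟨ht.1, ht.2.trans_le hT⟩
    have h1 : ContDiff ℝ 1 (θ t) := (S.c2 ht').of_le (by norm_num)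
    have hp := S.sol.periodic t
    have hw1 : ContDiff ℝ 1 (fun x => θ t x - f0 x) := h1.sub hf1
    have hwp := hp.sub hfp
    have epd : ∀ i, pd (fun x => θ t x - f0 x) i = fun x => pd (θ t) i x - pd f0 i x := by
      intro i
      simpa using pd_comb (ρ := fun _ => 0) (h1.differentiable one_ne_zero)
        (hf1.differentiable one_ne_zero) (by fun_prop) 0 1 i
    rw [S.ip_rhs ht' hw1 hwp]
    have s1 : - ∑ i, ip (pd (θ t) i) (pd (fun x => θ t x - f0 x) i) ≤ d * Γ^2/4 := by
      rw [← Finset.sum_neg_distrib]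
      have : ∀ i ∈ Finset.univ, - ip (pd (θ t) i) (pd (fun x => θ t x - f0 x) i) ≤ Γ^2/4 := by
        intro i _
        have ca := (CP_pd h1 hp i).c
        have cb := (CP_pd hf1 hfp i).c
        rw [epd, ip_comm, ip_sub ca cb ca, ← nm_sq, ip_comm]
        have := ip_le ca cb
        have := hΓ i
        nlinarith [sq_nonneg (nm (pd (θ t) i) - Γ/2), nm_nonneg (pd (θ t) i)]
      refine (Finset.sum_le_sum this).trans ?_
      simp; linarith
    have s2 : - ip (fun x => ∑ i, u t x i * pd (θ t) i x) (fun x => θ t x - f0 x) ≤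
        U * Γ * √(y t) := by
      have e0 : (fun x => ∑ i, u t x i * pd (θ t) i x) = fun x =>
          (∑ i, u t x i * pd (fun x => θ t x - f0 x) i x) + ∑ i, u t x i * pd f0 i x := by
        ext x
        rw [← Finset.sum_add_distrib]
        exact Finset.sum_congr rfl fun i _ => by rw [epd]; ring
      have c1 := (CP_adv S.hu S.hup hw1 hwp t).c
      have c2 := (CP_adv S.hu S.hup hf1 hfp t).c
      rw [e0, ip_add c1 c2 hw1.continuous, S.adv_skew t hw1 hwp, zero_add]
      have a1 := (abs_le.1 (cauchy c2 hw1.continuous)).1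
      have a2 : nm (fun x => ∑ i, u t x i * pd f0 i x) ≤ U * Γ := by
        obtain ⟨j, w, hw, hj, hus⟩ := S.sh t
        have hwU : ∀ x, |w x| ≤ U := fun x => by
          have := hU t ht x j
          simpa [hus] using this
        simp only [hus, sum_single]
        have cb := (CP_pd hf1 hfp j).c
        have := nm_mono (f := fun x => w x * pd f0 j x) (g := fun x => U * pd f0 j x)
          (hw.c.mul cb) (by fun_prop) (fun x => by
            rw [abs_mul, abs_mul, abs_of_nonneg hU0]
            exact mlr (hwU x) (abs_nonneg _))
        rw [nm_smul, abs_of_nonneg hU0] at this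
        exact this.trans (mll (hΓ j) hU0)
      have a3 : √(y t) = nm (fun x => θ t x - f0 x) := sqrt_sq (nm_nonneg _)
      rw [a3]
      have := mlr a2 (nm_nonneg (fun x => θ t x - f0 x))
      linarith
    have := mll s1 hk.le
    have h0 : 0 ≤ κ * (d * Γ^2) := by positivity
    nlinarith
  have hsub : Set.Icc 0 T ⊆ Set.Icc (0:ℝ) 1 := Set.Icc_subset_Icc le_rfl hT
  obtain ⟨t1, ht1, hmax⟩ := isCompact_Icc.exists_isMaxOn ⟨(0:ℝ), ⟨le_rfl, hT0⟩⟩ (hyc.mono hsub)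
  set Y := y t1 with hY
  have hY0 : 0 ≤ Y := sq_nonneg _
  have hkd : 0 ≤ κ * d * Γ^2 := by positivity
  have h1 := right_le (B := 2 * U * Γ * √Y + κ * d * Γ^2) ht1.1
    (hyc.mono (Set.Icc_subset_Icc le_rfl (ht1.2.trans hT)))
    (fun t ht => hyd t ⟨ht.1, ht.2.trans_le (ht1.2.trans hT)⟩)
    (fun t ht => (hb t ⟨ht.1, ht.2.trans_le ht1.2⟩).trans (by
      have : y t ≤ Y := hmax ⟨ht.1.le, ht.2.le.trans ht1.2⟩
      gcongr))
  have h2 : Y ≤ y 0 + κ * d * Γ^2+2 * U * Γ * T * √Y := by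
    have h3 : (2 * U * Γ * √Y + κ * d * Γ^2) * (t1 - 0) ≤2 * U * Γ * √Y * T + κ * d * Γ^2*1 := by
      rw [sub_zero, add_mul]
      gcongr
      · exact ht1.2
      · exact ht1.2.trans hT
    linarith
  have h4 : √(y T) ≤ √Y := sqrt_le_sqrt (hmax ⟨hT0, le_rfl⟩)
  have h5 : √(y T) = nm (fun x => θ T x - f0 x) := sqrt_sq (nm_nonneg _)
  rw [← h5]
  refine h4.trans ?_
  have h6 : 0 ≤ y 0 + κ * d * Γ^2 := add_nonneg (sq_nonneg _) hkd
  have h7 := sq_sqrt h6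
  have h8 := sq_sqrt hY0
  have h9 : 0 ≤2 * U * Γ * T := by positivity
  by_contra hcon
  push Not at hcon
  have := sqrt_nonneg (y 0 + κ * d * Γ^2)
  change 2 * U * Γ * T + √(y 0 + κ * d * Γ^2) < √Y at hcon
  nlinarith [mul_lt_mul_of_pos_right hcon (lt_of_le_of_lt pz hcon : 0 < √Y)]

lemma good_time (S : Sys u κ θin θ) {a b : ℝ} (ha : 0 ≤ a) (hab : a < b) (hb : b ≤1)
    (hu0 : ∀ t ∈ Set.Ioo a b, u t =0) {δ : ℝ} (hδ : nm (θ 0)^2 - nm (θ 1)^2 ≤2 * δ)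
    (hδ0 : 0 < δ) :
    ∃ s ∈ Set.Ioo a b, κ * (b - a) * gr θ s ≤2 * δ ∧ nm (fun x => θ a x - θ s x)^2 ≤5 * δ := by
  have hs : Set.Icc a b ⊆ Set.Icc 0 1 := Set.Icc_subset_Icc ha hb
  have hk := S.kp
  have ex : ∃ s ∈ Set.Ioo a b, κ * (b - a) * gr θ s ≤2 * δ := by
    by_contra hcon
    push Not at hcon
    have := right_le (B := - 4 * δ / (b - a)) hab.le (S.contE.mono hs)
      (fun t ht => S.dE ⟨ha.trans_lt ht.1, ht.2.trans_le hb⟩)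
      (fun t ht => by
        rw [le_div_iff₀ (by linarith)]
        nlinarith [hcon t ht])
    rw [div_mul_cancel₀ _ (by linarith)] at this
    have h1 := S.E_anti le_rfl ha (hab.le.trans hb)
    have h2 := S.E_anti (ha.trans hab.le) hb le_rfl
    linarith
  obtain ⟨s, hsm, hsg⟩ := ex
  refine ⟨s, hsm, hsg, ?_⟩
  have hs01 : s ∈ Set.Ioo (0:ℝ) 1 := ⟨ha.trans_lt hsm.1, hsm.2.trans_le hb⟩
  have h1s : ContDiff ℝ 1 (θ s) := (S.c2 hs01).of_le (by norm_num)
  have hps := S.sol.periodic s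
  have hss : Set.Icc a s ⊆ Set.Icc 0 1 := Set.Icc_subset_Icc ha hs01.2.le
  -- Y + ...
  have key := right_le (f := fun t => - nm (fun x => θ t x - θ s x)^2+3/2 * nm (θ t)^2)
    (f' := fun t => - (2 * ip (rhs u κ θ t) (fun x => θ t x - θ s x)) +
      3/2 * (- 2 * κ * gr θ t))
    (B := κ * gr θ s) hsm.1.le
    (((S.contSubSq (S.cp ⟨hs01.1.le, hs01.2.le⟩).c).mono hss).neg.add
      (continuousOn_const.mul (S.contE.mono hss)))
    (fun t ht => by
      have ht' : t ∈ Set.Ioo (0:ℝ) 1 := ⟨ha.trans_lt ht.1, ht.2.trans hs01.2⟩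
      have h := ((S.ud ht').sub_const (S.cp ⟨hs01.1.le, hs01.2.le⟩)).sq.int
      refine HasDerivWithinAt.fun_add (HasDerivWithinAt.fun_neg ?_) ((S.dE ht').const_mul _)
      simp only [nm_sq]
      refine HasDerivWithinAt.congr_deriv h ?_
      rw [integral_const_mul]; rfl)
    (fun t ht => by
      have ht' : t ∈ Set.Ioo (0:ℝ) 1 := ⟨ha.trans_lt ht.1, ht.2.trans hs01.2⟩
      have h1 : ContDiff ℝ 1 (θ t) := (S.c2 ht').of_le (by norm_num)
      have hp := S.sol.periodic t
      have epd : ∀ i, pd (fun x => θ t x - θ s x) i = fun x => pd (θ t) i x - pd (θ s) i x := by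
        intro i
        simpa using pd_comb (ρ := fun _ => 0) (h1.differentiable one_ne_zero)
          (h1s.differentiable one_ne_zero) (by fun_prop) 0 1 i
      rw [S.ip_rhs ht' (h1.sub h1s) (hp.sub hps)]
      have hz : u t =0 := hu0 t ⟨ht.1, ht.2.trans hsm.2⟩
      have e2 : ip (fun x => ∑ i, u t x i * pd (θ t) i x) (fun x => θ t x - θ s x) =0 := by
        simp [hz, ip]
      rw [e2]
      have : ∑ i, ip (pd (θ t) i) (pd (fun x => θ t x - θ s x) i) ≤3/2 * gr θ t+1/2 * gr θ s := by
        unfold gr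
        rw [Finset.mul_sum, Finset.mul_sum, ← Finset.sum_add_distrib]
        refine Finset.sum_le_sum fun i _ => ?_
        have ca := (CP_pd h1 hp i).c
        have cb := (CP_pd h1s hps i).c
        rw [epd, ip_comm, ip_sub ca cb ca, ← nm_sq, ip_comm]
        have := (abs_le.1 (cauchy ca cb)).1
        nlinarith [sq_nonneg (nm (pd (θ t) i) - nm (pd (θ s) i))]
      nlinarith)
  have h0 : nm (fun x => θ s x - θ s x)^2 =0 := by simp [nm_const]
  simp only [h0] at key
  have h3 := S.E_anti le_rfl ha (hab.le.trans hb)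
  have h4 := S.E_anti hs01.1.le hs01.2.le le_rfl
  have h5 : κ * gr θ s * (s - a) ≤ κ * (b - a) * gr θ s := by
    have := gr_nonneg (θ := θ) s
    have : κ * gr θ s * (s - a) ≤ κ * gr θ s * (b - a) :=
      mll (by linarith [hsm.2]) pz
    linarith
  linarith

end Sys

end

section
variable {d : ℕ}

def Lip {d : ℕ} (K : ℝ) (φ : Vd d → ℝ) : Prop := ∀ x y, |φ x - φ y| ≤ K * ‖x - y‖

lemma norm_ev (j : Fin d) : ‖(ev j : Vd d)‖ =1 := by
  rw [ev, Pi.norm_single, norm_one]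

lemma norm_sev (r : ℝ) (j : Fin d) : ‖r • (ev j : Vd d)‖ = |r| := by
  rw [norm_smul, norm_ev, mul_one, norm_eq_abs]

lemma Lip.cont {K : ℝ} {φ : Vd d → ℝ} (h : Lip K φ) : Continuous φ := by
  have : LipschitzWith K.toNNReal φ := LipschitzWith.of_dist_le_mul fun x y => by
    rw [dist_eq_norm, dist_eq_norm, norm_eq_abs]
    exact (h x y).trans (mlr (le_coe_toNNReal K) (norm_nonneg _))
  exact this.continuous

lemma Lip.pd_le {K : ℝ} (hK : 0 ≤ K) {φ : Vd d → ℝ} (h : Lip K φ) (l : Fin d) (x : Vd d) :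
    |pd φ l x| ≤ K := by
  have : LipschitzWith K.toNNReal φ := LipschitzWith.of_dist_le_mul fun x y => by
    rw [dist_eq_norm, dist_eq_norm, norm_eq_abs]
    exact (h x y).trans (mlr (le_coe_toNNReal K) (norm_nonneg _))
  have h1 := norm_fderiv_le_of_lipschitz ℝ this (x₀ := x)
  have h2 := (fderiv ℝ φ x).le_opNorm (ev l)
  rw [norm_ev, mul_one] at h2
  rw [coe_toNNReal K hK] at h1
  exact h2.trans h1

lemma moll_lip {δ K : ℝ} (hδ : 0 < δ) {f : Vd d → ℝ} (hf : Lip K f) : Lip K (moll δ hδ f) := by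
  intro x y
  have hc : ∀ z, Integrable (fun t => (bump (d := d) δ hδ).normed volume t * f (z - t)) := fun z => by
    apply Continuous.integrable_of_hasCompactSupport
    · have := (bump (d := d) δ hδ).contDiff_normed (μ := volume) (n := 0)
      have := this.continuous
      have := hf.cont
      fun_prop
    · exact (bump (d := d) δ hδ).hasCompactSupport_normed.mul_right
  unfold moll
  rw [← integral_sub (hc x) (hc y)]
  have e : K * ‖x - y‖ = ∫ t, (bump (d := d) δ hδ).normed volume t * (K * ‖x - y‖) := by
    rw [integral_mul_const, eta_int, one_mul]
  rw [e, ← norm_eq_abs]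
  refine norm_integral_le_of_norm_le ((bump (d := d) δ hδ).integrable_normed.mul_const _) (Eventually.of_forall fun t => ?_)
  rw [← mul_sub, norm_mul, norm_of_nonneg ((bump (d := d) δ hδ).nonneg_normed t)]
  refine mll ?_ ((bump (d := d) δ hδ).nonneg_normed t)
  have := hf (x - t) (y - t)
  simpa using this

lemma ibp_lip {K : ℝ} (hK : 0 ≤ K) {φ f : Vd d → ℝ} (hφ : CP φ) (hl : Lip K φ)
    (hf : ContDiff ℝ 1 f) (hp : SpacePeriodic f) (l : Fin d) :
    |ip (pd f l) φ| ≤ K * nm f := by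
  refine le_of_forall_pos_le_add fun ε hε => ?_
  set A := nm (pd f l) with hA
  have hA0 : 0 ≤ A := nm_nonneg _
  obtain ⟨δ, hδ, huc⟩ := hφ.uc (show 0 < ε / (A+1) by positivity)
  have hs := moll_smooth hδ hφ.c
  have hs1 : ContDiff ℝ 1 (moll δ hδ φ) := hs.of_le (by exact_mod_cast le_top)
  have hcl := moll_close hδ hφ.c huc
  have h1 := ibp_ip hf hp hs1 (moll_per hδ hφ.p) l
  have cf := (CP_pd hf hp l).c
  have cm := (CP_pd hs1 (moll_per hδ hφ.p) l).c
  have h2 := cauchy hf.continuous cm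
  have h3 : nm (pd (moll δ hδ φ) l) ≤ K := nm_le cm fun x => (moll_lip hδ hl).pd_le hK l x
  have h4 : ip (pd f l) φ = ip (pd f l) (moll δ hδ φ) - ip (pd f l) (fun x => moll δ hδ φ x - φ x) := by
    rw [ip_comm _ (fun x => moll δ hδ φ x - φ x), ip_sub hs1.continuous hφ.c cf, ip_comm (moll δ hδ φ), ip_comm φ]; ring
  have h5 := cauchy cf (hs1.continuous.sub hφ.c)
  have h6 : nm (fun x => moll δ hδ φ x - φ x) ≤ ε / (A+1) :=
    nm_le (hs1.continuous.sub hφ.c) hcl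
  have h7 : A * (ε / (A+1)) ≤ ε := by
    rw [mul_div_assoc', div_le_iff₀ pz]; nlinarith
  rw [h4, h1]
  have h8 : nm f * nm (pd (moll δ hδ φ) l) ≤ K * nm f := by
    rw [mul_comm]; exact mlr h3 (nm_nonneg _)
  have h9 := mll h6 hA0
  have := abs_sub (-ip f (pd (moll δ hδ φ) l)) (ip (pd f l) (fun x => moll δ hδ φ x - φ x))
  rw [abs_neg] at this
  have h5' : |ip (pd f l) (fun x => moll δ hδ φ x - φ x)| ≤ A * nm (fun x => moll δ hδ φ x - φ x) := h5
  linarith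

lemma ip_shear {f φ w : Vd d → ℝ} (hf : CP f) (hφ : CP φ) (hw : CP w) (j : Fin d)
    (hwj : ∀ x (r : ℝ), w (x + r • ev j) = w x) :
    ip (fun x => f (x + w x • ev j)) φ = ip f (fun x => φ (x - w x • ev j)) := by
  have hw' : CP (fun x => (-1) * w x) := hw.smul (-1)
  have h1 := (int_shear hφ hw' j (fun x r => by simp only [hwj])).1
  have h1' : CP (fun x => φ (x - w x • ev j)) := by
    convert h1 using 3 with x
    rw [sub_eq_add_neg, ← neg_smul]; simp
  have h2 := (int_shear (hf.mul h1') hw j hwj).2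
  unfold ip
  rw [← h2]
  simp only [hwj, add_sub_cancel_right]

namespace Sys
variable {u : ℝ → Vd d → Fin d → ℝ} {κ : ℝ} {θin : Vd d → ℝ} {θ : ℝ → Vd d → ℝ}

lemma ud_flow (S : Sys u κ θin θ) {t : ℝ} (ht : t ∈ Set.Ioo (0:ℝ) 1) {ξ : ℝ → ℝ} {a : ℝ}
    (hξ : HasDerivAt ξ a t) {γ : Vd d → ℝ} (hγ : CP γ) {j : Fin d}
    (hγj : ∀ x (r : ℝ), γ (x + r • ev j) = γ x) (hu : u t = fun x => Pi.single j (a * γ x)) :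
    UD (fun s x => θ s (x + (ξ s * γ x) • ev j))
      (fun x => κ * ∑ i, pd (pd (θ t) i) i (x + (ξ t * γ x) • ev j)) t := by
  have h2 := S.c2 ht
  have h1 : ContDiff ℝ 1 (θ t) := h2.of_le (by norm_num)
  have hp := S.sol.periodic t
  have ud := S.ud ht
  have hw : ∀ s, CP (fun x => ξ s * γ x) := fun s => hγ.smul _
  have hwj : ∀ s x (r : ℝ), ξ s * γ (x + r • ev j) = ξ s * γ x := fun s x r => by rw [hγj]
  have hDj := CP_pd h1 hp j
  refine ⟨(int_shear ud.1 (hw t) j (hwj t)).1, (int_shear ((CP_lap h2 hp).smul κ) (hw t) j (hwj t)).1,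
    fun ε hε => ?_⟩
  obtain ⟨C, hC, hCb⟩ := hγ.bdd
  obtain ⟨M, hM, hMb⟩ := hDj.bdd
  set A := |a| + 1 with hA
  have hA0 : 0 < A := by positivity
  set η := ε / (4 * (1 + A * (C+1) + C * M + C)) with hη
  have hη0 : 0 < η := by positivity
  obtain ⟨k1, hk1, b1⟩ := ud.2.2 η hη0
  obtain ⟨δ2, hδ2, b2⟩ := ud.2.1.uc hη0
  obtain ⟨δ3, hδ3, b3⟩ := hDj.uc hη0
  rw [hasDerivAt_iff_isLittleO, Asymptotics.isLittleO_iff] at hξ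
  obtain ⟨δ4, hδ4, b4⟩ := Metric.eventually_nhds_iff.1 (hξ (show 0 < min η 1 by positivity))
  have hCA : 0 < A * (C+1) := by positivity
  refine ⟨min k1 (min (min (δ2 / (2 * (A * (C+1)))) (δ3 / (2 * (A * (C+1))))) (δ4/2)), by positivity, fun s hs => ?_⟩
  have i1 : s - t ≤ k1 := by linarith [hs.2, min_le_left k1 (min (min (δ2 / (2 * (A * (C+1)))) (δ3 / (2 * (A * (C+1))))) (δ4/2))]
  have i0 : s - t ≤ min (min (δ2 / (2 * (A * (C+1)))) (δ3 / (2 * (A * (C+1))))) (δ4/2) := by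
    linarith [hs.2, min_le_right k1 (min (min (δ2 / (2 * (A * (C+1)))) (δ3 / (2 * (A * (C+1))))) (δ4/2))]
  have i2 : s - t ≤ δ2 / (2 * (A * (C+1))) := i0.trans ((min_le_left _ _).trans (min_le_left _ _))
  have i3 : s - t ≤ δ3 / (2 * (A * (C+1))) := i0.trans ((min_le_left _ _).trans (min_le_right _ _))
  have i4 : s - t ≤ δ4/2 := i0.trans (min_le_right _ _)
  have hst : 0 ≤ s - t := by linarith [hs.1]
  obtain ⟨c1, b1⟩ := b1 s ⟨hs.1, by linarith⟩
  have b4 := b4 (y := s) (by rw [Real.dist_eq, abs_of_nonneg hst]; linarith)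
  rw [smul_eq_mul, norm_eq_abs, norm_of_nonneg hst] at b4
  have hcγ := hγ.c
  refine ⟨by fun_prop, fun x => ?_⟩
  set z := x + (ξ t * γ x) • (ev j : Vd d) with hz
  set w := (ξ s - ξ t) * γ x with hwd
  have ez : x + (ξ s * γ x) • (ev j : Vd d) = z + w • ev j := by
    rw [hz, hwd, add_assoc, ← add_smul]; ring_nf
  have hξb : |ξ s - ξ t| ≤ A * (s - t) := by
    have : |ξ s - ξ t| ≤ |ξ s - ξ t - (s - t) * a| + |(s - t) * a| := by
      simpa using abs_add_le (ξ s - ξ t - (s - t) * a) ((s - t) * a)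
    rw [abs_mul, abs_of_nonneg hst] at this
    have h5 : min η 1 * (s - t) ≤1 * (s - t) := by gcongr; exact min_le_right _ _
    rw [hA]; linarith
  have hwb : |w| ≤ A * C * (s - t) := by
    rw [hwd, abs_mul]
    calc _ ≤ A * (s - t) * C := mul_le_mul hξb (hCb x) (abs_nonneg _) pz
      _ = _ := by ring
  have hwlt : ∀ δ' > 0, s - t ≤ δ' / (2 * (A * (C+1))) → |w| < δ' := by
    intro δ' hδ' h
    rw [le_div_iff₀ pz] at h
    nlinarith [mul_nonneg hA0.le hst]
  -- the four terms
  have e1 := b1 (z + w • ev j)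
  have e2 : |rhs u κ θ t (z + w • ev j) - rhs u κ θ t z| < η := by
    apply b2; rw [add_sub_cancel_left, norm_sev]; exact hwlt δ2 hδ2 i2
  have e3 : |θ t (z + w • ev j) - θ t z - w * pd (θ t) j z| ≤ η * |w| := by
    have hd : ∀ r ∈ Set.uIcc 0 w, HasDerivWithinAt (fun r : ℝ => θ t (z + r • ev j) - r * pd (θ t) j z)
        (pd (θ t) j (z + r • ev j) - pd (θ t) j z) (Set.uIcc 0 w) r := fun r _ => by
      refine ((pd_line (h1.differentiable one_ne_zero) j z r).hasDerivWithinAt).fun_sub ?_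
      simpa using (hasDerivWithinAt_id r _).mul_const (pd (θ t) j z)
    have := (convex_uIcc 0 w).norm_image_sub_le_of_norm_hasDerivWithin_le (C := η) hd (fun r hr => by
      refine le_of_lt (b3 _ _ ?_)
      rw [add_sub_cancel_left, norm_sev]
      refine lt_of_le_of_lt ?_ (hwlt δ3 hδ3 i3)
      have := Set.abs_sub_left_of_mem_uIcc hr
      simpa using this) Set.left_mem_uIcc Set.right_mem_uIcc
    simp only [norm_eq_abs, zero_smul, add_zero, zero_mul, sub_zero] at this
    refine le_trans (le_of_eq ?_) this
    congr 1; ring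
  have e4 : |w - (s - t) * (a * γ x)| ≤ η * C * (s - t) := by
    have : w - (s - t) * (a * γ x) = (ξ s - ξ t - (s - t) * a) * γ x := by rw [hwd]; ring
    rw [this, abs_mul]
    calc _ ≤ (η * (s - t)) * C := by
          refine mul_le_mul (b4.trans ?_) (hCb x) (abs_nonneg _) pz
          gcongr; exact min_le_left _ _
      _ = _ := by ring
  have e5 : κ * ∑ i, pd (pd (θ t) i) i z = rhs u κ θ t z + a * γ x * pd (θ t) j z := by
    have hγz : γ z = γ x := hγj x _
    unfold rhs
    rw [hu]; simp only [sum_single]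
    rw [hγz]; ring
  simp only [ez]
  rw [e5]
  have e6 : θ s (z + w • ev j) - θ t z - (s - t) * (rhs u κ θ t z + a * γ x * pd (θ t) j z) =
    (θ s (z + w • ev j) - θ t (z + w • ev j) - (s - t) * rhs u κ θ t (z + w • ev j)) +
    (s - t) * (rhs u κ θ t (z + w • ev j) - rhs u κ θ t z) +
    (θ t (z + w • ev j) - θ t z - w * pd (θ t) j z) +
    (w - (s - t) * (a * γ x)) * pd (θ t) j z := by ring
  rw [e6]
  have f2 : |(s - t) * (rhs u κ θ t (z + w • ev j) - rhs u κ θ t z)| ≤ η * (s - t) := by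
    rw [abs_mul, abs_of_nonneg hst, mul_comm]; gcongr
  have f3 : |θ t (z + w • ev j) - θ t z - w * pd (θ t) j z| ≤ η * (A * (C+1)) * (s - t) := by
    refine e3.trans ?_
    rw [mul_assoc]
    gcongr
    refine hwb.trans ?_
    gcongr; linarith
  have f4 : |(w - (s - t) * (a * γ x)) * pd (θ t) j z| ≤ η * (C * M) * (s - t) := by
    rw [abs_mul]
    calc _ ≤ (η * C * (s - t)) * M := mul_le_mul e4 (hMb z) (abs_nonneg _) pz
      _ = _ := by ring
  refine (abs_add_le _ _).trans ?_
  have g1 := abs_add_le ((θ s (z + w • ev j) - θ t (z + w • ev j) - (s - t) * rhs u κ θ t (z + w • ev j)) +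
    (s - t) * (rhs u κ θ t (z + w • ev j) - rhs u κ θ t z)) (θ t (z + w • ev j) - θ t z - w * pd (θ t) j z)
  have g2 := abs_add_le (θ s (z + w • ev j) - θ t (z + w • ev j) - (s - t) * rhs u κ θ t (z + w • ev j))
    ((s - t) * (rhs u κ θ t (z + w • ev j) - rhs u κ θ t z))
  have g3 : η * (4 * (1 + A * (C+1) + C * M + C)) = ε := by
    rw [hη, div_mul_cancel₀]; positivity
  have g4 : ε * (s - t) =4 * (η * (s - t))+4 * (η * (A * (C+1)) * (s - t))+4 * (η * (C * M) * (s - t)) +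
      4 * (η * C * (s - t)) := by rw [← g3]; ring
  have p1 : 0 ≤ η * (s - t) := by positivity
  have p2 : 0 ≤ η * (A * (C+1)) * (s - t) := by positivity
  have p3 : 0 ≤ η * (C * M) * (s - t) := by positivity
  have p4 : 0 ≤ η * C * (s - t) := by positivity
  linarith

lemma pairing (S : Sys u κ θin θ) {t0 t1 : ℝ} (h0 : 0 ≤ t0) (h01 : t0 ≤ t1) (h1 : t1 ≤1)
    {ξ a : ℝ → ℝ} (hξc : Continuous ξ) (hξ : ∀ t ∈ Set.Ioo t0 t1, HasDerivAt ξ (a t) t)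
    {γ : Vd d → ℝ} (hγ : CP γ) {j : Fin d}
    (hγj : ∀ x (r : ℝ), γ (x + r • ev j) = γ x)
    (hu : ∀ t ∈ Set.Ioo t0 t1, u t = fun x => Pi.single j (a t * γ x))
    {φ : Vd d → ℝ} (hφ : CP φ) {K : ℝ} (hK : 0 ≤ K)
    (hL : ∀ t ∈ Set.Ioo t0 t1, Lip K (fun x => φ (x - (ξ t * γ x) • ev j)))
    {L : ℝ} (hLp : 0 < L) :
    ip (θ t0) (fun x => φ (x - (ξ t0 * γ x) • ev j)) -
      ip (θ t1) (fun x => φ (x - (ξ t1 * γ x) • ev j)) ≤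
    L/4 * (nm (θ t0)^2 - nm (θ t1)^2) + κ * d * K^2 / (2 * L) * (t1 - t0) := by
  have hk := S.kp
  have hw : ∀ s, CP (fun x => ξ s * γ x) := fun s => hγ.smul _
  have hwj : ∀ s x (r : ℝ), ξ s * γ (x + r • ev j) = ξ s * γ x := fun s x r => by rw [hγj]
  have hmem : ∀ t ∈ Set.Icc t0 t1, t ∈ Set.Icc (0:ℝ) 1 := fun t ht => ⟨h0.trans ht.1, ht.2.trans h1⟩
  have heq : ∀ t ∈ Set.Icc t0 t1, ip (θ t) (fun x => φ (x - (ξ t * γ x) • ev j)) =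
      ∫ x in box d, θ t (x + (ξ t * γ x) • ev j) * φ x := fun t ht =>
    (ip_shear (S.cp (hmem t ht)) hφ (hw t) j (hwj t)).symm
  rw [heq t0 ⟨le_rfl, h01⟩, heq t1 ⟨h01, le_rfl⟩]
  have hcγ := hγ.c
  have hcφ := hφ.c
  have key := right_le (f := fun t => - (∫ x in box d, θ t (x + (ξ t * γ x) • ev j) * φ x) +
      L/4 * nm (θ t)^2)
    (f' := fun t => - (∫ x in box d, κ * (∑ i, pd (pd (θ t) i) i (x + (ξ t * γ x) • ev j)) * φ x) +
      L/4 * (- 2 * κ * gr θ t)) (B := κ * d * K^2 / (2 * L)) h01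
    ((ContinuousOn.neg ((S.contInt (F := fun t x => θ t (x + (ξ t * γ x) • ev j) * φ x) (by
        refine ContinuousOn.mul ?_ (by fun_prop)
        exact S.sol.cont.comp (f := fun p : ℝ × Vd d => (p.1, p.2 + (ξ p.1 * γ p.2) • (ev j : Vd d)))
          (by fun_prop) (fun p hp => ⟨hp.1, trivial⟩))).mono hmem)).add
      (continuousOn_const.mul (S.contE.mono hmem)))
    (fun t ht => by
      have ht' : t ∈ Set.Ioo (0:ℝ) 1 := ⟨h0.trans_lt ht.1, ht.2.trans_le h1⟩
      exact (((S.ud_flow ht' (hξ t ht) hγ hγj (hu t ht)).mul_const hφ).int.fun_neg).fun_add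
        ((S.dE ht').const_mul _))
    (fun t ht => by
      have ht' : t ∈ Set.Ioo (0:ℝ) 1 := ⟨h0.trans_lt ht.1, ht.2.trans_le h1⟩
      have h2 := S.c2 ht'
      have h1 : ContDiff ℝ 1 (θ t) := h2.of_le (by norm_num)
      have hp := S.sol.periodic t
      have hΔ := CP_lap h2 hp
      set ψ := fun x => φ (x - (ξ t * γ x) • ev j) with hψ
      have hψl : Lip K ψ := hL t ht
      have hψp : CP ψ := by
        have hw' : CP (fun x => (-1) * (ξ t * γ x)) := (hw t).smul (-1)
        have h1 := (int_shear hφ hw' j (fun x r => by simp only [hγj])).1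
        convert h1 using 3 with x
        rw [sub_eq_add_neg, ← neg_smul]; simp
      have e1 : (∫ x in box d, κ * (∑ i, pd (pd (θ t) i) i (x + (ξ t * γ x) • ev j)) * φ x) =
          κ * ∑ i, ip (pd (pd (θ t) i) i) ψ := by
        have := ip_shear hΔ hφ (hw t) j (hwj t)
        rw [ip_sum _ (fun i => (CP_pd (C1_pd h2 i) (per_pd hp i) i).c) hψp.c] at this
        rw [← this, ip, ← integral_const_mul]
        congr 1; ext x; ring
      have e2 : - ∑ i, ip (pd (pd (θ t) i) i) ψ ≤ L/2 * gr θ t + d * K^2 / (2 * L) := by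
        rw [← Finset.sum_neg_distrib, gr, Finset.mul_sum]
        have : (d:ℝ) * K^2 / (2 * L) = ∑ i : Fin d, K^2 / (2 * L) := by simp; ring
        rw [this, ← Finset.sum_add_distrib]
        refine Finset.sum_le_sum fun i _ => ?_
        have := (abs_le.1 (ibp_lip hK hψp hψl (C1_pd h2 i) (per_pd hp i) i)).1
        have h7 : K * nm (pd (θ t) i) ≤ L/2 * nm (pd (θ t) i)^2 + K^2 / (2 * L) := by
          have h8 := sq_nonneg (L * nm (pd (θ t) i) - K)
          have h9 : L/2 * nm (pd (θ t) i)^2 + K^2 / (2 * L) - K * nm (pd (θ t) i) =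
            (L * nm (pd (θ t) i) - K)^2 / (2 * L) := by field_simp; ring
          have : 0 ≤ (L * nm (pd (θ t) i) - K)^2 / (2 * L) := by positivity
          linarith
        linarith
      rw [e1]
      have := mll e2 hk.le
      have e3 : κ * (L/2 * gr θ t + d * K^2 / (2 * L)) = L/2 * (κ * gr θ t) + κ * d * K^2 / (2 * L) := by ring
      nlinarith)
  linarith

end Sys

end

section
variable {d : ℕ}

def tri (y : ℝ) : ℝ := 2 * |y - round y|

lemma tri_nonneg (y : ℝ) : 0 ≤ tri y := by unfold tri; positivity

lemma tri_le (y : ℝ) : tri y ≤1 := by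
  have := abs_sub_round y
  unfold tri; linarith

lemma tri_lip (y z : ℝ) : |tri y - tri z| ≤2 * |y - z| := by
  have key : ∀ y z, tri y ≤ tri z+2 * |y - z| := fun y z => by
    have h1 := round_le y (round z)
    have h2 := abs_sub_le y z (round z)
    unfold tri; linarith
  rw [abs_le]
  have := key y z
  have h := key z y
  rw [abs_sub_comm] at h
  constructor <;> linarith

lemma tri_cont : Continuous tri := by
  have : LipschitzWith 2 tri := LipschitzWith.of_dist_le_mul fun x y => by
    simpa [Real.dist_eq] using tri_lip x y
  exact this.continuous

lemma tri_int (y : ℝ) (k : ℤ) : tri (y + k) = tri y := by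
  unfold tri
  rw [round_add_intCast]; push_cast; congr 2; ring

lemma tri_even {q : ℤ} {y : ℝ} (h1 : (q:ℝ) ≤ y) (h2 : y ≤ q+1/2) : tri y =2 * (y - q) := by
  unfold tri
  rw [abs_sub_round_eq_min]
  have e : ⌊y⌋ = q := Int.floor_eq_iff.2 ⟨h1, by linarith⟩
  rw [Int.fract, e, min_eq_left (by linarith)]

lemma tri_odd {q : ℤ} {y : ℝ} (h1 : (q:ℝ)+1/2 ≤ y) (h2 : y ≤ q+1) :
    tri y =2 * (q+1 - y) := by
  rcases h2.eq_or_lt with h | h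
  · rw [h]
    have := tri_even (q := q+1) (y := q+1) (by push_cast; rfl) (by push_cast; linarith)
    rw [this]; push_cast; ring
  unfold tri
  rw [abs_sub_round_eq_min]
  have e : ⌊y⌋ = q := Int.floor_eq_iff.2 ⟨by linarith, by linarith⟩
  rw [Int.fract, e, min_eq_right (by linarith)]; ring

def sg (y : ℝ) : ℝ := if Even ⌊2 * y⌋ then 1 else -1

lemma sg_abs (y : ℝ) : |sg y| =1 := by unfold sg; split_ifs <;> simp

lemma sg_sq (y : ℝ) : sg y * sg y =1 := by unfold sg; split_ifs <;> simp

lemma sg_int (y : ℝ) (k : ℤ) : sg (y + k) = sg y := by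
  unfold sg
  have : 2 * (y + k) =2 * y + ((2 * k : ℤ) : ℝ) := by push_cast; ring
  rw [this, Int.floor_add_intCast]
  simp [Int.even_add]

lemma tri_half (y : ℝ) : tri (y+1/2) =1 - tri y := by
  have h1 := Int.floor_le y
  have h2 := (Int.lt_floor_add_one y).le
  rcases le_total y (⌊y⌋ + 1/2) with h | h
  · rw [tri_even h1 h, tri_odd (q := ⌊y⌋) (by linarith) (by linarith)]; ring
  · rw [tri_odd h h2, tri_even (q := ⌊y⌋ + 1) (by push_cast; linarith) (by push_cast; linarith)]
    push_cast; ring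

lemma tri_cell {y z : ℝ} (h : ⌊2 * y⌋ = ⌊2 * z⌋) : tri z - tri y =2 * sg y * (z - y) := by
  have a1 := Int.floor_le (2 * y)
  have a2 := (Int.lt_floor_add_one (2 * y)).le
  have b1 := Int.floor_le (2 * z)
  have b2 := (Int.lt_floor_add_one (2 * z)).le
  rw [← h] at b1 b2
  unfold sg
  obtain ⟨q, hq⟩ | ⟨q, hq⟩ := Int.even_or_odd ⌊2 * y⌋
  · rw [if_pos ⟨q, hq⟩]
    rw [hq] at a1 a2 b1 b2
    push_cast at *
    rw [tri_even (q := q) (y := z) (by linarith) (by linarith), tri_even (q := q) (by linarith) (by linarith)]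
    ring
  · rw [if_neg (by rw [Int.not_even_iff_odd]; exact ⟨q, hq⟩)]
    rw [hq] at a1 a2 b1 b2
    push_cast at *
    rw [tri_odd (q := q) (y := z) (by linarith) (by linarith), tri_odd (q := q) (by linarith) (by linarith)]
    ring

lemma sg_cell {y z : ℝ} (h : ⌊2 * y⌋ = ⌊2 * z⌋) : sg y = sg z := by unfold sg; rw [h]

lemma tri_kink {y z : ℝ} (h : ⌊2 * y⌋ ≠ ⌊2 * z⌋) : ∃ c : ℝ, (c =0 ∨ c =1) ∧
    |tri y - c| ≤2 * |y - z| ∧ |tri z - c| ≤2 * |y - z| := by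
  wlog hyz : y ≤ z generalizing y z
  · obtain ⟨c, hc, h1, h2⟩ := this (Ne.symm h) (le_of_not_ge hyz)
    rw [abs_sub_comm z y] at h1 h2
    exact ⟨c, hc, h2, h1⟩
  have hlt : ⌊2 * y⌋ < ⌊2 * z⌋ := lt_of_le_of_ne (Int.floor_le_floor (by linarith)) h
  have a := Int.floor_lt.1 hlt
  have b := Int.floor_le (2 * z)
  set m := ⌊2 * z⌋
  have e : ∃ c : ℝ, (c =0 ∨ c =1) ∧ tri (m/2) = c := by
    obtain ⟨q, hq⟩ | ⟨q, hq⟩ := Int.even_or_odd m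
    · refine ⟨0, Or.inl rfl, ?_⟩
      rw [hq, tri_even (q := q)] <;> push_cast <;> linarith
    · refine ⟨1, Or.inr rfl, ?_⟩
      rw [hq, tri_even (q := q)] <;> push_cast <;> linarith
  obtain ⟨c, hc, hm⟩ := e
  refine ⟨c, hc, ?_, ?_⟩
  · rw [← hm]
    refine (tri_lip _ _).trans ?_
    rw [abs_of_nonpos (by linarith), abs_of_nonpos (by linarith)]; linarith
  · rw [← hm]
    refine (tri_lip _ _).trans ?_
    rw [abs_of_nonneg (by linarith), abs_of_nonpos (by linarith)]; linarith

def gam {d : ℕ} (N : ℕ) (p : Fin d) (x : Vd d) : ℝ := tri (N * x p)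

lemma gam_cp (N : ℕ) (p : Fin d) : CP (gam N p) := by
  refine ⟨?_, fun x k => ?_⟩
  · unfold gam; have := tri_cont; fun_prop
  · unfold gam
    have : (N:ℝ) * (x + fun i => (k i : ℝ)) p = N * x p + ((N * k p : ℤ) : ℝ) := by
      push_cast; simp; ring
    rw [this, tri_int]

lemma gam_inv (N : ℕ) {p j : Fin d} (h : j ≠ p) (x : Vd d) (r : ℝ) :
    gam N p (x + r • ev j) = gam N p x := by
  simp [gam, ev, Pi.single_apply, h.symm]

lemma gam_lip (N : ℕ) (p : Fin d) : Lip (2 * N) (gam N p) := fun x y => by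
  refine (tri_lip _ _).trans ?_
  rw [← mul_sub, abs_mul, Nat.abs_cast]
  have := norm_le_pi_norm (x - y) p
  rw [norm_eq_abs, Pi.sub_apply] at this
  nlinarith [Nat.cast_nonneg (α := ℝ) N]

lemma gam_nonneg (N : ℕ) (p : Fin d) (x : Vd d) : 0 ≤ gam N p x := tri_nonneg _
lemma gam_le (N : ℕ) (p : Fin d) (x : Vd d) : gam N p x ≤1 := tri_le _

def push {d : ℕ} (D : ℝ) (N : ℕ) (j p : Fin d) (φ : Vd d → ℝ) (x : Vd d) : ℝ :=
  φ (x - (D * gam N p x) • ev j)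

lemma shear_cp {f w : Vd d → ℝ} (hf : CP f) (hw : CP w) (j : Fin d)
    (hwj : ∀ x (r : ℝ), w (x + r • ev j) = w x) : CP (fun x => f (x - w x • ev j)) ∧
    nm (fun x => f (x - w x • ev j)) = nm f := by
  have hw' : CP (fun x => (-1) * w x) := hw.smul (-1)
  have e : (fun x => f (x - w x • ev j)) = fun x => f (x + ((-1) * w x) • ev j) := by
    ext x; rw [sub_eq_add_neg, ← neg_smul]; simp
  rw [e]
  exact ⟨(int_shear hf hw' j (fun x r => by rw [hwj])).1, nm_shear hf hw' j (fun x r => by rw [hwj])⟩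

lemma push_cp {D : ℝ} {N : ℕ} {j p : Fin d} (h : j ≠ p) {φ : Vd d → ℝ} (hφ : CP φ) :
    CP (push D N j p φ) ∧ nm (push D N j p φ) = nm φ :=
  shear_cp hφ ((gam_cp N p).smul D) j (fun x r => by rw [gam_inv N h])

lemma shear_lip {D K : ℝ} (hD : 0 ≤ D) (hK : 0 ≤ K) {N : ℕ} {j p : Fin d} {φ : Vd d → ℝ} (hl : Lip K φ) :
    Lip (K * (1+2 * D * N)) (push D N j p φ) := fun x y => by
  unfold push
  refine (hl _ _).trans ?_
  rw [mul_assoc]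
  refine mll ?_ hK
  have e : x - (D * gam N p x) • (ev j : Vd d) - (y - (D * gam N p y) • ev j) =
    (x - y) - (D * (gam N p x - gam N p y)) • ev j := by
    rw [mul_sub, sub_smul]; abel
  rw [e]
  refine (norm_sub_le _ _).trans ?_
  rw [norm_sev, abs_mul, abs_of_nonneg hD]
  have := mll (gam_lip N p x y) hD
  linarith

def SW {d : ℕ} (φ G : Vd d → ℝ) (j : Fin d) (b : ℝ) : Prop :=
  ∀ ε > 0, ∀ᶠ r in 𝓝[>] (0:ℝ), nm (fun x => φ x - (G (x + r • ev j) - G x) / r) ≤ b + ε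

def CL {d : ℕ} (l : Fin d) (c : ℝ) (G : Vd d → ℝ) : Prop :=
  ∀ r > 0, nm (fun x => G (x + r • ev l) - G x) ≤ c * r

lemma nm_abs (f : Vd d → ℝ) : nm (fun x => |f x|) = nm f := by
  simp only [nm, l2sq, sq_abs]

lemma CP.abs {f : Vd d → ℝ} (hf : CP f) : CP (fun x => |f x|) :=
  ⟨hf.c.abs, fun x k => by simp only [hf.p x k]⟩

lemma CP.dif {G : Vd d → ℝ} (hG : CP G) (v : Vd d) : CP (fun x => G (x + v) - G x) :=
  (hG.trans v).sub hG

lemma three {A v : Vd d → ℝ} (hA : CP A) (hv : CP v) (j : Fin d)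
    (hvj : ∀ x (r : ℝ), v (x + r • ev j) = v x) (D : ℝ) :
    CP (fun x => |A (x - v x • ev j)| + |A x| + |A (x - D • ev j)|) ∧
    nm (fun x => |A (x - v x • ev j)| + |A x| + |A (x - D • ev j)|) ≤3 * nm A := by
  obtain ⟨h1, h2⟩ := shear_cp hA hv j hvj
  have h3 := hA.trans (-(D • ev j))
  have h4 := nm_trans hA (-(D • ev j))
  simp only [← sub_eq_add_neg] at h3 h4
  refine ⟨(h1.abs.add hA.abs).add h3.abs, ?_⟩
  have a := nm_add (h1.abs.add hA.abs).c h3.abs.c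
  have b := nm_add h1.abs.c hA.abs.c
  simp only [nm_abs] at a b
  rw [h2] at b; rw [h4] at a
  linarith

lemma SW.cl {φ G : Vd d → ℝ} {j : Fin d} {b : ℝ} (hφ : CP φ) (hG : CP G) (h : SW φ G j b) :
    CL j (nm φ + b) G := by
  have sub : ∀ s : ℝ, ∀ n : ℕ, nm (fun x => G (x + (n * s) • ev j) - G x) ≤
      n * nm (fun x => G (x + s • ev j) - G x) := by
    intro s n
    induction n with
    | zero => simp [nm_const]
    | succ n ih =>
      have e : (fun x => G (x + ((n+1 : ℕ) * s) • ev j) - G x) = fun x =>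
          (fun y => G (y + s • ev j) - G y) (x + (n * s) • ev j) +
          (G (x + (n * s) • ev j) - G x) := by
        ext x
        have : x + ((n+1 : ℕ) * s) • (ev j : Vd d) = x + (n * s) • ev j + s • ev j := by
          rw [add_assoc, ← add_smul]; push_cast; ring_nf
        rw [this]; ring
      rw [e]
      have h1 := nm_add ((hG.dif (s • ev j)).trans ((n * s) • ev j)).c (hG.dif ((n * s) • ev j)).c
      rw [nm_trans (hG.dif (s • ev j))] at h1
      push_cast
      linarith
  intro r hr
  refine le_of_forall_pos_le_add fun ε hε => ?_
  have ht : Tendsto (fun n : ℕ => r / n) atTop (𝓝[>] 0) := by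
    refine tendsto_nhdsWithin_iff.2 ⟨tendsto_const_div_atTop_nhds_zero_nat r, ?_⟩
    filter_upwards [eventually_gt_atTop 0] with n hn
    have : (0:ℝ) < n := by exact_mod_cast hn
    exact div_pos hr this
  obtain ⟨n, hn, hn0⟩ := ((ht.eventually (h (ε / r) pz)).and (eventually_gt_atTop 0)).exists
  have hnp : (0:ℝ) < n := by exact_mod_cast hn0
  set s := r / n with hs
  have hsp : 0 < s := by positivity
  have e1 : n * s = r := by rw [hs]; field_simp
  have h1 := sub s n
  rw [e1] at h1
  have cq : CP (fun x => 1 / s * (G (x + s • ev j) - G x)) := (hG.dif _).smul _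
  have h2 : nm (fun x => G (x + s • ev j) - G x) ≤ s * (nm φ + (b + ε / r)) := by
    have e2 : (fun x => G (x + s • ev j) - G x) = fun x => s * (φ x - (φ x - (G (x + s • ev j) - G x) / s)) := by
      ext x; field_simp; ring
    rw [e2, nm_smul, abs_of_pos hsp]
    refine mll ?_ hsp.le
    have cq' : CP (fun x => (G (x + s • ev j) - G x) / s) := by simpa [div_eq_inv_mul] using cq
    exact (nm_sub hφ.c (hφ.sub cq').c).trans (by linarith)
  calc _ ≤ n * (s * (nm φ + (b + ε / r))) := h1.trans (mll h2 hnp.le)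
    _ = r * (nm φ + (b + ε / r)) := by rw [← mul_assoc, e1]
    _ = _ := by field_simp; ring

lemma SW.dual {φ G ψ : Vd d → ℝ} {j : Fin d} {b : ℝ} (hφ : CP φ) (hG : CP G) (h : SW φ G j b)
    (hψ : ContDiff ℝ 1 ψ) (hp : SpacePeriodic ψ) :
    ip φ ψ ≤ nm G * nm (pd ψ j) + b * nm ψ := by
  refine le_of_forall_pos_le_add fun ε hε => ?_
  have hA := nm_nonneg ψ
  obtain ⟨r, hr, hr0⟩ := ((h (ε / (nm ψ+1)) pz).and self_mem_nhdsWithin).exists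
  have hr0 : 0 < r := hr0
  have hψc : CP ψ := ⟨hψ.continuous, hp⟩
  have cq : CP (fun x => 1 / r * (G (x + r • ev j) - G x)) := (hG.dif _).smul _
  have eq : (fun x => (G (x + r • ev j) - G x) / r) = fun x => 1 / r * (G (x + r • ev j) - G x) := by
    ext x; ring
  simp only [show ∀ x, (G (x + r • ev j) - G x) / r =1 / r * (G (x + r • ev j) - G x) from fun x => by ring] at hr
  have h1 : ip φ ψ = ip (fun x => φ x - 1 / r * (G (x + r • ev j) - G x)) ψ +
      1 / r * ip (fun x => G (x + r • ev j) - G x) ψ := by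
    rw [ip_sub hφ.c cq.c hψc.c, ip_smul]; ring
  have h2 := ip_le (hφ.sub cq).c hψc.c
  have h3 : ip (fun x => G (x + r • ev j) - G x) ψ ≤ nm G * (r * nm (pd ψ j)) := by
    rw [ip_sub (hG.trans _).c hG.c hψc.c]
    have e : ip (fun x => G (x + r • ev j)) ψ = ip G (fun x => ψ (x + -(r • ev j))) := by
      have := int_trans (hG.mul (hψc.trans (-(r • ev j)))).p (r • ev j)
      unfold ip
      rw [← this]
      congr 1; ext x; rw [add_neg_cancel_right]
    rw [e, ip_comm G, ip_comm G, ← ip_sub (hψc.trans _).c hψc.c hG.c]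
    refine (ip_le (hψc.dif _).c hG.c).trans ?_
    rw [mul_comm]
    refine mll ?_ (nm_nonneg _)
    have := nm_line_diff hψ hp j hr0.le
    rw [← nm_trans (hψc.dif (r • ev j)) (-(r • ev j))] at this
    simp only [neg_add_cancel_right] at this
    rwa [nm_sub_comm] at this
  have h4 : nm (fun x => φ x - 1 / r * (G (x + r • ev j) - G x)) * nm ψ ≤ b * nm ψ + ε := by
    have := mlr hr hA
    have h7 : ε / (nm ψ+1) * nm ψ ≤ ε := by
      rw [div_mul_eq_mul_div, div_le_iff₀ pz]; nlinarith
    linarith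
  have h5 : 1 / r * ip (fun x => G (x + r • ev j) - G x) ψ ≤ nm G * nm (pd ψ j) := by
    calc _ ≤1 / r * (nm G * (r * nm (pd ψ j))) := mll h3 pz
      _ = _ := by field_simp
  linarith

end

section
variable {d : ℕ}

def MM {d : ℕ} (D : ℝ) (j : Fin d) (G : Vd d → ℝ) (v : ℝ) (x : Vd d) : ℝ :=
  G (x - (D * v) • ev j) - (1 - v) * G x - v * G (x - D • ev j)

def Gn {d : ℕ} (D : ℝ) (N : ℕ) (j p : Fin d) (G : Vd d → ℝ) (x : Vd d) : ℝ :=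
  - (sg (N * x p) / (2 * D * N)) * MM D j G (gam N p x) x

lemma MM_le {D : ℝ} {j : Fin d} {G : Vd d → ℝ} {v : ℝ} (h0 : 0 ≤ v) (h1 : v ≤1) (x : Vd d) :
    |MM D j G v x| ≤ |G (x - (D * v) • ev j)| + |G x| + |G (x - D • ev j)| := by
  unfold MM
  refine (abs_sub _ _).trans (add_le_add ((abs_sub _ _).trans (add_le_add le_rfl ?_)) ?_)
  · rw [abs_mul, abs_of_nonneg (by linarith)]
    exact mul_le_of_le_one_left (abs_nonneg _) (by linarith)
  · rw [abs_mul, abs_of_nonneg h0]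
    exact mul_le_of_le_one_left (abs_nonneg _) h1

lemma MM_dif (D : ℝ) (j : Fin d) (G : Vd d → ℝ) (v : ℝ) (x w : Vd d) :
    MM D j G v (x + w) - MM D j G v x = MM D j (fun y => G (y + w) - G y) v x := by
  unfold MM
  have e : ∀ a : Vd d, x + w - a = x - a + w := fun a => by abel
  simp only [e]; ring

lemma MM_lip {D K : ℝ} (hD : 0 ≤ D) (hK : 0 ≤ K) {j : Fin d} {G : Vd d → ℝ} (hG : Lip K G) {v w : ℝ} (h0 : 0 ≤ v)
    (h1 : v ≤1) (x y : Vd d) :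
    |MM D j G v x - MM D j G w y| ≤ K * (2 * ‖x - y‖ + 2 * D * |v - w|) := by
  have a1 : |G (x - (D * v) • ev j) - G (y - (D * w) • ev j)| ≤ K * (‖x - y‖ + D * |v - w|) := by
    refine (hG _ _).trans (mll ?_ hK)
    have e : x - (D * v) • (ev j : Vd d) - (y - (D * w) • ev j) = (x - y) - (D * (v - w)) • ev j := by
      rw [mul_sub, sub_smul]; abel
    rw [e]
    refine (norm_sub_le _ _).trans ?_
    rw [norm_sev, abs_mul, abs_of_nonneg hD]
  have a2 := hG x y
  have a3 : |G (x - D • ev j) - G (y - D • ev j)| ≤ K * ‖x - y‖ := by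
    have := hG (x - D • ev j) (y - D • ev j)
    rwa [sub_sub_sub_cancel_right] at this
  have a4 : |G (y - D • ev j) - G y| ≤ K * D := by
    have := hG (y - D • ev j) y
    rwa [sub_sub_cancel_left, norm_neg, norm_sev, abs_of_nonneg hD] at this
  have e : MM D j G v x - MM D j G w y = (G (x - (D * v) • ev j) - G (y - (D * w) • ev j))
    - (1 - v) * (G x - G y) - v * (G (x - D • ev j) - G (y - D • ev j)) -
      (v - w) * (G (y - D • ev j) - G y) := by unfold MM; ring
  rw [e]
  refine (abs_sub _ _).trans ?_
  have b1 := abs_sub (G (x - (D * v) • ev j) - G (y - (D * w) • ev j)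
    - (1 - v) * (G x - G y)) (v * (G (x - D • ev j) - G (y - D • ev j)))
  have b2 := abs_sub (G (x - (D * v) • ev j) - G (y - (D * w) • ev j)) ((1 - v) * (G x - G y))
  have c1 : |(1 - v) * (G x - G y)| ≤ (1 - v) * (K * ‖x - y‖) := by
    rw [abs_mul, abs_of_nonneg (by linarith)]; exact mll a2 (by linarith)
  have c2 : |v * (G (x - D • ev j) - G (y - D • ev j))| ≤ v * (K * ‖x - y‖) := by
    rw [abs_mul, abs_of_nonneg h0]; exact mll a3 h0
  have c3 : |(v - w) * (G (y - D • ev j) - G y)| ≤ |v - w| * (K * D) := by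
    rw [abs_mul]; exact mll a4 (abs_nonneg _)
  linarith

lemma MM_end {D : ℝ} {j : Fin d} {G : Vd d → ℝ} {c : ℝ} (hc : c =0 ∨ c =1) (x : Vd d) :
    MM D j G c x =0 := by
  rcases hc with rfl | rfl <;> simp [MM]

section
variable {D : ℝ} {N : ℕ} {j p : Fin d} {φ G : Vd d → ℝ}

lemma Gn_lip (hD : 0 < D) (hN : 0 < N) {K : ℝ} (hK : 0 ≤ K) (hG : Lip K G) :
    Lip (K * (2+8 * D * N) / (2 * D * N)) (Gn D N j p G) := by
  intro x y
  have hN' : (0:ℝ) < N := by exact_mod_cast hN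
  have hp : |x p - y p| ≤ ‖x - y‖ := by
    have := norm_le_pi_norm (x - y) p
    rwa [norm_eq_abs, Pi.sub_apply] at this
  have hNp : |(N:ℝ) * x p - N * y p| ≤ N * ‖x - y‖ := by
    rw [← mul_sub, abs_mul, abs_of_pos hN']; gcongr
  have hn := norm_nonneg (x - y)
  have goal : |sg (N * x p) * MM D j G (gam N p x) x - sg (N * y p) * MM D j G (gam N p y) y| ≤
      K * (2+8 * D * N) * ‖x - y‖ := by
    by_cases h : ⌊2 * (N * x p)⌋ = ⌊2 * (N * y p)⌋
    · rw [← sg_cell h, ← mul_sub, abs_mul, sg_abs, one_mul]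
      refine (MM_lip hD.le hK hG (gam_nonneg _ _ _) (gam_le _ _ _) x y).trans ?_
      rw [mul_assoc K]
      refine mll ?_ hK
      have := mll (gam_lip N p x y) hD.le
      nlinarith [mul_nonneg (mul_nonneg hD.le hN'.le) hn]
    · obtain ⟨c, hc, h1, h2⟩ := tri_kink h
      refine (abs_sub _ _).trans ?_
      rw [abs_mul, abs_mul, sg_abs, sg_abs, one_mul, one_mul]
      have b1 := MM_lip hD.le hK hG (w := c) (j := j) (gam_nonneg N p x) (gam_le N p x) x x
      have b2 := MM_lip hD.le hK hG (w := c) (j := j) (gam_nonneg N p y) (gam_le N p y) y y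
      rw [MM_end hc, sub_zero, sub_self, norm_zero] at b1 b2
      have d1 : D * |gam N p x - c| ≤ D * (2 * (N * ‖x - y‖)) := by
        refine mll (h1.trans ?_) hD.le; linarith
      have d2 : D * |gam N p y - c| ≤ D * (2 * (N * ‖x - y‖)) := by
        refine mll (h2.trans ?_) hD.le; linarith
      have := mll d1 hK
      have := mll d2 hK
      have := mul_nonneg hK hn
      nlinarith
  have e : Gn D N j p G x - Gn D N j p G y = - (1 / (2 * D * N)) * (sg (N * x p) * MM D j G (gam N p x) x - sg (N * y p) * MM D j G (gam N p y) y) := by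
    unfold Gn; ring
  rw [e, abs_mul, abs_neg, abs_of_pos pz]
  calc _ ≤1 / (2 * D * N) * (K * (2+8 * D * N) * ‖x - y‖) := mll goal pz
    _ = _ := by ring

lemma Gn_cp (hD : 0 < D) (hN : 0 < N) {K : ℝ} (hK : 0 ≤ K) (hG : Lip K G) (hGp : CP G) :
    CP (Gn D N j p G) := by
  refine ⟨(Gn_lip hD hN hK hG).cont, fun x k => ?_⟩
  have e : (N:ℝ) * (x + fun i => (k i : ℝ)) p = N * x p + ((N * k p : ℤ) : ℝ) := by
    push_cast; simp; ring
  unfold Gn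
  rw [e, sg_int, (gam_cp N p).p x k]
  have e2 : ∀ a : Vd d, x + (fun i => (k i : ℝ)) - a = x - a + fun i => (k i : ℝ) := fun a => by abel
  unfold MM
  rw [e2, e2, hGp.p, hGp.p, hGp.p]

lemma nm_Gn_aux (hD : 0 < D) (hN : 0 < N) (hjp : j ≠ p) {A F v : Vd d → ℝ} (hA : CP A) (hF : CP F)
    (hv : CP v) (hvj : ∀ x (r : ℝ), v (x + r • ev j) = v x) (h0 : ∀ x, 0 ≤ v x) (h1 : ∀ x, v x ≤1)
    (h : ∀ x, |F x| ≤1 / (2 * D * N) * |MM D j A (v x) x|) :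
    nm F ≤3 * nm A / (2 * D * N) := by
  have hN' : (0:ℝ) < N := by exact_mod_cast hN
  obtain ⟨t1, t2⟩ := three hA (hv.smul D) j (fun x r => by rw [hvj]) D
  have := nm_mono hF.c (t1.smul (1 / (2 * D * N))).c (fun x => by
    refine (h x).trans ?_
    rw [abs_mul, abs_of_pos (show 0 <1 / (2 * D * N) by positivity)]
    refine mll ?_ pz
    exact (MM_le (h0 x) (h1 x) x).trans (le_abs_self _))
  rw [nm_smul, abs_of_pos (show 0 <1 / (2 * D * N) by positivity)] at this
  refine this.trans ?_
  calc _ ≤1 / (2 * D * N) * (3 * nm A) := mll t2 pz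
    _ = _ := by ring

lemma nm_Gn (hD : 0 < D) (hN : 0 < N) (hjp : j ≠ p) {K : ℝ} (hK : 0 ≤ K) (hG : Lip K G) (hGp : CP G) :
    nm (Gn D N j p G) ≤3 * nm G / (2 * D * N) := by
  have hN' : (0:ℝ) < N := by exact_mod_cast hN
  refine nm_Gn_aux hD hN hjp hGp (Gn_cp hD hN hK hG hGp) (gam_cp N p) (gam_inv N hjp)
    (gam_nonneg N p) (gam_le N p) fun x => ?_
  unfold Gn
  rw [abs_mul, abs_neg, abs_div, sg_abs, abs_of_pos pz]

lemma Gn_cl (hD : 0 < D) (hN : 0 < N) (hjp : j ≠ p) {K : ℝ} (hK : 0 ≤ K) (hG : Lip K G) (hGp : CP G)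
    {l : Fin d} (hl : l ≠ p) {c : ℝ} (hc : CL l c G) : CL l (3 * c / (2 * D * N)) (Gn D N j p G) := by
  have hN' : (0:ℝ) < N := by exact_mod_cast hN
  intro r hr
  have := nm_Gn_aux hD hN hjp (hGp.dif (r • ev l)) ((Gn_cp hD hN hK hG hGp (j := j) (p := p)).dif (r • ev l))
    (gam_cp N p) (gam_inv N hjp) (gam_nonneg N p) (gam_le N p) fun x => by
    rw [← MM_dif]
    have e : (x + r • ev l) p = x p := by simp [ev, Pi.single_apply, hl.symm]
    unfold Gn
    rw [e, gam_inv N hl, ← mul_sub, abs_mul, abs_neg, abs_div, sg_abs, abs_of_pos (show 0 <2 * D * N by positivity)]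
  refine this.trans ?_
  have h2 := hc r hr
  calc _ ≤3 * (c * r) / (2 * D * N) := by gcongr
    _ = _ := by ring

lemma kink_meas (N : ℕ) (p : Fin d) (r : ℝ) :
    MeasurableSet {x : Vd d | ⌊2 * ((N:ℝ) * x p)⌋ = ⌊2 * ((N:ℝ) * (x p + r))⌋} := by
  apply measurableSet_eq_fun <;> exact Int.measurable_floor.comp (by fun_prop)

def μr {d : ℕ} (N : ℕ) (p : Fin d) (r : ℝ) : ℝ :=
  ∫ x in box d, if ⌊2 * ((N:ℝ) * x p)⌋ = ⌊2 * ((N:ℝ) * (x p + r))⌋ then (0:ℝ) else 1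

lemma μr_nonneg (N : ℕ) (p : Fin d) (r : ℝ) : 0 ≤ μr N p r :=
  integral_nonneg fun x => by dsimp only; split_ifs <;> simp

lemma kink_l2 (N : ℕ) (p : Fin d) (r : ℝ) {F H : Vd d → ℝ} (hF : CP F) (hH : CP H) {C : ℝ}
    (hFC : ∀ x, |F x| ≤ C)
    (hFH : ∀ x : Vd d, ⌊2 * ((N:ℝ) * x p)⌋ = ⌊2 * ((N:ℝ) * (x p + r))⌋ → |F x| ≤ H x) :
    nm F^2 ≤ nm H^2 + C^2 * μr N p r := by
  have hindi : Integrable (fun x : Vd d => if ⌊2 * ((N:ℝ) * x p)⌋ = ⌊2 * ((N:ℝ) * (x p + r))⌋ then (0:ℝ) else 1)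
      (volume.restrict (box d)) := by
    refine Integrable.mono' (integrable_const 1)
      (Measurable.ite (kink_meas N p r) measurable_const measurable_const).aestronglyMeasurable
      (Eventually.of_forall fun x => ?_)
    split_ifs <;> simp
  rw [nm_sq, nm_sq, ip, ip, μr, ← integral_const_mul, ← integral_add (ion (hH.mul hH).c) (hindi.const_mul _)]
  refine integral_mono (ion (hF.mul hF).c) ((ion (hH.mul hH).c).add (hindi.const_mul _)) fun x => ?_
  dsimp only
  split_ifs with h
  · rw [mul_zero, add_zero, ← abs_mul_abs_self (F x)]
    exact mul_self_le_mul_self (abs_nonneg _) (hFH x h)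
  · rw [mul_one, ← abs_mul_abs_self (F x)]
    have := mul_self_le_mul_self (abs_nonneg _) (hFC x)
    nlinarith [mul_self_nonneg (H x)]

lemma kink_tendsto (N : ℕ) (p : Fin d) : Tendsto (fun r : ℝ => μr N p r) (𝓝[>] 0) (𝓝 0) := by
  unfold μr
  have := tendsto_integral_filter_of_dominated_convergence (μ := volume.restrict (box d)) (l := 𝓝[>] (0:ℝ))
    (F := fun r x => if ⌊2 * ((N:ℝ) * x p)⌋ = ⌊2 * ((N:ℝ) * (x p + r))⌋ then (0:ℝ) else 1) (f := fun _ => (0:ℝ))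
    (bound := fun _ => 1) ?_ ?_ (integrable_const _) ?_
  · simpa using this
  · refine Eventually.of_forall fun r => ?_
    exact (Measurable.ite (kink_meas N p r) measurable_const measurable_const).aestronglyMeasurable
  · refine Eventually.of_forall fun r => Eventually.of_forall fun x => ?_
    split_ifs <;> simp
  · refine Eventually.of_forall fun x => ?_
    refine tendsto_const_nhds.congr' ?_
    have hc : Tendsto (fun r : ℝ => 2 * ((N:ℝ) * (x p + r))) (𝓝[>] 0) (𝓝 (2 * ((N:ℝ) * (x p+0)))) :=
      ((by fun_prop : Continuous fun r : ℝ => 2 * ((N:ℝ) * (x p + r))).tendsto 0).mono_left nhdsWithin_le_nhds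
    rw [add_zero] at hc
    filter_upwards [hc.eventually_lt_const (Int.lt_floor_add_one _), self_mem_nhdsWithin] with r h1 h2
    have h2 : 0 < r := h2
    rw [if_pos]
    symm
    rw [Int.floor_eq_iff]
    refine ⟨(Int.floor_le _).trans ?_, h1⟩
    gcongr
    linarith

lemma aux_tr1 {m C e : ℝ} (h : m * (C^2+1) < e) (hm : 0 ≤ m) : C^2 * m ≤ e := by
  nlinarith

lemma aux_tr2 {a h m e : ℝ} (h1 : a^2 ≤ h^2 + m) (h2 : m ≤ e^2) (hh : 0 ≤ h) (he : 0 ≤ e) : a ≤ h + e := by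
  have : 0 ≤ h * e := mul_nonneg hh he
  apply le_of_sq_le_sq _ pz
  nlinarith

set_option maxHeartbeats 1000000 in
lemma transfer (hD : 0 < D) (hN : 0 < N) (hjp : j ≠ p) (hφ : CP φ) (hG : CP G) {K K' : ℝ}
    (hK : 0 ≤ K) (hlG : Lip K G) (hK' : 0 ≤ K') (hlφ : Lip K' φ) {b c : ℝ} (hb : 0 ≤ b) (hc0 : 0 ≤ c)
    (hsw : SW φ G j b) (hc : CL p c G) :
    SW (push D N j p φ) (Gn D N j p G) p (b+2 * nm G / D+3 * c / (2 * D * N)) := by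
  intro ε hε
  have hN' : (0:ℝ) < N := by exact_mod_cast hN
  set R := 2 * D * N with hR
  have hRp : 0 < R := by positivity
  have hGn := Gn_lip (j := j) (p := p) hD hN hK hlG
  have hGnc := Gn_cp (j := j) (p := p) hD hN hK hlG hG
  set Kn := K * (2+8 * D * N) / (2 * D * N)
  obtain ⟨C0, hC0, hφb⟩ := hφ.bdd
  set C := C0 + |Kn| with hC
  have hmul : Tendsto (fun r : ℝ => R * r) (𝓝[>] 0) (𝓝[>] 0) := by
    refine tendsto_nhdsWithin_iff.2 ⟨?_, ?_⟩
    · have : Tendsto (fun r : ℝ => R * r) (𝓝 0) (𝓝 (R*0)) := (continuous_const.mul continuous_id).tendsto 0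
      rw [mul_zero] at this
      exact this.mono_left nhdsWithin_le_nhds
    · filter_upwards [self_mem_nhdsWithin] with r hr
      exact mul_pos hRp hr
  have ev1 := hmul.eventually (hsw (ε/4) pz)
  have ev2 : ∀ᶠ r in 𝓝[>] (0:ℝ), r < ε / (4 * (K' * R+1)) :=
    (eventually_lt_nhds pz).filter_mono nhdsWithin_le_nhds
  have ev3 := (kink_tendsto N p).eventually_lt_const (show 0 < (ε/2)^2 / (C^2+1) by positivity)
  filter_upwards [ev1, ev2, ev3, self_mem_nhdsWithin] with r h1 h2 h3 h4
  have hr : 0 < r := h4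
  have hRr : 0 < R * r := by positivity
  -- profiles
  have hg := gam_cp (d := d) N p
  have hg' : CP (fun x => gam N p (x + r • ev p)) := hg.trans _
  have hgj := gam_inv N hjp
  have hgj' : ∀ (x : Vd d) (s : ℝ), gam N p (x + s • ev j + r • ev p) = gam N p (x + r • ev p) := fun x s => by
    rw [add_right_comm, hgj]
  set w := fun x : Vd d => D * max (gam N p x) (gam N p (x + r • ev p)) with hw
  have hwcp : CP w := ⟨by have := hg.c; have := hg'.c; fun_prop, fun x k => by
    simp only [hw, hg.p x k]
    rw [show gam N p (x + (fun i => (k i : ℝ)) + r • ev p) = gam N p (x + r • ev p) from hg'.p x k]⟩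
  have hwj : ∀ x (s : ℝ), w (x + s • ev j) = w x := fun x s => by simp only [hw, hgj, hgj']
  set E := fun z => φ z - (G (z + (R * r) • ev j) - G z) / (R * r) with hE
  have hEcp : CP E := by
    have : CP (fun x => 1 / (R * r) * (G (x + (R * r) • ev j) - G x)) := (hG.dif _).smul _
    simp only [hE]
    have e : (fun z => φ z - (G (z + (R * r) • ev j) - G z) / (R * r)) = fun z => φ z - 1 / (R * r) * (G (z + (R * r) • ev j) - G z) := by
      ext z; ring
    rw [e]; exact hφ.sub this
  obtain ⟨q1, q2⟩ := shear_cp hEcp hwcp j hwj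
  set dG := fun y => G (y + r • ev p) - G y with hdG
  have hdGcp : CP dG := hG.dif _
  obtain ⟨t1, t2⟩ := three hdGcp (hg'.smul D) j (fun x s => by rw [hgj']) D
  set T := fun x => |dG (x - (D * gam N p (x + r • ev p)) • ev j)| + |dG x| + |dG (x - D • ev j)| with hT
  have hGD := hG.trans (-(D • ev j))
  have hGDn := nm_trans hG (-(D • ev j))
  simp only [← sub_eq_add_neg] at hGD hGDn
  set H := fun x => |E (x - w x • ev j)| + 1 / D * |G x - G (x - D • ev j)| + 1 / (R * r) * T x + K' * (R * r) with hH
  have hconst : CP (fun _ : Vd d => K' * (R * r)) := ⟨continuous_const, fun _ _ => rfl⟩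
  have hHcp : CP H := ((q1.abs.add ((hG.sub hGD).abs.smul _)).add (t1.smul _)).add hconst
  have hHn : nm H ≤ b+2 * nm G / D+3 * c / R + ε/2 := by
    have a1 := nm_add ((q1.abs.add ((hG.sub hGD).abs.smul (1 / D))).add (t1.smul (1 / (R * r)))).c hconst.c
    have a2 := nm_add (q1.abs.add ((hG.sub hGD).abs.smul (1 / D))).c (t1.smul (1 / (R * r))).c
    have a3 := nm_add q1.abs.c ((hG.sub hGD).abs.smul (1 / D)).c
    rw [nm_abs, q2, nm_smul, nm_abs] at a3
    rw [nm_smul] at a2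
    rw [nm_const] at a1
    rw [abs_of_pos pz] at a2 a3
    rw [abs_of_nonneg pz] at a1
    have a4 := nm_sub hG.c hGD.c
    rw [hGDn] at a4
    have a5 : 1 / D * nm (fun x => G x - G (x - D • ev j)) ≤2 * nm G / D := by
      calc _ ≤1 / D * (nm G + nm G) := mll a4 pz
        _ = _ := by ring
    have a6 : 1 / (R * r) * nm T ≤3 * c / R := by
      calc _ ≤1 / (R * r) * (3 * (c * r)) := by
            refine mll (t2.trans ?_) pz
            exact mll (hc r hr) (by norm_num)
        _ = _ := by field_simp
    have a7 : K' * (R * r) ≤ ε/4 := by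
      rw [lt_div_iff₀ pz] at h2
      nlinarith
    linarith
  -- pointwise bound
  set F := fun x => push D N j p φ x - (Gn D N j p G (x + r • ev p) - Gn D N j p G x) / r with hF
  have hFcp : CP F := by
    have : CP (fun x => 1 / r * (Gn D N j p G (x + r • ev p) - Gn D N j p G x)) := (hGnc.dif _).smul _
    have e : F = fun x => push D N j p φ x - 1 / r * (Gn D N j p G (x + r • ev p) - Gn D N j p G x) := by
      ext z; simp only [hF]; ring
    rw [e]; exact (push_cp hjp hφ).1.sub this
  have hFC : ∀ x, |F x| ≤ C := fun x => by
    refine (abs_sub _ _).trans (add_le_add (hφb _) ?_)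
    rw [abs_div, abs_of_pos hr, div_le_iff₀ hr]
    refine (hGn _ _).trans ?_
    rw [add_sub_cancel_left, norm_sev, abs_of_pos hr]
    exact mlr (le_abs_self _) hr.le
  have hFH : ∀ x : Vd d, ⌊2 * ((N:ℝ) * x p)⌋ = ⌊2 * ((N:ℝ) * (x p + r))⌋ → |F x| ≤ H x := fun x hx => by
    have ep : (x + r • ev p) p = x p + r := by simp [ev]
    set v := gam N p x with hv
    set v' := gam N p (x + r • ev p) with hv'
    have hvv : v' - v =2 * sg (N * x p) * (N * r) := by
      have := tri_cell hx
      rw [hv, hv', gam, gam, ep, this]; ring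
    have hsg := sg_cell hx
    set s := sg (N * x p) with hs
    have hMd : MM D j G v' (x + r • ev p) - MM D j G v' x = MM D j dG v' x := MM_dif _ _ _ _ _ _
    have hTle : |MM D j dG v' x| ≤ T x := MM_le (gam_nonneg _ _ _) (gam_le _ _ _) x
    have hDv : D * (v' - v) = s * (R * r) := by rw [hvv, hR]; ring
    have hmain : G (x - (D * v') • ev j) - G (x - (D * v) • ev j) =
        - s * (R * r) * (φ (x - w x • ev j) - E (x - w x • ev j)) := by
      have hEz : ∀ z, R * r * (φ z - E z) = G (z + (R * r) • ev j) - G z := fun z => by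
        simp only [hE]; field_simp; ring
      have hs1 : s =1 ∨ s = -1 := by
        simp only [hs, sg]; split_ifs <;> simp
      rcases hs1 with h | h
      · have hwx : w x = D * v' := by
          simp only [hw]; rw [max_eq_right]
          rw [h] at hDv; by_contra hcon; push Not at hcon; nlinarith
        rw [hwx, h, neg_one_mul, neg_mul, hEz]
        have : x - (D * v') • (ev j : Vd d) + (R * r) • ev j = x - (D * v) • ev j := by
          rw [show R * r = D * v' - D * v by rw [h] at hDv; linarith, sub_smul]; abel
        rw [this]; ring
      · have hwx : w x = D * v := by
          simp only [hw]; rw [max_eq_left]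
          rw [h] at hDv; by_contra hcon; push Not at hcon; nlinarith
        rw [hwx, h, neg_neg, one_mul, hEz]
        have : x - (D * v) • (ev j : Vd d) + (R * r) • ev j = x - (D * v') • ev j := by
          rw [show R * r = D * v - D * v' by rw [h] at hDv; linarith, sub_smul]; abel
        rw [this]
    have hss : s * s =1 := sg_sq _
    have hFeq : F x = (φ (x - (D * v) • ev j) - φ (x - w x • ev j)) + E (x - w x • ev j) +
        1 / D * (G x - G (x - D • ev j)) + s * (1 / (R * r)) * MM D j dG v' x := by
      simp only [hF, push, Gn]
      rw [ep, ← hsg, ← hv, ← hv', ← hR]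
      have e1 : MM D j G v' (x + r • ev p) = MM D j dG v' x + MM D j G v' x := by rw [← hMd]; ring
      have e2 : MM D j G v' x - MM D j G v x = - s * (R * r) * (φ (x - w x • ev j) - E (x - w x • ev j)) +
          (v' - v) * (G x - G (x - D • ev j)) := by
        rw [← hmain]; unfold MM; ring
      have e3 : (-(s / R) * MM D j G v' (x + r • ev p) - -(s / R) * MM D j G v x) =
        -(s / R) * (MM D j dG v' x + (MM D j G v' x - MM D j G v x)) := by rw [e1]; ring
      rw [e3, e2]
      have e4 : v' - v = s * (R * r) / D := by rw [← hDv]; field_simp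
      rw [e4]
      have : -(s / R) * (MM D j dG v' x + (-s * (R * r) * (φ (x - w x • ev j) - E (x - w x • ev j)) +
          s * (R * r) / D * (G x - G (x - D • ev j)))) / r =
          -(s * (1 / (R * r)) * MM D j dG v' x) + s * s * (φ (x - w x • ev j) - E (x - w x • ev j))
          - s * s * (1 / D * (G x - G (x - D • ev j))) := by field_simp; ring
      rw [this, hss]; ring
    have hφd : |φ (x - (D * v) • ev j) - φ (x - w x • ev j)| ≤ K' * (R * r) := by
      refine (hlφ _ _).trans (mll ?_ hK')
      rw [sub_sub_sub_cancel_left, ← sub_smul, norm_sev]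
      simp only [hw]
      rw [← mul_sub, abs_mul, abs_of_pos hD]
      have : |max v v' - v| ≤ |v' - v| := by
        rcases le_total v v' with h | h
        · rw [max_eq_right h]
        · rw [max_eq_left h]; simp
      calc _ ≤ D * |v' - v| := mll this hD.le
        _ = |D * (v' - v)| := by rw [abs_mul, abs_of_pos hD]
        _ = _ := by rw [hDv, abs_mul, hs, sg_abs, one_mul, abs_of_pos hRr]
    rw [hFeq]
    refine (abs_add_le _ _).trans ?_
    have g1 := abs_add_le ((φ (x - (D * v) • ev j) - φ (x - w x • ev j)) + E (x - w x • ev j))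
      (1 / D * (G x - G (x - D • ev j)))
    have g2 := abs_add_le (φ (x - (D * v) • ev j) - φ (x - w x • ev j)) (E (x - w x • ev j))
    have g3 : |s * (1 / (R * r)) * MM D j dG v' x| ≤1 / (R * r) * T x := by
      rw [abs_mul, abs_mul, hs, sg_abs, one_mul, abs_of_pos pz]
      exact mll hTle pz
    rw [abs_mul (1 / D), abs_of_pos (show 0 <1 / D by positivity)] at g1
    simp only [hH]
    linarith
  have hfin := kink_l2 N p r hFcp hHcp hFC hFH
  have hfin2 : C^2 * μr N p r ≤ (ε/2)^2 := by
    rw [lt_div_iff₀ pz] at h3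
    exact aux_tr1 h3 (μr_nonneg N p r)
  have h9 := aux_tr2 hfin hfin2 (nm_nonneg H) pz
  change nm F ≤ _
  linarith

end

section
variable {d : ℕ}

def avg {d : ℕ} (j : Fin d) (f : Vd d → ℝ) (x : Vd d) : ℝ := ∫ s in (0:ℝ)..1, f (x + s • ev j)

def osc {d : ℕ} (j : Fin d) (f : Vd d → ℝ) : ℝ := nm (fun x => f x - avg j f x)

variable {f g : Vd d → ℝ}

lemma avg_cp (hf : CP f) (j : Fin d) : CP (avg j f) := CP_lineint hf _ _ _

lemma avg_nm (hf : CP f) (j : Fin d) : nm (avg j f) ≤ nm f := by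
  have := nm_lineint hf (ev j) (zero_le_one' ℝ)
  rw [sub_zero, one_mul] at this
  exact this

lemma line_int (hf : CP f) (j : Fin d) (x : Vd d) (a b : ℝ) :
    IntervalIntegrable (fun s : ℝ => f (x + s • ev j)) volume a b := by
  have := hf.c
  exact Continuous.intervalIntegrable (by fun_prop) _ _

lemma avg_inv (hf : CP f) (j : Fin d) (x : Vd d) (r : ℝ) : avg j f (x + r • ev j) = avg j f x := by
  have h := (per_line hf.p x j).intervalIntegral_add_eq r 0
  have e : avg j f (x + r • ev j) = ∫ s in (0:ℝ)..1, (fun t : ℝ => f (x + t • ev j)) (s + r) := by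
    unfold avg
    refine intervalIntegral.integral_congr fun s _ => ?_
    simp only [add_smul]; congr 1; abel
  rw [e, intervalIntegral.integral_comp_add_right (fun t : ℝ => f (x + t • ev j))]
  rw [zero_add, add_comm 1 r, h, zero_add]; rfl

lemma avg_inv2 (j l : Fin d) (h : ∀ x (r : ℝ), f (x + r • ev l) = f x) (x : Vd d) (r : ℝ) :
    avg j f (x + r • ev l) = avg j f x := by
  unfold avg
  refine intervalIntegral.integral_congr fun s _ => ?_
  beta_reduce
  rw [add_right_comm, h]

lemma avg_sub (hf : CP f) (hg : CP g) (j : Fin d) (x : Vd d) :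
    avg j (fun x => f x - g x) x = avg j f x - avg j g x := by
  unfold avg
  rw [intervalIntegral.integral_sub (line_int hf j x _ _) (line_int hg j x _ _)]

def avl {d : ℕ} (f : Vd d → ℝ) : List (Fin d) → Vd d → ℝ
  | [] => f
  | j :: l => avg j (avl f l)

lemma avl_cp (hf : CP f) (l : List (Fin d)) : CP (avl f l) := by
  induction l with
  | nil => exact hf
  | cons j l ih => exact avg_cp ih j

lemma avl_int (hf : CP f) (l : List (Fin d)) : ∫ x in box d, avl f l x = ∫ x in box d, f x := by
  induction l with
  | nil => rfl
  | cons j l ih => rw [← ih]; exact int_avg (avl_cp hf l) j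

lemma avl_inv (hf : CP f) (l : List (Fin d)) : ∀ j ∈ l, ∀ x (r : ℝ), avl f l (x + r • ev j) = avl f l x := by
  induction l with
  | nil => simp
  | cons i l ih =>
    intro j hj x r
    rcases List.mem_cons.1 hj with rfl | h
    · exact avg_inv (avl_cp hf l) j x r
    · exact avg_inv2 i j (ih j h) x r

lemma avl_nm (hf : CP f) (l : List (Fin d)) :
    nm (fun x => f x - avl f l x) ≤ (l.map fun j => osc j f).sum := by
  induction l with
  | nil => simp [avl, nm_const]
  | cons j l ih =>
    have h1 := avg_cp hf j
    have h2 := avl_cp hf l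
    have := nm_tri hf.c h1.c (avg_cp h2 j).c
    have e : (fun x => avg j f x - avg j (avl f l) x) = avg j (fun x => f x - avl f l x) := by
      ext x; rw [avg_sub hf h2]
    rw [e] at this
    have h3 := avg_nm (hf.sub h2) j
    simp only [List.map_cons, List.sum_cons]
    change nm (fun x => f x - avg j (avl f l) x) ≤ _
    unfold osc at *
    linarith

lemma inv_all {g : Vd d → ℝ} (h : ∀ j x (r : ℝ), g (x + r • ev j) = g x) (x : Vd d) : g x = g 0 := by
  have : ∀ s : Finset (Fin d), g (∑ j ∈ s, x j • ev j) = g 0 := fun s => by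
    induction s using Finset.induction_on with
    | empty => simp
    | insert a s ha ih => rw [Finset.sum_insert ha, add_comm, h, ih]
  rw [← this Finset.univ]
  congr 1
  ext i
  simp [ev, Finset.sum_apply, Pi.single_apply]

lemma poin (hf : CP f) (h0 : ∫ x in box d, f x =0) : nm f ≤ ∑ j, osc j f := by
  have h1 := avl_nm hf (Finset.univ : Finset (Fin d)).toList
  have h2 := avl_inv hf (Finset.univ : Finset (Fin d)).toList
  have h3 := inv_all (fun j => h2 j (by simp))
  have h4 := avl_int hf (Finset.univ : Finset (Fin d)).toList
  rw [h0] at h4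
  have h5 : avl f (Finset.univ : Finset (Fin d)).toList 0 =0 := by
    rw [← h4, setIntegral_congr_fun (g := fun _ => avl f (Finset.univ : Finset (Fin d)).toList 0)
      box_compact.measurableSet (fun x _ => h3 x)]
    simp
  simp only [h3, h5, sub_zero] at h1
  simpa using h1

lemma push_sub (D : ℝ) (N : ℕ) (j p : Fin d) :
    push D N j p (fun x => f x - g x) = fun x => push D N j p f x - push D N j p g x := rfl

lemma osc_push (hf : CP f) (D : ℝ) (N : ℕ) {j p : Fin d} (h : j ≠ p) :
    nm (fun x => push D N j p f x - f x) ≤2 * osc j f := by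
  have ha := avg_cp hf j
  have e : push D N j p (avg j f) = avg j f := by
    ext x
    rw [push, sub_eq_add_neg, ← neg_smul, avg_inv hf]
  have h1 := nm_tri (push_cp (D := D) (N := N) h hf).1.c ha.c hf.c
  have h2 := (push_cp (D := D) (N := N) h (hf.sub ha)).2
  rw [push_sub, e] at h2
  rw [h2, nm_sub_comm (avg j f)] at h1
  unfold osc
  linarith

lemma osc_close (hf : CP f) (hg : CP g) (j : Fin d) : osc j f ≤ osc j g+2 * nm (fun x => f x - g x) := by
  have ha := avg_cp hf j
  have hb := avg_cp hg j
  have h1 := nm_tri hf.c hg.c ha.c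
  have h2 := nm_tri hg.c hb.c ha.c
  have e : (fun x => avg j g x - avg j f x) = avg j (fun x => g x - f x) := by
    ext x; rw [avg_sub hg hf]
  have h3 := avg_nm (hg.sub hf) j
  rw [← e, nm_sub_comm g f] at h3
  unfold osc
  linarith

lemma exists_dir {F : ℕ → Vd d → ℝ} {D : ℕ → ℝ} {N : ℕ → ℕ} {dir prof : ℕ → Fin d}
    (hF0 : CP (F 0)) (hF : ∀ n, F (n+1) = push (D n) (N n) (dir n) (prof n) (F n))
    (hne : ∀ n, dir n ≠ prof n) (hdir : ∀ n (h : n < d), dir n = ⟨n, h⟩)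
    (h0 : ∫ x in box d, F 0 x =0) (hpos : 0 < nm (F 0)) :
    ∃ j < d, nm (F 0) ≤6 * d^2 * osc (dir j) (F j) := by
  by_contra hcon
  push Not at hcon
  set a := nm (F 0)
  have hd : 0 < (d:ℝ) := by
    rcases Nat.eq_zero_or_pos d with h | h
    · subst h
      have := poin hF0 h0
      simp at this
      exact absurd this (not_le.2 hpos)
    · exact_mod_cast h
  have hcp : ∀ n, CP (F n) := fun n => by
    induction n with
    | zero => exact hF0
    | succ n ih => rw [hF]; exact (push_cp (hne n) ih).1
  have h1 : ∀ j < d, osc (dir j) (F j) ≤ a / (6 * d^2) := fun j hj => by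
    rw [le_div_iff₀ pz]
    linarith [hcon j hj]
  have h2 : ∀ n ≤ d, nm (fun x => F n x - F 0 x) ≤ n * (2 * (a / (6 * d^2))) := fun n => by
    induction n with
    | zero => intro _; simp [nm_const]
    | succ n ih =>
      intro hn
      have e1 := ih (by omega)
      have e2 := osc_push (hcp n) (D n) (N n) (hne n)
      rw [← hF] at e2
      have e3 := nm_tri (hcp (n+1)).c (hcp n).c hF0.c
      have := h1 n (by omega)
      push_cast
      linarith
  have h3 : ∀ j : Fin d, osc j (F 0) ≤ (1+4 * d) * (a / (6 * d^2)) := fun j => by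
    have e1 := osc_close hF0 (hcp j) j
    have e2 := h1 j j.2
    rw [hdir j j.2] at e2
    have e3 := h2 j j.2.le
    have e4 : ((j:ℕ):ℝ) * (2 * (a / (6 * d^2))) ≤ d * (2 * (a / (6 * d^2))) := by
      gcongr; exact_mod_cast j.2.le
    rw [nm_sub_comm] at e1
    simp only [Fin.eta] at e2
    linarith
  have h4 := (poin hF0 h0).trans (Finset.sum_le_sum fun j _ => h3 j)
  simp only [Finset.sum_const, Finset.card_univ, Fintype.card_fin, nsmul_eq_mul] at h4
  have hd1 : (1:ℝ) ≤ d := by exact_mod_cast (Nat.cast_pos.1 hd)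
  have h5 : (d:ℝ) * ((1+4 * d) * (a / (6 * d^2))) = (1+4 * d) * a / (6 * d) := by
    field_simp
  rw [h5, le_div_iff₀ pz] at h4
  have : a * d ≥ a*1 := mll hd1 hpos.le
  change a * (6 * d) ≤ _ at h4
  nlinarith

def om {d : ℕ} (j : Fin d) (f : Vd d → ℝ) (v : ℝ) : ℝ := nm (fun x => f (x + v • ev j) - f x)

lemma om_sq_int (hf : CP f) (j : Fin d) (D a b : ℝ) :
    ∫ v in a..b, om j f (D * v)^2 = ∫ x in box d, ∫ v in a..b, (f (x + (D * v) • ev j) - f x)^2 := by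
  have := hf.c
  rw [swap_box (F := fun v x => (f (x + (D * v) • ev j) - f x)^2)
    (by unfold Function.uncurry; fun_prop)]
  refine intervalIntegral.integral_congr fun v _ => ?_
  simp only [om, nm_sq]
  simp only [ip, sq]

lemma osc_le (hf : CP f) (j : Fin d) : osc j f^2 ≤ ∫ v in (0:ℝ)..1, om j f v^2 := by
  have h := om_sq_int hf j 1 0 1
  simp only [one_mul] at h
  have hc := hf.c
  rw [h, osc, nm_sq, ip]
  have hcx : Continuous (fun x : Vd d => ∫ v in (0:ℝ)..1, (f (x + v • ev j) - f x)^2) :=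
    intervalIntegral.continuous_parametric_intervalIntegral_of_continuous' (by unfold Function.uncurry; fun_prop) _ _
  refine setIntegral_mono (ion ((hf.sub (avg_cp hf j)).mul (hf.sub (avg_cp hf j))).c) (ion hcx) fun x => ?_
  simp only
  set m := avg j f x - f x with hm
  have hi : ∀ c : ℝ, Continuous (fun v : ℝ => f (x + v • ev j) - c) := fun c => by fun_prop
  have h0 : 0 ≤ ∫ v in (0:ℝ)..1, (f (x + v • ev j) - avg j f x)^2 :=
    intervalIntegral.integral_nonneg zero_le_one fun _ _ => sq_nonneg _
  have e : ∀ v : ℝ, (f (x + v • ev j) - avg j f x)^2 =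
      (f (x + v • ev j) - f x)^2 - (2 * m * (f (x + v • ev j) - f x) - m^2) := fun v => by rw [hm]; ring
  have i1 : IntervalIntegrable (fun v : ℝ => (f (x + v • ev j) - f x)^2) volume 0 1 :=
    Continuous.intervalIntegrable (by fun_prop) _ _
  have i2 : IntervalIntegrable (fun v : ℝ => 2 * m * (f (x + v • ev j) - f x)) volume 0 1 :=
    Continuous.intervalIntegrable (by fun_prop) _ _
  have i4 : ∫ v in (0:ℝ)..1, (f (x + v • ev j) - f x) = m := by
    rw [intervalIntegral.integral_sub (line_int hf j x _ _) (by simp)]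
    simp [hm, avg]
  simp only [e] at h0
  rw [intervalIntegral.integral_sub i1 (i2.sub (by simp)), intervalIntegral.integral_sub i2 (by simp),
    intervalIntegral.integral_const_mul, i4] at h0
  simp at h0
  nlinarith

lemma om_mul (hf : CP f) (j : Fin d) (v : ℝ) (M : ℕ) : om j f (M * v) ≤ M * om j f v := by
  induction M with
  | zero => simp [om, nm_const]
  | succ M ih =>
    have h1 := nm_tri (hf.trans (((M+1 : ℕ) * v) • ev j)).c (hf.trans ((M * v) • ev j)).c hf.c
    have h2 := nm_trans (hf.dif (v • ev j)) ((M * v) • ev j)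
    have e : (fun x => f (x + ((M:ℝ) * v) • ev j + v • ev j) - f (x + ((M:ℝ) * v) • ev j)) =
      fun x => f (x + (((M+1 : ℕ):ℝ) * v) • ev j) - f (x + ((M:ℝ) * v) • ev j) := by
      ext x; rw [add_assoc, ← add_smul]; push_cast; congr 4; ring
    rw [e] at h2
    rw [h2] at h1
    unfold om at *
    push_cast at *
    linarith

lemma osc_om (hf : CP f) (j : Fin d) {M : ℕ} (hM : 0 < M) :
    (1 / (M:ℝ))^2 * osc j f^2 ≤ ∫ v in (0:ℝ)..1, om j f (1 / M * v)^2 := by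
  have hM' : (0:ℝ) < M := by exact_mod_cast hM
  have hc : Continuous (fun v => om j f v) := by
    have hfc := hf.c
    unfold om nm l2sq
    refine Real.continuous_sqrt.comp ?_
    exact continuous_parametric_integral_of_continuous (by unfold Function.uncurry; fun_prop) box_compact
  calc _ ≤ (1 / (M:ℝ))^2 * ∫ v in (0:ℝ)..1, om j f v^2 := by gcongr; exact osc_le hf j
    _ = ∫ v in (0:ℝ)..1, (1 / (M:ℝ))^2 * om j f v^2 := by rw [intervalIntegral.integral_const_mul]
    _ ≤ _ := by
      refine intervalIntegral.integral_mono_on zero_le_one (Continuous.intervalIntegrable (by fun_prop) _ _)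
        (Continuous.intervalIntegrable (by fun_prop) _ _) fun v _ => ?_
      have := om_mul hf j (1 / M * v) M
      rw [← mul_assoc, mul_one_div_cancel hM'.ne', one_mul] at this
      rw [← mul_pow]
      refine pow_le_pow_left₀ (mul_nonneg pz (nm_nonneg _)) ?_ 2
      rw [div_mul_eq_mul_div, one_mul, div_le_iff₀ hM']
      change om j f v ≤ _
      linarith

lemma tri_quarter {Ψ : ℝ → ℝ} (hΨ : Continuous Ψ) (h0 : ∀ v, 0 ≤ Ψ v) (y : ℝ) :
    1/4 * ∫ v in (0:ℝ)..1, Ψ v ≤ ∫ s in (0:ℝ)..1, Ψ (2 * tri (y + s) - 1) := by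
  have hper : Function.Periodic (fun s => Ψ (2 * tri s - 1)) 1 := fun s => by
    have := tri_int s 1
    simp only [Int.cast_one] at this
    simp only [this]
  have htc := tri_cont
  have e1 : ∫ s in (0:ℝ)..1, Ψ (2 * tri (y + s) - 1) = ∫ s in (0:ℝ)..1, Ψ (2 * tri s - 1) := by
    rw [intervalIntegral.integral_comp_add_left (fun s => Ψ (2 * tri s - 1)), add_zero,
      hper.intervalIntegral_add_eq y 0, zero_add]
  rw [e1]
  have hi : ∀ a b : ℝ, IntervalIntegrable (fun s => Ψ (2 * tri s - 1)) volume a b := fun a b =>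
    Continuous.intervalIntegrable (by fun_prop) _ _
  rw [← intervalIntegral.integral_add_adjacent_intervals (hi 0 (1/4)) (hi (1/4) 1),
    ← intervalIntegral.integral_add_adjacent_intervals (hi (1/4) (1/2)) (hi (1/2) 1)]
  have p1 : 0 ≤ ∫ s in (0:ℝ)..(1/4), Ψ (2 * tri s - 1) :=
    intervalIntegral.integral_nonneg (by norm_num) fun _ _ => h0 _
  have p2 : 0 ≤ ∫ s in (1/2:ℝ)..1, Ψ (2 * tri s - 1) :=
    intervalIntegral.integral_nonneg (by norm_num) fun _ _ => h0 _
  have e2 : ∫ s in (1/4:ℝ)..(1/2), Ψ (2 * tri s - 1) = ∫ s in (1/4:ℝ)..(1/2), Ψ (4 * s - 1) := by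
    refine intervalIntegral.integral_congr fun s hs => ?_
    rw [Set.uIcc_of_le (by norm_num)] at hs
    have := tri_even (q := 0) (y := s) (by push_cast; linarith [hs.1]) (by push_cast; linarith [hs.2])
    simp only [this]
    congr 1; push_cast; ring
  have e3 : ∫ s in (1/4:ℝ)..(1/2), Ψ (4 * s - 1) =1/4 * ∫ v in (0:ℝ)..1, Ψ v := by
    rw [intervalIntegral.integral_comp_mul_sub (f := Ψ) (by norm_num : (4:ℝ) ≠ 0)]
    norm_num
  linarith

end

section
variable {d : ℕ} {f g : Vd d → ℝ}

lemma push_cl {D : ℝ} {N : ℕ} {j p l : Fin d} (hjp : j ≠ p) (hf : CP f) (hl : l ≠ p) {c : ℝ}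
    (h : CL l c f) : CL l c (push D N j p f) := fun r hr => by
  have e := (push_cp (D := D) (N := N) hjp (hf.dif (r • ev l))).2
  have e2 : (fun x => push D N j p f (x + r • ev l) - push D N j p f x) =
      push D N j p (fun x => f (x + r • ev l) - f x) := by
    ext x
    simp only [push, gam_inv N hl]
    congr 2; abel
  rw [e2, e]
  exact h r hr

lemma push_cl_self {D Γ : ℝ} (hD : 0 ≤ D) {N : ℕ} {j p : Fin d} (hjp : j ≠ p) (hf : ContDiff ℝ 1 f)
    (hp : SpacePeriodic f) (hΓ : ∀ l, nm (pd f l) ≤ Γ) :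
    CL p ((1+4 * D * N) * Γ) (push D N j p f) := fun r hr => by
  have hcp : CP f := ⟨hf.continuous, hp⟩
  set S := D * (2 * N * r) with hS
  have hS0 : 0 ≤ S := by positivity
  have hpd := CP_pd hf hp j
  have hI := CP_lineint hpd.abs (ev j) (-S) S
  have hIn := nm_lineint hpd.abs (ev j) (show -S ≤ S by linarith)
  rw [nm_abs] at hIn
  set I := fun x => ∫ s in (-S)..S, |pd f j (x + s • ev j)| with hIdef
  obtain ⟨q1, q2⟩ := push_cp (D := D) (N := N) hjp hI
  obtain ⟨q3, q4⟩ := shear_cp (hcp.dif (r • ev p)) (((gam_cp N p).trans (r • ev p)).smul D) j (fun x s => by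
    rw [add_right_comm, gam_inv N hjp])
  have hbd : ∀ x, |push D N j p f (x + r • ev p) - push D N j p f x| ≤
      |(|f (x - (D * gam N p (x + r • ev p)) • ev j + r • ev p) - f (x - (D * gam N p (x + r • ev p)) • ev j)| +
        push D N j p I x)| := fun x => by
    refine le_trans ?_ (le_abs_self _)
    set v := gam N p x
    set v' := gam N p (x + r • ev p) with hv'
    have hvv : |v - v'| ≤2 * N * r := by
      have := gam_lip N p x (x + r • ev p)
      rw [sub_add_cancel_left, norm_neg, norm_sev, abs_of_pos hr] at this
      exact this
    have e1 : push D N j p f (x + r • ev p) = f (x - (D * v') • ev j + r • ev p) := by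
      rw [push, ← hv']; congr 1; abel
    have e2 : f (x - (D * v') • ev j) = f (x - (D * v) • ev j + (D * (v - v')) • ev j) := by
      congr 1; rw [mul_sub, sub_smul]; abel
    have e3 := line_diff hf j (x - (D * v) • ev j) (D * (v - v'))
    have hw : |D * (v - v')| ≤ S := by
      rw [abs_mul, abs_of_nonneg hD]; exact mll hvv hD
    have e4 : |f (x - (D * v') • ev j) - f (x - (D * v) • ev j)| ≤ push D N j p I x := by
      rw [e2, e3]
      have hci : ∀ a b : ℝ, IntervalIntegrable (fun s : ℝ => |pd f j (x - (D * v) • ev j + s • ev j)|) volume a b :=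
        fun a b => line_int hpd.abs j _ a b
      rw [← norm_eq_abs]
      refine (intervalIntegral.norm_integral_le_abs_integral_norm).trans ?_
      simp only [norm_eq_abs]
      rw [abs_le] at hw
      have hpush : push D N j p I x = ∫ s in (-S)..S, |pd f j (x - (D * v) • ev j + s • ev j)| := rfl
      rw [hpush]
      rcases le_total 0 (D * (v - v')) with h | h
      · rw [abs_of_nonneg (intervalIntegral.integral_nonneg h fun _ _ => abs_nonneg _)]
        exact intervalIntegral.integral_mono_interval (by linarith) h hw.2
          (Filter.Eventually.of_forall fun _ => abs_nonneg _) (hci _ _)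
      · rw [intervalIntegral.integral_symm, abs_neg,
          abs_of_nonneg (intervalIntegral.integral_nonneg h fun _ _ => abs_nonneg _)]
        exact intervalIntegral.integral_mono_interval hw.1 h hS0
          (Filter.Eventually.of_forall fun _ => abs_nonneg _) (hci _ _)
    rw [e1, push]
    refine (abs_sub_le _ (f (x - (D * v') • ev j)) _).trans (add_le_add le_rfl e4)
  have h1 := nm_mono (((push_cp (D := D) (N := N) hjp hcp).1).dif (r • ev p)).c (q3.abs.add q1).c hbd
  have h2 := nm_add q3.abs.c q1.c
  rw [nm_abs, q4, q2] at h2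
  have h3 := nm_line_diff hf hp p hr.le
  have h4 := mll (hΓ p) hr.le
  have h5 : (S - -S) * nm (pd f j) ≤ (S - -S) * Γ := mll (hΓ j) (by linarith)
  have : (1+4 * D * N) * Γ * r = r * Γ + (S - -S) * Γ := by rw [hS]; ring
  rw [this]
  linarith

set_option maxHeartbeats 400000 in
lemma catch_low {M N : ℕ} (hM : 0 < M) (hN : 0 < N) {j p : Fin d} (hjp : j ≠ p) (hf : CP f) {Γ : ℝ} (hΓ0 : 0 ≤ Γ)
    (hΓ : CL p Γ f) :
    1/2 * (1 / M) * osc j f - 3 * Γ / N ≤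
      nm (fun x => push (1 / M) N j p f x - push (1 / M) N j p f (x + (1 / (2 * N) : ℝ) • ev p)) := by
  have hN' : (0:ℝ) < N := by exact_mod_cast hN
  have hM' : (0:ℝ) < M := by exact_mod_cast hM
  set D : ℝ := 1 / M with hD
  set h : ℝ := 1 / (2 * N) with hh
  have hh0 : 0 < h := by positivity
  have hfc := hf.c
  have hgc := (gam_cp (d := d) N p).c
  obtain ⟨P1, -⟩ := push_cp (D := D) (N := N) hjp hf
  set e := nm (fun x => push D N j p f x - push D N j p f (x + h • ev p)) with he
  -- Z
  have hW : ∀ s : ℝ, CP (fun x => D * (1 - 2 * gam N p (x + s • ev p))) := fun s => by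
    have h1 := (gam_cp N p).trans (s • (ev p : Vd d))
    refine ⟨by have := h1.c; fun_prop, fun x k => ?_⟩
    have h2 : gam N p (x + (fun i => (k i : ℝ)) + s • ev p) = gam N p (x + s • ev p) := h1.p x k
    rw [h2]
  have hWj : ∀ s : ℝ, ∀ (x : Vd d) (r : ℝ), D * (1 - 2 * gam N p (x + r • ev j + s • ev p)) =
      D * (1 - 2 * gam N p (x + s • ev p)) := fun s x r => by
    rw [add_right_comm, gam_inv N hjp]
  set Z : ℝ → Vd d → ℝ := fun s x => f x - f (x - (D * (1 - 2 * gam N p (x + s • ev p))) • ev j) with hZ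
  have hZcp : ∀ s, CP (Z s) := fun s => hf.sub (shear_cp hf (hW s) j (hWj s)).1
  have hZ0 : nm (Z 0) ≤ e + Γ * h := by
    have a1 := (push_cp (D := D) (N := N) hjp (hZcp 0)).2
    have hV : CP (fun x : Vd d => D * (1 - gam N p x)) := ⟨by fun_prop, fun x k => by rw [(gam_cp N p).p x k]⟩
    obtain ⟨b1, b2⟩ := shear_cp (hf.dif (h • ev p)) hV j (fun x r => by rw [gam_inv N hjp])
    have a2 := nm_add (P1.sub (P1.trans (h • ev p))).c b1.c
    rw [b2] at a2
    have a3 := hΓ h hh0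
    have a4 : (fun x => push D N j p f x - push D N j p f (x + h • ev p) +
        (f (x - (D * (1 - gam N p x)) • ev j + h • ev p) - f (x - (D * (1 - gam N p x)) • ev j))) =
        push D N j p (Z 0) := by
      ext x
      have g1 : gam N p (x + h • ev p) =1 - gam N p x := by
        have : (x + h • ev p) p = x p + h := by simp [ev]
        rw [gam, this, gam, ← tri_half]
        congr 1; rw [hh]; field_simp
      have g2 : gam N p (x - (D * gam N p x) • ev j) = gam N p x := by
        rw [sub_eq_add_neg, ← neg_smul, gam_inv N hjp]
      simp only [push, hZ, g1, zero_smul, add_zero, g2]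
      have g3 : x - (D * gam N p x) • ev j - (D * (1 - 2 * gam N p x)) • ev j = x - (D * (1 - gam N p x)) • ev j := by
        rw [sub_sub, ← add_smul]; congr 2; ring
      have g4 : x + h • ev p - (D * (1 - gam N p x)) • ev j = x - (D * (1 - gam N p x)) • ev j + h • ev p := by abel
      rw [g3, g4]; ring
    rw [a4, a1] at a2
    linarith
  have hZs : ∀ s, 0 ≤ s → nm (Z s) ≤ nm (Z 0)+2 * (Γ * s) := fun s hs => by
    rcases hs.eq_or_lt with rfl | hs
    · simp
    have a0 := hΓ s hs
    have a1 := nm_trans (hZcp s) (-(s • ev p))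
    have a2 := nm_trans (hf.dif (s • ev p)) (-(s • ev p))
    simp only [neg_add_cancel_right] at a2
    set Y := fun x => f x - f (x + -(s • ev p)) with hY
    have hYc : CP Y := hf.sub (hf.trans _)
    obtain ⟨b1, b2⟩ := shear_cp hYc (hW 0) j (hWj 0)
    have a3 := nm_add ((hZcp 0).sub hYc).c b1.c
    have a4 := nm_sub (hZcp 0).c hYc.c
    rw [b2] at a3
    have a5 : (fun x => Z 0 x - Y x + Y (x - (D * (1 - 2 * gam N p (x + (0:ℝ) • ev p))) • ev j)) =
        fun x => Z s (x + -(s • ev p)) := by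
      ext x
      simp only [hZ, hY, neg_add_cancel_right, zero_smul, add_zero]
      have : x + -(s • ev p) - (D * (1 - 2 * gam N p x)) • ev j = x - (D * (1 - 2 * gam N p x)) • ev j + -(s • ev p) := by abel
      rw [this]; ring
    rw [a5, a1] at a3
    have a6 : nm Y ≤ Γ * s := by rw [hY, a2]; exact a0
    linarith
  -- average
  have hcont : Continuous (Function.uncurry fun (s : ℝ) (x : Vd d) => Z (s / N) x^2) := by
    unfold Function.uncurry
    simp only [hZ]
    fun_prop
  have hsw := swap_box hcont 0 1
  have hup : ∫ s in (0:ℝ)..1, ∫ x in box d, Z (s / N) x^2 ≤ (e + Γ * h+2 * (Γ / N))^2 := by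
    have : ∫ s in (0:ℝ)..1, (e + Γ * h+2 * (Γ / N))^2 = (e + Γ * h+2 * (Γ / N))^2 := by simp
    rw [← this]
    refine intervalIntegral.integral_mono_on zero_le_one ?_ (by simp) fun s hs => ?_
    · refine Continuous.intervalIntegrable ?_ _ _
      exact continuous_parametric_integral_of_continuous hcont box_compact
    · have a1 : ∫ x in box d, Z (s / N) x^2 = nm (Z (s / N))^2 := by
        rw [nm_sq, ip]; simp only [sq]
      have a2 := hZs (s / N) (by have := hs.1; positivity)
      have a3 : Γ * (s / N) ≤ Γ / N := by
        rw [← mul_div_assoc]; gcongr; nlinarith [hs.2]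
      rw [a1]
      exact pow_le_pow_left₀ (nm_nonneg _) (by linarith) 2
  have hlow : 1/4 * ∫ v in (0:ℝ)..1, om j f (D * v)^2 ≤ ∫ x in box d, ∫ s in (0:ℝ)..1, Z (s / N) x^2 := by
    rw [om_sq_int hf, ← integral_const_mul]
    refine setIntegral_mono (ion ?_) (ion ?_) fun x => ?_
    · refine continuous_const.mul (intervalIntegral.continuous_parametric_intervalIntegral_of_continuous' ?_ _ _)
      unfold Function.uncurry; fun_prop
    · refine intervalIntegral.continuous_parametric_intervalIntegral_of_continuous' ?_ _ _
      exact hcont.comp continuous_swap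
    · refine (tri_quarter (Ψ := fun v => (f (x + (D * v) • ev j) - f x)^2) (by fun_prop) (fun _ => sq_nonneg _)
        (N * x p)).trans (le_of_eq ?_)
      refine intervalIntegral.integral_congr fun s _ => ?_
      simp only [hZ]
      have g1 : gam N p (x + (s / N) • ev p) = tri (N * x p + s) := by
        have : (x + (s / N) • ev p) p = x p + s / N := by simp [ev]
        rw [gam, this]; congr 1; field_simp
      rw [g1]
      have : x - (D * (1 - 2 * tri (N * x p + s))) • ev j = x + (D * (2 * tri (N * x p + s) - 1)) • ev j := by
        rw [sub_eq_add_neg, ← neg_smul]; congr 2; ring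
      rw [this]; ring
  have hom := osc_om hf j hM
  have hosc : 0 ≤ osc j f := nm_nonneg _
  have hfin : (1/2 * D * osc j f)^2 ≤ (e + Γ * h+2 * (Γ / N))^2 := by
    rw [hsw] at hlow
    rw [← hD] at hom
    nlinarith
  have he0 : 0 ≤ e := nm_nonneg _
  have := le_of_sq_le_sq hfin pz
  have g5 : Γ * h ≤ Γ / N := by
    rw [hh, mul_one_div]; gcongr; linarith
  rw [mul_div_assoc]
  linarith

lemma test_fn {F : Vd d → ℝ} (hF : CP F) {K : ℝ} (hK : 0 ≤ K) (hl : Lip K F) (p : Fin d) {h : ℝ} (hh : 0 < h) :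
    ∃ φ G : Vd d → ℝ, CP φ ∧ CP G ∧ (∃ K1, 0 ≤ K1 ∧ Lip K1 φ) ∧ (∃ K2, 0 ≤ K2 ∧ Lip K2 G) ∧
      ip F φ = nm (fun x => F x - F (x + h • ev p))^2/2 ∧
      nm φ ≤ nm (fun x => F x - F (x + h • ev p)) ∧
      nm G ≤ h/2 * nm (fun x => F x - F (x + h • ev p)) ∧ SW φ G p 0 ∧
      ∀ l c, CL l c F → CL l (h * c) G := by
  have hFt := hF.trans (h • ev p)
  set y := fun x => F x - F (x + h • ev p) with hy
  have hyc : CP y := hF.sub hFt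
  have hyl : Lip (2 * K) y := fun x z => by
    have h1 := hl x z
    have h2 := hl (x + h • ev p) (z + h • ev p)
    rw [add_sub_add_right_eq_sub] at h2
    have : y x - y z = (F x - F z) - (F (x + h • ev p) - F (z + h • ev p)) := by simp only [hy]; ring
    rw [this]
    refine (abs_sub _ _).trans (by linarith)
  have hyt := hyc.trans (-(h • ev p))
  set φ := fun x => 1/2 * (y x - y (x + -(h • ev p))) with hφ
  have hφc : CP φ := (hyc.sub hyt).smul _
  set I := fun x => ∫ s in (-h)..0, y (x + s • ev p) with hI
  have hIc : CP I := CP_lineint hyc _ _ _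
  set G := fun x => 1/2 * I x with hG
  have hIl : Lip (2 * K * h) I := fun x z => by
    simp only [hI]
    rw [← intervalIntegral.integral_sub (line_int hyc p x _ _) (line_int hyc p z _ _)]
    have := intervalIntegral.norm_integral_le_of_norm_le_const (a := -h) (b := 0) (C := 2 * K * ‖x - z‖)
      (f := fun s : ℝ => y (x + s • ev p) - y (z + s • ev p)) fun s _ => by
        have := hyl (x + s • ev p) (z + s • ev p)
        rw [add_sub_add_right_eq_sub] at this
        exact this
    rw [sub_neg_eq_add, zero_add, abs_of_pos hh, norm_eq_abs] at this
    linarith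
  refine ⟨φ, G, hφc, hIc.smul _, ⟨2 * K, by positivity, fun x z => ?_⟩, ⟨K * h, by positivity, fun x z => ?_⟩,
    ?_, ?_, ?_, ?_, ?_⟩
  · have h1 := hyl x z
    have h2 := hyl (x + -(h • ev p)) (z + -(h • ev p))
    rw [add_sub_add_right_eq_sub] at h2
    have : φ x - φ z =1/2 * ((y x - y z) - (y (x + -(h • ev p)) - y (z + -(h • ev p)))) := by simp only [hφ]; ring
    rw [this, abs_mul, abs_of_pos (by norm_num : (0:ℝ) <1/2)]
    have := abs_sub (y x - y z) (y (x + -(h • ev p)) - y (z + -(h • ev p)))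
    linarith
  · have : G x - G z =1/2 * (I x - I z) := by simp only [hG]; ring
    rw [this, abs_mul, abs_of_pos (by norm_num : (0:ℝ) <1/2)]
    linarith [hIl x z]
  · have e1 : ip F y = nm y^2/2 := by
      have a1 := nm_sub_sq hF.c hFt.c
      rw [nm_trans hF] at a1
      have a2 := ip_sub hF.c hFt.c hF.c
      have a3 := nm_sq F
      have a4 := ip_comm (fun x => F (x + h • ev p)) F
      rw [ip_comm, a2, a4, ← a3, a1]
      ring
    have e2 : ip F (fun x => y (x + -(h • ev p))) = nm y^2/2 - nm y^2 := by
      have a1 := int_trans (f := fun x => F x * y (x + -(h • ev p))) (hF.mul hyt).p (h • ev p)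
      simp only [add_neg_cancel_right] at a1
      have a2 : ip (fun x => F x - y x) y = ip F (fun x => y (x + -(h • ev p))) := by
        rw [ip, ip, ← a1]; simp only [hy]
        congr 1; ext x; ring
      rw [← a2, ip_sub hF.c hyc.c hyc.c, e1, ← nm_sq]
    rw [hφ, ip_comm, ip_smul, ip_sub hyc.c hyt.c hF.c, ip_comm y, e1, ip_comm _ F, e2]
    ring
  · have := nm_sub hyc.c hyt.c
    rw [nm_trans hyc] at this
    rw [hφ, nm_smul, abs_of_pos (by norm_num : (0:ℝ) <1/2)]
    linarith
  · have := nm_lineint hyc (ev p) (show -h ≤0 by linarith)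
    rw [hG, nm_smul, abs_of_pos (by norm_num : (0:ℝ) <1/2)]
    simp only [sub_neg_eq_add, zero_add] at this
    calc _ ≤1/2 * (h * nm y) := by gcongr
      _ = _ := by ring
  · intro ε hε
    have hev : ∀ᶠ r in 𝓝[>] (0:ℝ), r < ε / (2 * K+1) :=
      (eventually_lt_nhds pz).filter_mono nhdsWithin_le_nhds
    filter_upwards [hev, self_mem_nhdsWithin] with r hr1 hr
    have hr : 0 < r := hr
    rw [lt_div_iff₀ pz] at hr1
    have hGc : CP G := hIc.smul _
    have hcc : Continuous (fun x => φ x - (G (x + r • ev p) - G x) / r) :=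
      hφc.c.sub ((hGc.dif _).c.div_const r)
    refine nm_le hcc fun x => ?_
    have i1 : ∀ a b : ℝ, IntervalIntegrable (fun s : ℝ => y (x + s • ev p)) volume a b := line_int hyc p x
    have e1 : I (x + r • ev p) - I x = (∫ s in (0:ℝ)..r, y (x + s • ev p)) - ∫ s in (-h)..(-h + r), y (x + s • ev p) := by
      have a1 : I (x + r • ev p) = ∫ s in (-h + r)..r, y (x + s • ev p) := by
        have := intervalIntegral.integral_comp_add_right (a := -h) (b := 0) (fun s : ℝ => y (x + s • ev p)) r
        rw [zero_add] at this
        rw [← this]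
        refine intervalIntegral.integral_congr fun s _ => ?_
        beta_reduce
        rw [add_smul]; congr 1; abel
      have a2 : I x = (∫ s in (-h)..(-h + r), y (x + s • ev p)) + ((∫ s in (-h + r)..r, y (x + s • ev p)) +
          ∫ s in r..0, y (x + s • ev p)) := by
        rw [intervalIntegral.integral_add_adjacent_intervals (i1 _ _) (i1 _ _),
          intervalIntegral.integral_add_adjacent_intervals (i1 _ _) (i1 _ _)]
      rw [a1, a2, intervalIntegral.integral_symm 0 r]; ring
    have e2 : ∀ c : ℝ, |(∫ s in c..(c + r), y (x + s • ev p)) - r * y (x + c • ev p)| ≤2 * K * r * r := fun c => by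
      have a1 : ∫ s in c..(c + r), y (x + c • ev p) = r * y (x + c • ev p) := by simp
      rw [← a1, ← intervalIntegral.integral_sub (i1 _ _) (by simp)]
      have := intervalIntegral.norm_integral_le_of_norm_le_const (a := c) (b := c + r) (C := 2 * K * r)
        (f := fun s : ℝ => y (x + s • ev p) - y (x + c • ev p)) fun s hs => by
          rw [Set.uIoc_of_le (by linarith)] at hs
          refine (hyl _ _).trans ?_
          rw [add_sub_add_left_eq_sub, ← sub_smul, norm_sev, abs_of_pos (by linarith [hs.1])]
          gcongr
          linarith [hs.2]
      rwa [add_sub_cancel_left, abs_of_pos hr] at this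
    have f1 := e2 0
    have f2 := e2 (-h)
    simp only [zero_add, zero_smul, add_zero, neg_smul] at f1 f2
    have e3 : φ x - (G (x + r • ev p) - G x) / r =1 / (2 * r) *
        (-((∫ s in (0:ℝ)..r, y (x + s • ev p)) - r * y x) +
          ((∫ s in (-h)..(-h + r), y (x + s • ev p)) - r * y (x + -(h • ev p)))) := by
      have : G (x + r • ev p) - G x =1/2 * (I (x + r • ev p) - I x) := by simp only [hG]; ring
      rw [this, e1]; simp only [hφ]
      field_simp
      ring
    rw [e3, abs_mul, abs_of_pos pz]
    have f3 := abs_add_le (-((∫ s in (0:ℝ)..r, y (x + s • ev p)) - r * y x))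
          ((∫ s in (-h)..(-h + r), y (x + s • ev p)) - r * y (x + -(h • ev p)))
    rw [abs_neg] at f3
    calc _ ≤1 / (2 * r) * (2 * K * r * r+2 * K * r * r) := by gcongr; linarith
      _ =2 * K * r := by field_simp; ring
      _ ≤ _ := by nlinarith
  · intro l c hc r hr
    have a1 := hc r hr
    have hFd := hF.dif (r • ev l)
    have a2 := nm_sub hFd.c (hFd.trans (h • ev p)).c
    rw [nm_trans hFd] at a2
    have a3 : (fun x => F (x + r • ev l) - F x - (F (x + h • ev p + r • ev l) - F (x + h • ev p))) =
        fun x => y (x + r • ev l) - y x := by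
      ext x; simp only [hy]; rw [add_right_comm x (r • ev l)]; ring
    rw [a3] at a2
    have a4 := nm_lineint (hyc.dif (r • ev l)) (ev p) (show -h ≤0 by linarith)
    have a5 : (fun x => G (x + r • ev l) - G x) = fun x => 1/2 * ∫ s in (-h)..0, (y (x + s • ev p + r • ev l) - y (x + s • ev p)) := by
      ext x
      have i1 := line_int (hyc.trans (r • ev l)) p x (-h) 0
      rw [intervalIntegral.integral_sub i1 (line_int hyc p x _ _)]
      simp only [hG, hI]
      rw [← mul_sub]
      congr 3
      ext s; congr 1; abel
    rw [a5, nm_smul, abs_of_pos (by norm_num : (0:ℝ) <1/2)]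
    simp only [sub_neg_eq_add, zero_add] at a4
    have a6 : h * nm (fun x => y (x + r • ev l) - y x) ≤ h * (c * r + c * r) := by gcongr; linarith
    linarith

end

section
variable {d : ℕ}

lemma push_inv (D : ℝ) (N : ℕ) {j p : Fin d} (h : j ≠ p) (φ : Vd d → ℝ) :
    push D N j p (push (-D) N j p φ) = φ := by
  ext x
  have : gam N p (x - (D * gam N p x) • ev j) = gam N p x := by
    rw [sub_eq_add_neg, ← neg_smul, gam_inv N h]
  rw [push, push, this, neg_mul, neg_smul, sub_neg_eq_add, sub_add_cancel]

lemma push_ip (D : ℝ) (N : ℕ) {j p : Fin d} (h : j ≠ p) {φ ψ : Vd d → ℝ} (hφ : CP φ) (hψ : CP ψ) :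
    ip (push D N j p φ) (push D N j p ψ) = ip φ ψ := by
  have := (int_shear (hφ.mul hψ) ((gam_cp N p).smul (-D)) j (fun x r => by rw [gam_inv N h])).2
  rw [ip, ip, ← this]
  simp only [push, neg_mul, neg_smul, sub_eq_add_neg]

lemma Lip.mono {K K' : ℝ} {φ : Vd d → ℝ} (h : Lip K φ) (hk : K ≤ K') : Lip K' φ := fun x y =>
  (h x y).trans (mlr hk (norm_nonneg _))

lemma CL.mono {c c' : ℝ} {l : Fin d} {φ : Vd d → ℝ} (h : CL l c φ) (hk : c ≤ c') : CL l c' φ := fun r hr =>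
  (h r hr).trans (mlr hk hr.le)

lemma SW.mono {c c' : ℝ} {l : Fin d} {φ G : Vd d → ℝ} (h : SW φ G l c) (hk : c ≤ c') : SW φ G l c' := fun r hr => by
  filter_upwards [h r hr] with x hx
  linarith

lemma push_lip_ex (D : ℝ) (N : ℕ) (j p : Fin d) {φ : Vd d → ℝ} {K : ℝ} (hK : 0 ≤ K) (hl : Lip K φ) :
    Lip (K * (1+2 * |D| * N)) (push D N j p φ) := fun x y => by
  refine (hl _ _).trans ?_
  rw [mul_assoc]
  refine mll ?_ hK
  have e : x - (D * gam N p x) • ev j - (y - (D * gam N p y) • ev j) =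
      (x - y) - (D * (gam N p x - gam N p y)) • ev j := by rw [mul_sub, sub_smul]; abel
  rw [e]
  refine (norm_sub_le _ _).trans ?_
  rw [norm_sev, abs_mul]
  have := mll (gam_lip N p x y) (abs_nonneg D)
  linarith

structure Cas (d : ℕ) where
  D : ℕ → ℝ
  N : ℕ → ℕ
  dir : ℕ → Fin d
  prof : ℕ → Fin d

def Cas.itp {d : ℕ} (C : Cas d) (φ : Vd d → ℝ) : ℕ → Vd d → ℝ
  | 0 => φ
  | n+1 => push (C.D n) (C.N n) (C.dir n) (C.prof n) (C.itp φ n)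

def Cas.R {d : ℕ} (C : Cas d) (n : ℕ) : ℝ := 2 * C.D n * C.N n

def Cas.ce {d : ℕ} (C : Cas d) (n : ℕ) : ℝ :=
  if n < d then 1 else if n = d then 2 + C.N 0 * C.D 0 else 6 / C.R (n - 1)

structure Cas.Ok {d : ℕ} (C : Cas d) (M B : ℕ) : Prop where
  d2 : 2 ≤ d
  M0 : 0 < M
  B0 : 0 < B
  D0 : ∀ n, 0 < C.D n
  N0 : ∀ n, 0 < C.N n
  R3 : ∀ n, 3 ≤ C.R n
  ne : ∀ n, C.dir n ≠ C.prof n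
  dp : ∀ n, C.dir (n+1) = C.prof n
  dirE : ∀ n (h : n < d), C.dir n = ⟨n, h⟩
  DE : ∀ n < d, C.D n =1 / M
  NE : ∀ n < d, C.N n = B
  pd1 : (C.prof d : ℕ) =1
  pdl : (C.prof (d - 1) : ℕ) =0
  pp : ∀ n, d ≤ n → C.prof (n+1) = C.dir n
  inc : ∀ n, (∏ l ∈ Finset.Ico d n, 3 / C.R l) / (2 * B * C.D n)+3 * C.ce n / C.R n ≤
    (1/2) ^ (n+1) / (480 * d^2 * M)

namespace Cas
variable {C : Cas d} {M B : ℕ}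

lemma itp_cp (h : C.Ok M B) {φ : Vd d → ℝ} (hφ : CP φ) (n : ℕ) : CP (C.itp φ n) ∧ nm (C.itp φ n) = nm φ := by
  induction n with
  | zero => exact ⟨hφ, rfl⟩
  | succ n ih =>
    have := push_cp (D := C.D n) (N := C.N n) (h.ne n) ih.1
    exact ⟨this.1, this.2.trans ih.2⟩

lemma itp_ip (h : C.Ok M B) {φ ψ : Vd d → ℝ} (hφ : CP φ) (hψ : CP ψ) (n : ℕ) :
    ip (C.itp φ n) (C.itp ψ n) = ip φ ψ := by
  induction n with
  | zero => rfl
  | succ n ih =>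
    rw [← ih]
    exact push_ip _ _ (h.ne n) (itp_cp h hφ n).1 (itp_cp h hψ n).1

lemma itp_inv (h : C.Ok M B) (n : ℕ) : ∀ {φ : Vd d → ℝ}, CP φ → ∀ {K : ℝ}, 0 ≤ K → Lip K φ →
    ∃ φ0, CP φ0 ∧ (∃ K0, 0 ≤ K0 ∧ Lip K0 φ0) ∧ C.itp φ0 n = φ := by
  induction n with
  | zero => exact fun hφ K hK hl => ⟨_, hφ, ⟨K, hK, hl⟩, rfl⟩
  | succ n ih =>
    intro φ hφ K hK hl
    have h1 := push_cp (D := -C.D n) (N := C.N n) (h.ne n) hφ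
    obtain ⟨φ0, a, b, c⟩ := ih h1.1 pz (push_lip_ex (-C.D n) (C.N n) (C.dir n) (C.prof n) hK hl)
    refine ⟨φ0, a, b, ?_⟩
    rw [itp, c, push_inv _ _ (h.ne n)]

lemma itp_lip (h : C.Ok M B) {φ : Vd d → ℝ} {K : ℝ} (hK : 0 ≤ K) (hl : Lip K φ) (n : ℕ) :
    Lip (K * ∏ l ∈ Finset.range n, (1 + C.R l)) (C.itp φ n) := by
  induction n with
  | zero => rw [Finset.prod_range_zero, mul_one]; exact hl
  | succ n ih =>
    rw [Finset.prod_range_succ, ← mul_assoc]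
    refine shear_lip (h.D0 n).le (mul_nonneg hK (Finset.prod_nonneg fun l _ => ?_)) ih
    linarith [h.R3 l]

lemma prof_lt (h : C.Ok M B) {n : ℕ} (hn : n+1 < d) : (C.prof n : ℕ) = n+1 := by
  rw [← h.dp, h.dirE _ hn]

lemma itp_cl (h : C.Ok M B) {φ : Vd d → ℝ} (hφ : CP φ) {Γ : ℝ} {l : Fin d} (hc : CL l Γ φ) (n : ℕ) (hn : n < d)
    (hl : (l:ℕ) =0 ∨ n < l) : CL l Γ (C.itp φ n) := by
  induction n with
  | zero => exact hc
  | succ n ih =>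
    refine push_cl (h.ne n) (itp_cp h hφ n).1 (fun e => ?_) (ih (by omega) (by omega))
    have := prof_lt h hn
    rw [← e] at this
    omega

lemma itp_cl1 (h : C.Ok M B) {φ : Vd d → ℝ} (hφ : ContDiff ℝ 1 φ) (hp : SpacePeriodic φ) {Γ : ℝ}
    (hΓ : ∀ l, nm (pd φ l) ≤ Γ) (n : ℕ) (hn : n < d) {l : Fin d} (hl : (l:ℕ) =1) :
    CL l ((1+4 * (1 / M) * B) * Γ) (C.itp φ (n+1)) := by
  have hc : CP φ := ⟨hφ.continuous, hp⟩
  induction n with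
  | zero =>
    have e1 : l = C.prof 0 := by
      ext; rw [hl, prof_lt h (by have := h.d2; omega)]
    rw [e1, ← h.DE 0 hn, ← h.NE 0 hn]
    exact push_cl_self (h.D0 0).le (h.ne 0) hφ hp hΓ
  | succ n ih =>
    refine push_cl (h.ne _) (itp_cp h hc _).1 (fun e => ?_) (ih (by omega))
    rcases Nat.lt_or_ge (n+2) d with h2 | h2
    · have := prof_lt h h2
      rw [← e] at this
      omega
    · have : n+1 = d - 1 := by omega
      rw [this] at e
      have := h.pdl
      rw [← e] at this
      omega

lemma ce_nonneg (h : C.Ok M B) (n : ℕ) : 0 ≤ C.ce n := by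
  unfold ce
  have := h.R3 (n - 1)
  have := h.D0 0
  split_ifs <;> positivity

structure St (C : Cas d) (M B : ℕ) (φ0 : Vd d → ℝ) (e Q : ℝ) (n : ℕ) (G : Vd d → ℝ) : Prop where
  cp : CP G
  lip : ∃ K, 0 ≤ K ∧ Lip K G
  sw : SW (C.itp φ0 n) G (C.dir n) (e / (480 * d^2 * M) * (1 - (1/2) ^ n))
  g1 : nm G ≤ e / (4 * B) * ∏ l ∈ Finset.Ico d n, 3 / C.R l
  g2 : nm G ≤ Q * ∏ l ∈ Finset.range n, 3 / C.R l
  cl : CL (C.prof n) (C.ce n * e) G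
  fam : n < d → ∀ l : Fin d, ((l:ℕ) =0 ∨ n < l) → CL l e G
  one : n ≤ d → ∀ l : Fin d, (l:ℕ) =1 → CL l ((2 + B * (1 / M)) * e) G

lemma St.step (h : C.Ok M B) {φ0 : Vd d → ℝ} (hφ : CP φ0) {K0 : ℝ} (hK0 : 0 ≤ K0) (hl0 : Lip K0 φ0)
    {e Q : ℝ} (he : 0 < e) (hQ : 0 ≤ Q) (hφe : nm φ0 ≤ e) {n : ℕ} (hn : 0 < n) {G : Vd d → ℝ} (S : St C M B φ0 e Q n G) :
    St C M B φ0 e Q (n+1) (Gn (C.D n) (C.N n) (C.dir n) (C.prof n) G) := by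
  obtain ⟨K, hK, hl⟩ := S.lip
  have hD := h.D0 n
  have hN := h.N0 n
  have hN' : (0:ℝ) < C.N n := by exact_mod_cast hN
  have hR := h.R3 n
  have hRp : 0 < C.R n := by linarith
  have hd : (0:ℝ) < d := by have := h.d2; exact_mod_cast (by omega : 0 < d)
  have hd1 : (1:ℝ) ≤ d := by have := h.d2; exact_mod_cast (by omega : 1 ≤ d)
  have hM : (0:ℝ) < M := by exact_mod_cast h.M0
  have hM1 : (1:ℝ) ≤ M := by exact_mod_cast h.M0
  have hB : (0:ℝ) < B := by exact_mod_cast h.B0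
  obtain ⟨c1, c2⟩ := itp_cp h hφ n
  have hgn := nm_Gn (p := C.prof n) hD hN (h.ne n) hK hl S.cp
  have hgn' : nm (Gn (C.D n) (C.N n) (C.dir n) (C.prof n) G) ≤ nm G * (3 / C.R n) := by
    refine hgn.trans (le_of_eq ?_)
    rw [Cas.R]; ring
  have hb1 : (1/2 : ℝ) ^ n ≤1 := pow_le_one₀ (by norm_num) (by norm_num)
  have hb0 : 0 ≤ e / (480 * d^2 * M) * (1 - (1/2) ^ n) := by
    have : 0 ≤1 - (1/2 : ℝ) ^ n := by linarith
    positivity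
  have hcl : ∀ l c, l ≠ C.prof n → 0 ≤ c → CL l c G → CL l c (Gn (C.D n) (C.N n) (C.dir n) (C.prof n) G) :=
    fun l c h1 h2 h3 => by
      refine (Gn_cl hD hN (h.ne n) hK hl S.cp h1 h3).mono ?_
      rw [div_le_iff₀ pz]
      change 3 * c ≤ c * C.R n
      nlinarith
  have hfam : n+1 < d → ∀ l : Fin d, ((l:ℕ) =0 ∨ n+1 < l) →
      CL l e (Gn (C.D n) (C.N n) (C.dir n) (C.prof n) G) := fun h1 l h2 => by
    refine hcl l e (fun q => ?_) he.le (S.fam (by omega) l (by omega))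
    have := prof_lt h h1
    rw [← q] at this
    omega
  have hone : n+1 ≤ d → ∀ l : Fin d, (l:ℕ) =1 →
      CL l ((2 + B * (1 / M)) * e) (Gn (C.D n) (C.N n) (C.dir n) (C.prof n) G) := fun h1 l h2 => by
    refine hcl l _ (fun q => ?_) pz (S.one (by omega) l h2)
    rcases Nat.lt_or_ge (n+1) d with h3 | h3
    · have := prof_lt h h3
      rw [← q] at this
      omega
    · have h4 : n = d - 1 := by omega
      rw [h4] at q
      have := h.pdl
      rw [← q] at this
      omega
  refine ⟨Gn_cp hD hN hK hl S.cp, ⟨_, ?_, Gn_lip hD hN hK hl⟩, ?_, ?_, ?_, ?_, hfam, hone⟩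
  · positivity
  · have hce : 0 ≤ C.ce n * e := mul_nonneg (ce_nonneg h n) he.le
    have h1 := transfer hD hN (h.ne n) c1 S.cp hK hl
      (mul_nonneg hK0 (Finset.prod_nonneg fun l _ => by linarith [h.R3 l])) (itp_lip h hK0 hl0 n) hb0 hce S.sw S.cl
    rw [h.dp]
    refine SW.mono h1 ?_
    have h2 := mll (h.inc n) he.le
    have h3 : 2 * nm G / C.D n ≤ e * ((∏ l ∈ Finset.Ico d n, 3 / C.R l) / (2 * B * C.D n)) := by
      rw [div_le_iff₀ hD]
      refine (mll S.g1 (by norm_num : (0:ℝ) ≤2)).trans (le_of_eq ?_)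
      field_simp
      norm_num
    have h4 : 3 * (C.ce n * e) / (2 * C.D n * C.N n) = e * (3 * C.ce n / C.R n) := by
      rw [Cas.R]; ring
    rw [h4, pow_succ (1/2 : ℝ) n]
    rw [mul_add] at h2
    have h5 : e * ((1/2) ^ (n+1) / (480 * d^2 * M)) = e / (480 * d^2 * M) * ((1/2) ^ n * (1/2)) := by
      rw [pow_succ (1/2 : ℝ) n]; ring
    rw [h5] at h2
    have h6 : e / (480 * d^2 * M) * (1 - (1/2 : ℝ) ^ n * (1/2)) = e / (480 * d^2 * M) * (1 - (1/2 : ℝ) ^ n) +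
      e / (480 * d^2 * M) * ((1/2 : ℝ) ^ n * (1/2)) := by ring
    rw [h6]
    linarith
  · rcases Nat.lt_or_ge n d with h1 | h1
    · rw [Finset.Ico_eq_empty (by omega)]
      have h2 := S.g1
      rw [Finset.Ico_eq_empty (by omega)] at h2
      refine hgn'.trans (le_trans ?_ h2)
      have : 3 / C.R n ≤1 := by rw [div_le_one hRp]; exact hR
      exact mul_le_of_le_one_right (nm_nonneg _) this
    · rw [Finset.prod_Ico_succ_top h1, ← mul_assoc]
      exact hgn'.trans (mlr S.g1 pz)
  · rw [Finset.prod_range_succ, ← mul_assoc]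
    exact hgn'.trans (mlr S.g2 pz)
  · rcases lt_trichotomy (n+1) d with h1 | h1 | h1
    · rw [Cas.ce, if_pos h1, one_mul]
      refine hfam h1 _ ?_
      rcases Nat.lt_or_ge (n+2) d with h3 | h3
      · right; rw [prof_lt h h3]; omega
      · left; rw [show n+1 = d - 1 by omega]; exact h.pdl
    · rw [Cas.ce, if_neg (by omega), if_pos h1]
      have := hone h1.le (C.prof (n+1)) (by rw [h1]; exact h.pd1)
      rwa [h.NE 0 (by have := h.d2; omega), h.DE 0 (by have := h.d2; omega)]
    · rw [Cas.ce, if_neg (by omega), if_neg (by omega), Nat.add_sub_cancel, h.pp n (by omega)]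
      have h2 := SW.cl c1 S.cp S.sw
      have h3 : nm (C.itp φ0 n) + e / (480 * d^2 * M) * (1 - (1/2) ^ n) ≤2 * e := by
        rw [c2]
        have h4 : e / (480 * d^2 * M) ≤ e := by
          apply div_le_self he.le
          have : (1:ℝ) ≤ d^2 := one_le_pow₀ hd1
          nlinarith
        have h5 : e / (480 * d^2 * M) * (1 - (1/2) ^ n) ≤ e / (480 * d^2 * M)*1 := by
          refine mll ?_ pz
          have : (0:ℝ) ≤ (1/2) ^ n := by positivity
          linarith
        linarith
      have h4 := Gn_cl hD hN (h.ne n) hK hl S.cp (h.ne n) (h2.mono h3)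
      refine h4.mono (le_of_eq ?_)
      rw [Cas.R]; ring

lemma main_test (h : C.Ok M B) {f0 : Vd d → ℝ} (hf : ContDiff ℝ 2 f0) (hp : SpacePeriodic f0)
    (h0 : ∫ x in box d, f0 x =0) {Γ : ℝ} (hΓ : ∀ l, nm (pd f0 l) ≤ Γ) (hΓ0 : 0 ≤ Γ) (hpos : 0 < nm f0)
    (hbig : 72 * d^2 * Γ ≤1 / M * B * nm f0) :
    ∃ (e : ℝ) (φ0 : Vd d → ℝ) (Q K0 : ℝ), nm f0 / (24 * d^2 * M) ≤ e ∧ 0 < e ∧ CP φ0 ∧ 0 ≤ K0 ∧ Lip K0 φ0 ∧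
      ip f0 φ0 = e^2/2 ∧ nm φ0 ≤ e ∧ 0 ≤ Q ∧
      ∀ n, d ≤ n → ∃ G, CP G ∧ SW (C.itp φ0 n) G (C.dir n) (e / (480 * d^2 * M)) ∧
        nm G ≤ Q * ∏ l ∈ Finset.range n, 3 / C.R l := by
  have hd : (0:ℝ) < d := by have := h.d2; exact_mod_cast (by omega : 0 < d)
  have hM : (0:ℝ) < M := by exact_mod_cast h.M0
  have hB : (0:ℝ) < B := by exact_mod_cast h.B0
  have hf1 : ContDiff ℝ 1 f0 := hf.of_le (by norm_num)
  have hcp : CP f0 := ⟨hf.continuous, hp⟩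
  have hCL : ∀ l, CL l Γ f0 := fun l r hr => by
    rw [mul_comm]
    exact (nm_line_diff hf1 hp l hr.le).trans (mll (hΓ l) hr.le)
  obtain ⟨Kf, hKf0, hKf⟩ : ∃ K, 0 ≤ K ∧ Lip K f0 := by
    have hfd : Continuous (fun x => ‖fderiv ℝ f0 x‖) := (hf1.continuous_fderiv (by norm_num)).norm
    obtain ⟨K, hK, hb⟩ := CP.bdd (f := fun x => ‖fderiv ℝ f0 x‖) ⟨hfd, fun x k => by
      rw [per_fderiv hp x k]⟩
    refine ⟨K, hK, fun x y => ?_⟩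
    have := Convex.norm_image_sub_le_of_norm_fderiv_le (𝕜 := ℝ) (f := f0) (C := K) (s := Set.univ) (x := y) (y := x)
      (fun x _ => hf1.differentiable (by norm_num) x) (fun x _ => by have := hb x; rwa [abs_norm] at this) convex_univ
      (Set.mem_univ _) (Set.mem_univ _)
    exact this
  obtain ⟨j, hj, hja⟩ := exists_dir (F := C.itp f0) hcp (fun n => rfl) h.ne h.dirE h0 hpos
  change nm f0 ≤ _ at hja
  obtain ⟨cj, -⟩ := itp_cp h hcp j
  obtain ⟨cj1, cj2⟩ := itp_cp h hcp (j+1)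
  have hclj : CL (C.prof j) Γ (C.itp f0 j) := by
    refine itp_cl h hcp (hCL _) j hj ?_
    rcases Nat.lt_or_ge (j+1) d with h3 | h3
    · right; rw [prof_lt h h3]; omega
    · left; rw [show j = d - 1 by omega]; exact h.pdl
  have hlow := catch_low h.M0 h.B0 (h.ne j) cj hΓ0 hclj
  have hit : push (1 / (M:ℝ)) B (C.dir j) (C.prof j) (C.itp f0 j) = C.itp f0 (j+1) := by
    rw [itp, h.DE j hj, h.NE j hj]
  rw [hit] at hlow
  obtain ⟨φ, G, t1, t2, ⟨K1, t3, t4⟩, ⟨K2, t5, t6⟩, t7, t8, t9, t10, t11⟩ := test_fn cj1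
    (mul_nonneg hKf0 (Finset.prod_nonneg fun l _ => by linarith [h.R3 l])) (itp_lip h hKf0 hKf (j+1))
    (C.prof j) (h := 1 / (2 * B)) pz
  set e := nm (fun x => C.itp f0 (j+1) x - C.itp f0 (j+1) (x + (1 / (2 * B) : ℝ) • ev (C.prof j))) with he
  have heL : nm f0 / (24 * d^2 * M) ≤ e := by
    refine le_trans ?_ hlow
    have h1 : 3 * Γ / B ≤ nm f0 / (24 * d^2 * M) := by
      rw [div_le_div_iff₀ pz pz]
      have : 1 / (M:ℝ) * B * nm f0 * M = B * nm f0 := by field_simp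
      have h2 := mlr hbig hM.le
      rw [this] at h2
      linarith
    have h2 : nm f0 / (12 * d^2 * M) ≤1/2 * (1 / M) * osc (C.dir j) (C.itp f0 j) := by
      rw [div_le_iff₀ pz]
      refine hja.trans (le_of_eq ?_)
      field_simp; ring
    have h3 : nm f0 / (12 * d^2 * M) = nm f0 / (24 * d^2 * M) + nm f0 / (24 * d^2 * M) := by
      field_simp; ring
    linarith
  have he0 : 0 < e := lt_of_lt_of_le pz heL
  have hΓe : Γ ≤ B * e/3 := by
    rw [div_le_iff₀ pz] at heL
    have h2 := mlr hbig hM.le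
    have : 1 / (M:ℝ) * B * nm f0 * M = B * nm f0 := by field_simp
    rw [this] at h2
    have h3 := mll heL hB.le
    have h4 : (72 * d^2 * M) * Γ ≤ (72 * d^2 * M) * (B * e/3) := by linarith
    exact le_of_mul_le_mul_left h4 pz
  obtain ⟨φ0, p1, ⟨K0, p2, p3⟩, p4⟩ := itp_inv h (j+1) t1 t3 t4
  have hnm : nm φ0 = nm φ := by rw [← p4, (itp_cp h p1 (j+1)).2]
  have hR0 : ∀ l, 0 <3 / C.R l := fun l => by have := h.R3 l; positivity
  have hP : 0 < ∏ l ∈ Finset.range (j+1), 3 / C.R l := Finset.prod_pos fun l _ => hR0 l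
  set Q := nm G / ∏ l ∈ Finset.range (j+1), 3 / C.R l with hQ
  have hQ0 : 0 ≤ Q := div_nonneg (nm_nonneg _) hP.le
  have hbase : St C M B φ0 e Q (j+1) G := by
    have hfam : j+1 < d → ∀ l : Fin d, ((l:ℕ) =0 ∨ j+1 < l) → CL l e G := fun h1 l h2 => by
      refine (t11 l Γ (itp_cl h hcp (hCL l) _ h1 h2)).mono ?_
      rw [div_mul_eq_mul_div, one_mul, div_le_iff₀ pz]
      nlinarith
    have hone : ∀ l : Fin d, (l:ℕ) =1 → CL l ((2 + B * (1 / M)) * e) G := fun l h2 => by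
      refine (t11 l _ (itp_cl1 h hf1 hp hΓ j hj h2)).mono ?_
      have h3 : 1 / (2 * (B:ℝ)) * ((1+4 * (1 / M) * B) * Γ) ≤1 / (2 * (B:ℝ)) * ((1+4 * (1 / M) * B) * (B * e/3)) := by
        gcongr
      refine h3.trans ?_
      have h4 : 1 / (2 * (B:ℝ)) * ((1+4 * (1 / M) * B) * (B * e/3)) = (1/6+2/3 * (B * (1 / M))) * e := by
        field_simp; ring
      rw [h4]
      have : 0 ≤ (B:ℝ) * (1 / M) := by positivity
      refine mlr ?_ he0.le
      linarith
    refine ⟨t2, ⟨K2, t5, t6⟩, ?_, ?_, ?_, ?_, hfam, fun _ => hone⟩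
    · rw [p4, h.dp]
      refine t10.mono ?_
      have : (1/2 : ℝ) ^ (j+1) ≤1 := pow_le_one₀ (by norm_num) (by norm_num)
      have : 0 ≤1 - (1/2 : ℝ) ^ (j+1) := by linarith
      positivity
    · rw [Finset.Ico_eq_empty (by omega), Finset.prod_empty, mul_one]
      refine t9.trans (le_of_eq ?_)
      field_simp; norm_num
    · rw [hQ, div_mul_cancel₀ _ hP.ne']
    · rcases Nat.lt_or_ge (j+1) d with h1 | h1
      · rw [Cas.ce, if_pos h1, one_mul]
        refine hfam h1 _ ?_
        rcases Nat.lt_or_ge (j+2) d with h3 | h3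
        · right; rw [prof_lt h h3]; omega
        · left; rw [show j+1 = d - 1 by omega]; exact h.pdl
      · have h1 : j+1 = d := by omega
        rw [Cas.ce, if_neg (by omega), if_pos h1]
        have := hone (C.prof (j+1)) (by rw [h1]; exact h.pd1)
        rwa [h.NE 0 (by have := h.d2; omega), h.DE 0 (by have := h.d2; omega)]
  have hall : ∀ n, ∃ G, St C M B φ0 e Q (j+1 + n) G := fun n => by
    induction n with
    | zero => exact ⟨G, hbase⟩
    | succ n ih =>
      obtain ⟨G', hG'⟩ := ih
      exact ⟨_, St.step h p1 p2 p3 he0 hQ0 (by rw [hnm]; exact t8) (Nat.lt_of_lt_of_le (Nat.succ_pos j) (Nat.le_add_right _ _)) hG'⟩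
  refine ⟨e, φ0, Q, K0, heL, he0, p1, p2, p3, ?_, by rw [hnm]; exact t8, hQ0, fun n hn => ?_⟩
  · rw [← t7, ← p4, itp_ip h hcp p1]
  · obtain ⟨G', hG'⟩ := hall (n - (j+1))
    rw [show j+1 + (n - (j+1)) = n by omega] at hG'
    refine ⟨G', hG'.cp, hG'.sw.mono ?_, hG'.g2⟩
    have : (0:ℝ) ≤ (1/2) ^ n := by positivity
    refine mul_le_of_le_one_right pz (by linarith)
end Cas

end

section
variable {d : ℕ}

def bt (i n : ℕ) : ℝ := (1/2) ^ i - (1/2) ^ (i+1 + n)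
def tau (i n : ℕ) : ℝ := (1/2) ^ (i+11 * n+3)
def qf (z : ℝ) : ℝ := max 0 (6 * z * (1 - z))
def act (t : ℝ) (s : ℕ × ℕ) : Prop := bt s.1 s.2 < t ∧ t < bt s.1 s.2 + tau s.1 s.2

lemma tau_pos (i n : ℕ) : 0 < tau i n := by unfold tau; positivity

lemma half_anti {a b : ℕ} (h : a ≤ b) : (1/2 : ℝ) ^ b ≤ (1/2) ^ a :=
  pow_le_pow_of_le_one (by norm_num) (by norm_num) h

lemma bt_zero (i : ℕ) : bt i 0 = (1/2) ^ (i+1) := by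
  unfold bt; rw [add_zero, pow_succ]; ring

lemma bt_succ (i n : ℕ) : bt i (n+1) = bt i n + (1/2) ^ (i + n+2) := by
  unfold bt
  rw [show i+1 + (n+1) = (i + n+1)+1 by ring, show i+1 + n = i + n+1 by ring,
    show i + n+2 = (i + n+1)+1 by ring, pow_succ _ (i + n+1)]
  ring

lemma tau_half (i n : ℕ) : tau i n ≤ (1/2) ^ (i + n+3) := half_anti (by omega)

lemma bt_tau (i n : ℕ) : bt i n + tau i n + (1/2) ^ (i + n+3) ≤ bt i (n+1) := by
  rw [bt_succ]
  have := tau_half i n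
  have h : (1/2 : ℝ) ^ (i + n+3) = (1/2) ^ (i + n+2) * (1/2) := pow_succ _ _
  linarith

lemma bt_mono (i : ℕ) : Monotone (bt i) := monotone_nat_of_le_succ fun n => by
  rw [bt_succ]; have : (0:ℝ) < (1/2) ^ (i + n+2) := by positivity
  linarith

lemma bt_lt (i n : ℕ) : bt i n < (1/2) ^ i := by
  unfold bt; have : (0:ℝ) < (1/2) ^ (i+1 + n) := by positivity
  linarith

lemma bt_le_one (i n : ℕ) : bt i n ≤1 := (bt_lt i n).le.trans (pow_le_one₀ (by norm_num) (by norm_num))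

lemma bt_pos (i n : ℕ) : 0 < bt i n :=
  lt_of_lt_of_le (by rw [bt_zero]; positivity) (bt_mono i (Nat.zero_le n))

lemma act_lt {t : ℝ} {s : ℕ × ℕ} (h : act t s) : t < bt s.1 (s.2+1) := by
  have := bt_tau s.1 s.2
  have h2 : (0:ℝ) < (1/2) ^ (s.1 + s.2+3) := by positivity
  linarith [h.2]

lemma act_i {t : ℝ} {s : ℕ × ℕ} (h : act t s) : (1/2) ^ (s.1+1) < t ∧ t < (1/2) ^ s.1 :=
  ⟨by rw [← bt_zero]; exact (bt_mono _ (Nat.zero_le _)).trans_lt h.1, (act_lt h).trans (bt_lt _ _)⟩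

lemma i_uniq {t : ℝ} {i j : ℕ} (h : (1/2) ^ (i+1) < t) (h' : t < (1/2) ^ j) : j ≤ i := by
  by_contra hc
  have := half_anti (show i+1 ≤ j by omega)
  linarith

lemma n_uniq {t : ℝ} {i n m : ℕ} (h : bt i n < t) (h' : t < bt i (m+1)) : n ≤ m := by
  by_contra hc
  have := bt_mono i (show m+1 ≤ n by omega)
  linarith

lemma act_uniq {t : ℝ} {s s' : ℕ × ℕ} (h : act t s) (h' : act t s') : s = s' := by
  have h1 : s.1 = s'.1 := le_antisymm (i_uniq (act_i h').1 (act_i h).2) (i_uniq (act_i h).1 (act_i h').2)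
  refine Prod.ext h1 ?_
  have a := act_lt h
  have b := act_lt h'
  have e := h.1
  have f := h'.1
  rw [h1] at a e
  exact le_antisymm (n_uniq e b) (n_uniq f a)

lemma qf_le (z : ℝ) : qf z ≤3/2 := max_le (by norm_num) (by nlinarith [sq_nonneg (z - 1/2)])
lemma qf_nonneg (z : ℝ) : 0 ≤ qf z := le_max_left _ _
lemma qf_zero {z : ℝ} (h : z ≤0 ∨ 1 ≤ z) : qf z =0 := by
  apply max_eq_left
  rcases h with h | h <;> nlinarith

lemma qf_lip' {x y : ℝ} (h : qf y ≤ qf x) : qf x - qf y ≤6 * |x - y| := by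
  rcases le_or_gt x 0 with hx | hx
  · rw [qf_zero (Or.inl hx)]; nlinarith [qf_nonneg y, abs_nonneg (x - y)]
  rcases le_or_gt 1 x with hx1 | hx1
  · rw [qf_zero (Or.inr hx1)]; nlinarith [qf_nonneg y, abs_nonneg (x - y)]
  have e : qf x =6 * x * (1 - x) := max_eq_right (by nlinarith)
  rw [e]
  rcases le_or_gt y 0 with hy | hy
  · rw [qf_zero (Or.inl hy)]; nlinarith [le_abs_self (x - y)]
  rcases le_or_gt 1 y with hy1 | hy1
  · rw [qf_zero (Or.inr hy1)]; nlinarith [neg_abs_le (x - y)]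
  have e : qf y =6 * y * (1 - y) := max_eq_right (by nlinarith)
  rw [e]
  have : 6 * x * (1 - x) - 6 * y * (1 - y) =6 * ((x - y) * (1 - x - y)) := by ring
  rw [this]
  have h2 : (x - y) * (1 - x - y) ≤ |x - y| * 1 := by
    refine (le_abs_self _).trans ?_
    rw [abs_mul]
    exact mll (abs_le.2 ⟨by linarith, by linarith⟩) (abs_nonneg _)
  linarith

lemma qf_lip (x y : ℝ) : |qf x - qf y| ≤6 * |x - y| := by
  rcases le_total (qf y) (qf x) with h | h
  · rw [abs_of_nonneg (by linarith)]; exact qf_lip' h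
  · rw [abs_sub_comm, abs_of_nonneg (by linarith), abs_sub_comm x y]; exact qf_lip' h

lemma min_rpow {α z : ℝ} (h0 : 0 < α) (h1 : α <1) (hz : 0 ≤ z) : min 1 z ≤ z ^ α := by
  rcases le_or_gt 1 z with h | h
  · rw [min_eq_left h]; exact one_le_rpow h h0.le
  · rw [min_eq_right h.le]
    rcases hz.eq_or_lt with hz | hz
    · rw [← hz, zero_rpow h0.ne']
    · simpa using rpow_le_rpow_of_exponent_ge hz h.le h1.le

def amp {d : ℕ} (C : ℕ → Cas d) (s : ℕ × ℕ) (t : ℝ) : ℝ :=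
  (C s.1).D s.2 / tau s.1 s.2 * qf ((t - bt s.1 s.2) / tau s.1 s.2)

def Us {d : ℕ} (C : ℕ → Cas d) (s : ℕ × ℕ) (t : ℝ) (x : Vd d) : Fin d → ℝ :=
  Pi.single ((C s.1).dir s.2) (amp C s t * gam ((C s.1).N s.2) ((C s.1).prof s.2) x)

open Classical in
def vf {d : ℕ} (C : ℕ → Cas d) (t : ℝ) (x : Vd d) : Fin d → ℝ :=
  if h : ∃ s, act t s then Us C h.choose t x else 0

structure Fam {d : ℕ} (C : ℕ → Cas d) (M B : ℕ → ℕ) (α K0 : ℝ) : Prop where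
  ok : ∀ i, (C i).Ok (M i) (B i)
  a0 : 0 < α
  a1 : α <1
  kp : 0 < K0
  H : ∀ i n, (C i).D n * ((C i).N n : ℝ) ^ α ≤ K0 * tau i n^2
  D1 : ∀ i n, (C i).D n*2 ^ (11 * n) ≤2 ^ (11 * d) / M i
  M2 : ∀ i, 2 * M i ≤ M (i+1)
  MB : ∀ i, 2 ^ (11 * d+8) * B i ≤ M (i+1)
  R8 : ∀ i n, (8:ℝ) ^ n ≤ (C i).R n

variable {C : ℕ → Cas d} {M B : ℕ → ℕ} {α K0 : ℝ}

lemma amp_zero {s : ℕ × ℕ} {t : ℝ} (h : ¬ act t s) : amp C s t =0 := by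
  have ht := tau_pos s.1 s.2
  rw [amp, qf_zero, mul_zero]
  by_contra hc
  push Not at hc
  refine h ⟨?_, ?_⟩
  · have := hc.1; rw [div_pos_iff_of_pos_right ht] at this; linarith
  · have := hc.2; rw [div_lt_one ht] at this; linarith

lemma Us_zero {s : ℕ × ℕ} {t : ℝ} (h : ¬ act t s) : Us C s t =0 := by
  ext x i; simp [Us, amp_zero h]

lemma vf_act {s : ℕ × ℕ} {t : ℝ} (h : act t s) : vf C t = Us C s t := by
  have hex : ∃ s, act t s := ⟨s, h⟩
  ext x i
  rw [vf, dif_pos hex, act_uniq hex.choose_spec h]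

lemma vf_none {t : ℝ} (h : ∀ s, ¬ act t s) : vf C t =0 := by
  ext x i
  rw [vf, dif_neg (by push Not; exact h)]; rfl

namespace Fam

lemma shear (F : Fam C M B α K0) (t : ℝ) : Shear (vf C t) := by
  by_cases h : ∃ s, act t s
  · obtain ⟨s, h⟩ := h
    rw [vf_act h]
    exact ⟨(C s.1).dir s.2, fun x => amp C s t * gam ((C s.1).N s.2) ((C s.1).prof s.2) x,
      (gam_cp _ _).smul _, fun x r => by simp only [gam_inv _ ((F.ok s.1).ne s.2)], rfl⟩
  · push Not at h
    rw [vf_none h]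
    have hd := (F.ok 0).d2
    refine ⟨⟨0, by omega⟩, fun _ => 0, ⟨continuous_const, fun _ _ => rfl⟩, fun _ _ => rfl, ?_⟩
    ext x i; simp

lemma divfree (F : Fam C M B α K0) : WeakDivFree (vf C) := by
  intro t _ φ hφ hp
  obtain ⟨j, w, hw, hwj, e⟩ := F.shear t
  simp only [e, sum_single]
  exact int_w_pd hw (hφ.of_le (by exact_mod_cast le_top)) hp j hwj

lemma D_le (F : Fam C M B α K0) (i n : ℕ) : (C i).D n ≤ K0 * tau i n^2 := by
  refine le_trans ?_ (F.H i n)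
  have h1 : (1:ℝ) ≤ ((C i).N n : ℝ) := by exact_mod_cast (F.ok i).N0 n
  exact le_mul_of_one_le_right ((F.ok i).D0 n).le (one_le_rpow h1 F.a0.le)

lemma amp_nonneg (F : Fam C M B α K0) (s : ℕ × ℕ) (t : ℝ) : 0 ≤ amp C s t :=
  mul_nonneg (div_nonneg ((F.ok _).D0 _).le (tau_pos _ _).le) (qf_nonneg _)

lemma amp_le (F : Fam C M B α K0) (s : ℕ × ℕ) (t : ℝ) : amp C s t ≤ (C s.1).D s.2 / tau s.1 s.2 * (3/2) :=
  mll (qf_le _) (div_nonneg ((F.ok _).D0 _).le (tau_pos _ _).le)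

lemma tau_one (i n : ℕ) : tau i n ≤1 := pow_le_one₀ (by norm_num) (by norm_num)

lemma Us_x (F : Fam C M B α K0) (s : ℕ × ℕ) (t : ℝ) (x y : Vd d) :
    ‖Us C s t x - Us C s t y‖ ≤6 * K0 * ‖x - y‖ ^ α := by
  have ht := tau_pos s.1 s.2
  have ht1 := tau_one s.1 s.2
  have hD := (F.ok s.1).D0 s.2
  set N := (C s.1).N s.2 with hN
  rw [Us, Us, ← Pi.single_sub, Pi.norm_single, ← mul_sub, norm_mul, norm_eq_abs, norm_eq_abs,
    abs_of_nonneg (F.amp_nonneg s t)]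
  have h1 : |gam N ((C s.1).prof s.2) x - gam N ((C s.1).prof s.2) y| ≤2 * (N * ‖x - y‖) ^ α := by
    have h2 := gam_lip N ((C s.1).prof s.2) x y
    have h3 : |gam N ((C s.1).prof s.2) x - gam N ((C s.1).prof s.2) y| ≤1 :=
      abs_le.2 ⟨by linarith [gam_nonneg N ((C s.1).prof s.2) x, gam_le N ((C s.1).prof s.2) y],
        by linarith [gam_nonneg N ((C s.1).prof s.2) y, gam_le N ((C s.1).prof s.2) x]⟩
    have h4 := min_rpow F.a0 F.a1 (z := N * ‖x - y‖) pz
    rcases le_total 1 ((N:ℝ) * ‖x - y‖) with h5 | h5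
    · rw [min_eq_left h5] at h4; linarith
    · rw [min_eq_right h5] at h4; linarith
  rw [mul_rpow pz (norm_nonneg _)] at h1
  have h2 := mul_le_mul (F.amp_le s t) h1 (abs_nonneg _) pz
  refine h2.trans ?_
  have h3 : (C s.1).D s.2 / tau s.1 s.2 * (3/2) * (2 * ((N:ℝ) ^ α * ‖x - y‖ ^ α)) =
      3 * ((C s.1).D s.2 * (N:ℝ) ^ α / tau s.1 s.2) * ‖x - y‖ ^ α := by ring
  rw [h3]
  refine mlr ?_ pz
  have h4 : (C s.1).D s.2 * (N:ℝ) ^ α / tau s.1 s.2 ≤ K0 := by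
    rw [div_le_iff₀ ht]
    refine (F.H s.1 s.2).trans ?_
    have := F.kp
    rw [pow_two]
    nlinarith [mul_pos this ht]
  linarith [F.kp]

lemma Us_t (F : Fam C M B α K0) (s : ℕ × ℕ) (t r : ℝ) (x : Vd d) :
    ‖Us C s t x - Us C s r x‖ ≤6 * K0 * |t - r| ^ α := by
  have ht := tau_pos s.1 s.2
  have ht1 := tau_one s.1 s.2
  have hD := (F.ok s.1).D0 s.2
  set g := gam ((C s.1).N s.2) ((C s.1).prof s.2) x
  rw [Us, Us, ← Pi.single_sub, Pi.norm_single, ← sub_mul, norm_mul, norm_eq_abs, norm_eq_abs,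
    abs_of_nonneg (gam_nonneg _ _ x)]
  have h0 : |amp C s t - amp C s r| * gam ((C s.1).N s.2) ((C s.1).prof s.2) x ≤ |amp C s t - amp C s r| :=
    mul_le_of_le_one_right (abs_nonneg _) (gam_le _ _ _)
  refine h0.trans ?_
  rw [amp, amp, ← mul_sub, abs_mul, abs_of_pos pz]
  have h1 : |qf ((t - bt s.1 s.2) / tau s.1 s.2) - qf ((r - bt s.1 s.2) / tau s.1 s.2)| ≤
      6 * (|t - r| / tau s.1 s.2) ^ α := by
    have h2 := qf_lip ((t - bt s.1 s.2) / tau s.1 s.2) ((r - bt s.1 s.2) / tau s.1 s.2)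
    have e : (t - bt s.1 s.2) / tau s.1 s.2 - (r - bt s.1 s.2) / tau s.1 s.2 = (t - r) / tau s.1 s.2 := by ring
    rw [e, abs_div, abs_of_pos ht] at h2
    have h3 : |qf ((t - bt s.1 s.2) / tau s.1 s.2) - qf ((r - bt s.1 s.2) / tau s.1 s.2)| ≤6 := by
      rw [abs_le]
      constructor <;>
      linarith [qf_le ((t - bt s.1 s.2) / tau s.1 s.2), qf_le ((r - bt s.1 s.2) / tau s.1 s.2),
        qf_nonneg ((t - bt s.1 s.2) / tau s.1 s.2), qf_nonneg ((r - bt s.1 s.2) / tau s.1 s.2)]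
    have h4 := min_rpow F.a0 F.a1 (z := |t - r| / tau s.1 s.2) pz
    rcases le_total 1 (|t - r| / tau s.1 s.2) with h5 | h5
    · rw [min_eq_left h5] at h4; linarith
    · rw [min_eq_right h5] at h4; linarith
  refine (mll h1 pz).trans ?_
  rw [div_rpow (abs_nonneg _) ht.le]
  have h3 : (C s.1).D s.2 / tau s.1 s.2 * (6 * (|t - r| ^ α / tau s.1 s.2 ^ α)) =
      6 * ((C s.1).D s.2 / (tau s.1 s.2 * tau s.1 s.2 ^ α)) * |t - r| ^ α := by field_simp
  rw [h3]
  refine mlr ?_ pz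
  have h4 : (C s.1).D s.2 / (tau s.1 s.2 * tau s.1 s.2 ^ α) ≤ K0 := by
    rw [div_le_iff₀ pz]
    refine (F.D_le s.1 s.2).trans ?_
    have h5 : tau s.1 s.2 ≤ tau s.1 s.2 ^ α := by
      simpa using rpow_le_rpow_of_exponent_ge ht ht1 F.a1.le
    have := F.kp
    rw [pow_two]
    gcongr
  linarith

lemma vf_x (F : Fam C M B α K0) (t : ℝ) (x y : Vd d) :
    ‖vf C t x - vf C t y‖ ≤12 * K0 * ‖x - y‖ ^ α := by
  have h0 : 0 ≤ K0 * ‖x - y‖ ^ α := mul_nonneg F.kp.le pz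
  by_cases h : ∃ s, act t s
  · obtain ⟨s, h⟩ := h
    rw [vf_act h]
    linarith [F.Us_x s t x y]
  · push Not at h
    rw [vf_none h]
    simp; linarith

lemma vf_t (F : Fam C M B α K0) (t r : ℝ) (x : Vd d) :
    ‖vf C t x - vf C r x‖ ≤12 * K0 * |t - r| ^ α := by
  have h0 : 0 ≤ K0 * |t - r| ^ α := mul_nonneg F.kp.le pz
  by_cases h : ∃ s, act t s
  · obtain ⟨s, h⟩ := h
    by_cases h' : ∃ s, act r s
    · obtain ⟨s', h'⟩ := h'
      rw [vf_act h, vf_act h']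
      by_cases e : s = s'
      · rw [e]; linarith [F.Us_t s' t r x]
      · have e1 : Us C s r =0 := Us_zero fun q => e (act_uniq q h')
        have e2 : Us C s' t =0 := Us_zero fun q => e (act_uniq h q)
        have e3 : Us C s t x - Us C s' r x = (Us C s t x - Us C s r x) + (Us C s' t x - Us C s' r x) := by
          rw [e1, e2]; simp; abel
        rw [e3]
        refine (norm_add_le _ _).trans ?_
        linarith [F.Us_t s t r x, F.Us_t s' t r x]
    · push Not at h'
      rw [vf_act h, vf_none h', ← Us_zero (C := C) (h' s)]
      linarith [F.Us_t s t r x]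
  · push Not at h
    by_cases h' : ∃ s, act r s
    · obtain ⟨s', h'⟩ := h'
      rw [vf_act h', vf_none h, ← Us_zero (C := C) (h s')]
      linarith [F.Us_t s' t r x]
    · push Not at h'
      rw [vf_none h', vf_none h]
      simp; linarith

lemma vf_cont (F : Fam C M B α K0) : Continuous (fun p : ℝ × Vd d => vf C p.1 p.2) := by
  rw [continuous_iff_continuousAt]
  intro p
  rw [ContinuousAt, tendsto_iff_norm_sub_tendsto_zero]
  have h : ∀ q : ℝ × Vd d, ‖vf C q.1 q.2 - vf C p.1 p.2‖ ≤12 * K0 * ‖q.2 - p.2‖ ^ α+12 * K0 * |q.1 - p.1| ^ α := by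
    intro q
    have : vf C q.1 q.2 - vf C p.1 p.2 = (vf C q.1 q.2 - vf C q.1 p.2) + (vf C q.1 p.2 - vf C p.1 p.2) := by abel
    rw [this]
    exact (norm_add_le _ _).trans (add_le_add (F.vf_x _ _ _) (F.vf_t _ _ _))
  refine squeeze_zero (fun _ => norm_nonneg _) h ?_
  have hc : Continuous (fun q : ℝ × Vd d => 12 * K0 * ‖q.2 - p.2‖ ^ α+12 * K0 * |q.1 - p.1| ^ α) := by
    have h1 : Continuous (fun q : ℝ × Vd d => ‖q.2 - p.2‖ ^ α) :=
      Continuous.rpow_const (by fun_prop) fun _ => Or.inr F.a0.le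
    have h2 : Continuous (fun q : ℝ × Vd d => |q.1 - p.1| ^ α) :=
      Continuous.rpow_const (by fun_prop) fun _ => Or.inr F.a0.le
    fun_prop
  have := hc.tendsto p
  simpa [zero_rpow F.a0.ne'] using this

lemma holder (F : Fam C M B α K0) : HolderVF α (vf C) :=
  ⟨F.vf_cont, 12 * K0, fun s _ t _ x y => ⟨F.vf_x t x y, F.vf_t t s x⟩⟩

lemma growth (F : Fam C M B α K0) (i j : ℕ) : (2:ℝ) ^ j * M i ≤ M (i + j) := by
  induction j with
  | zero => simp
  | succ j ih =>
    have : (2:ℝ) * M (i + j) ≤ M (i + j+1) := by exact_mod_cast F.M2 (i + j)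
    rw [pow_succ, ← add_assoc]
    linarith

lemma sup (F : Fam C M B α K0) (i : ℕ) {t : ℝ} (ht : t < (1/2) ^ (i+1)) (x : Vd d) (l : Fin d) :
    |vf C t x l| ≤3/2*2 ^ (11 * d+3) * (2 ^ (i+1) / M (i+1)) := by
  by_cases h : ∃ s, act t s
  · obtain ⟨⟨j, n⟩, h⟩ := h
    rw [vf_act h]
    have h1 := i_uniq (act_i h).1 ht
    simp only at h1
    obtain ⟨m, rfl⟩ := Nat.exists_eq_add_of_le h1
    have h2 : |Us C (i+1 + m, n) t x l| ≤ amp C (i+1 + m, n) t := by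
      rw [← norm_eq_abs]
      refine (norm_le_pi_norm _ l).trans ?_
      rw [Us, Pi.norm_single, norm_eq_abs, abs_of_nonneg (mul_nonneg (F.amp_nonneg _ _) (gam_nonneg _ _ _))]
      exact mul_le_of_le_one_right (F.amp_nonneg _ _) (gam_le _ _ _)
    refine (h2.trans (F.amp_le _ _)).trans ?_
    simp only
    have hM : (0:ℝ) < M (i+1 + m) := by exact_mod_cast (F.ok _).M0
    have hM1 : (0:ℝ) < M (i+1) := by exact_mod_cast (F.ok _).M0
    have h3 := F.D1 (i+1 + m) n
    have h4 := F.growth (i+1) m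
    have e : (C (i+1 + m)).D n / tau (i+1 + m) n * (3/2) =
        3/2*2^3*2 ^ (i+1 + m) * ((C (i+1 + m)).D n*2 ^ (11 * n)) := by
      rw [tau, one_div, inv_pow, pow_add, pow_add]
      field_simp
    rw [e]
    have h5 : (2:ℝ) ^ m / M (i+1 + m) ≤1 / M (i+1) := by
      rw [div_le_div_iff₀ hM hM1]; linarith
    calc _ ≤ (3:ℝ)/2*2^3*2 ^ (i+1 + m) * (2 ^ (11 * d) / M (i+1 + m)) := by gcongr
      _ = (3:ℝ)/2*2 ^ (11 * d+3)*2 ^ (i+1) * (2 ^ m / M (i+1 + m)) := by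
        rw [pow_add _ (i+1), pow_add _ _ 3]; ring
      _ ≤ (3:ℝ)/2*2 ^ (11 * d+3)*2 ^ (i+1) * (1 / M (i+1)) := by gcongr
      _ = _ := by ring
  · push Not at h
    rw [vf_none h]
    simp; positivity

lemma pause (i n : ℕ) {t : ℝ} (h : t ∈ Set.Ioo (bt i n + tau i n) (bt i (n+1))) : vf C t =0 := by
  refine vf_none fun s hs => ?_
  have h0 := bt_mono i (Nat.zero_le n)
  rw [bt_zero] at h0
  have ht := tau_pos i n
  have e : s.1 = i := le_antisymm (i_uniq (by linarith [h.1]) (act_i hs).2) (i_uniq (act_i hs).1 (h.2.trans (bt_lt _ _)))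
  have a := act_lt hs
  have b := hs.1
  have c := hs.2
  rw [e] at a b c
  have e2 : s.2 = n := le_antisymm (n_uniq b h.2) (n_uniq (by linarith [h.1]) a)
  rw [e2] at c
  linarith [h.1]

end Fam

end

section
variable {d : ℕ}

namespace Fam
variable {C : ℕ → Cas d} {M B : ℕ → ℕ} {α K0 : ℝ}
variable {κ : ℝ} {θin : Vd d → ℝ} {θ : ℝ → Vd d → ℝ}

def xi (D b τ t : ℝ) : ℝ := D * (3 * ((t - b) / τ)^2 - 2 * ((t - b) / τ)^3)

lemma xi_deriv (D b τ t : ℝ) : HasDerivAt (xi D b τ) (D / τ * (6 * ((t - b) / τ) * (1 - (t - b) / τ))) t := by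
  have h1 : HasDerivAt (fun t : ℝ => (t - b) / τ) (1 / τ) t := ((hasDerivAt_id t).sub_const b).div_const τ
  have h2 := (((h1.pow 2).const_mul 3).sub ((h1.pow 3).const_mul 2)).const_mul D
  refine h2.congr_deriv ?_
  push_cast
  ring

lemma xi_cont (D b τ : ℝ) : Continuous (xi D b τ) := by unfold xi; fun_prop

lemma stage (F : Fam C M B α K0) (S : Sys (vf C) κ θin θ) (i n : ℕ) {φ : Vd d → ℝ} (hφ : CP φ) {K : ℝ} (hK : 0 ≤ K)
    (hl : Lip K φ) {L : ℝ} (hL : 0 < L) :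
    ip (θ (bt i n)) φ - ip (θ (bt i n + tau i n))
      (push ((C i).D n) ((C i).N n) ((C i).dir n) ((C i).prof n) φ) ≤
    L/4 * (nm (θ (bt i n))^2 - nm (θ (bt i n + tau i n))^2) +
      κ * d * (K * (1 + (C i).R n))^2 / (2 * L) * tau i n := by
  have ht := tau_pos i n
  have hD := (F.ok i).D0 n
  have h := S.pairing (t0 := bt i n) (t1 := bt i n + tau i n) (bt_pos i n).le (by linarith)
    (by have := bt_tau i n; have := bt_le_one i (n+1); have : (0:ℝ) < (1/2) ^ (i + n+3) := by positivity
        linarith)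
    (xi_cont ((C i).D n) (bt i n) (tau i n)) (a := amp C (i, n)) (fun t h => by
      refine (xi_deriv _ _ _ t).congr_deriv ?_
      have h1 : 0 ≤ (t - bt i n) / tau i n := div_nonneg (by linarith [h.1]) ht.le
      have h2 : (t - bt i n) / tau i n ≤1 := by rw [div_le_one ht]; linarith [h.2]
      rw [amp, qf, max_eq_right]
      exact mul_nonneg pz (by linarith))
    (gam_cp ((C i).N n) ((C i).prof n)) (j := (C i).dir n) (fun x r => gam_inv _ ((F.ok i).ne n) x r)
    (fun t h => by rw [vf_act (s := (i, n)) h]; rfl) hφ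
    (K := K * (1 + (C i).R n)) (by have := (F.ok i).R3 n; positivity)
    (fun t h => by
      have h1 : 0 ≤ (t - bt i n) / tau i n := div_nonneg (by linarith [h.1]) ht.le
      have h2 : (t - bt i n) / tau i n ≤1 := by rw [div_le_one ht]; linarith [h.2]
      set z := (t - bt i n) / tau i n
      have e : xi ((C i).D n) (bt i n) (tau i n) t = (C i).D n * (3 * z^2 - 2 * z^3) := rfl
      have h3 : 0 ≤3 * z^2 - 2 * z^3 := by nlinarith [mul_nonneg (sq_nonneg z) (by linarith : 0 ≤1 - z), sq_nonneg z]
      have h4 : 3 * z^2 - 2 * z^3 ≤1 := by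
        have : 1 - (3 * z^2 - 2 * z^3) = (1 - z)^2 * (1+2 * z) := by ring
        have : 0 ≤ (1 - z)^2 * (1+2 * z) := by positivity
        linarith
      refine (shear_lip (by rw [e]; positivity) hK hl).mono ?_
      refine mll ?_ hK
      rw [e, Cas.R]
      have : (C i).D n * (3 * z^2 - 2 * z^3) ≤ (C i).D n := mul_le_of_le_one_right hD.le h4
      gcongr) hL
  have e0 : xi ((C i).D n) (bt i n) (tau i n) (bt i n) =0 := by simp [xi]
  have e1 : xi ((C i).D n) (bt i n) (tau i n) (bt i n + tau i n) = (C i).D n := by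
    rw [xi, add_sub_cancel_left, div_self ht.ne']; ring
  rw [e0, e1] at h
  simp only [zero_mul, zero_smul, sub_zero, add_sub_cancel_left] at h
  exact h

lemma pausing (F : Fam C M B α K0) (S : Sys (vf C) κ θin θ) (i n : ℕ) {φ : Vd d → ℝ} (hφ : CP φ) {K : ℝ} (hK : 0 ≤ K)
    (hl : Lip K φ) {L : ℝ} (hL : 0 < L) :
    ip (θ (bt i n + tau i n)) φ - ip (θ (bt i (n+1))) φ ≤
    L/4 * (nm (θ (bt i n + tau i n))^2 - nm (θ (bt i (n+1)))^2) +
      κ * d * K^2 / (2 * L) * (bt i (n+1) - (bt i n + tau i n)) := by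
  have ht := tau_pos i n
  have hb := bt_pos i n
  have h := S.pairing (t0 := bt i n + tau i n) (t1 := bt i (n+1)) (by linarith)
    (by have := bt_tau i n; have : (0:ℝ) < (1/2) ^ (i + n+3) := by positivity
        linarith) (bt_le_one i (n+1)) (ξ := fun _ => 0) (a := fun _ => 0) continuous_const
    (fun t _ => hasDerivAt_const t 0)
    (gam_cp ((C i).N n) ((C i).prof n)) (j := (C i).dir n) (fun x r => gam_inv _ ((F.ok i).ne n) x r)
    (fun t h => by rw [pause i n h]; ext x l; simp) hφ hK
    (fun t _ => by simpa using hl) hL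
  simpa using h

def Lam (C : Cas d) (K : ℝ) (n : ℕ) : ℝ := K * ∏ l ∈ Finset.range n, (1 + C.R l)

lemma Lam_nonneg (F : Fam C M B α K0) (i : ℕ) {K : ℝ} (hK : 0 ≤ K) (n : ℕ) : 0 ≤ Lam (C i) K n :=
  mul_nonneg hK (Finset.prod_nonneg fun l _ => by linarith [(F.ok i).R3 l])

lemma Lam_succ (K : ℝ) (i n : ℕ) : Lam (C i) K (n+1) = Lam (C i) K n * (1 + (C i).R n) := by
  rw [Lam, Lam, Finset.prod_range_succ, mul_assoc]

lemma chain (F : Fam C M B α K0) (S : Sys (vf C) κ θin θ) (i : ℕ) {φ : Vd d → ℝ} (hφ : CP φ) {K : ℝ} (hK : 0 ≤ K)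
    (hl : Lip K φ) {L : ℝ} (hL : 0 < L) (n : ℕ) :
    ip (θ (bt i 0)) φ - ip (θ (bt i n)) ((C i).itp φ n) ≤
    L/4 * (nm (θ (bt i 0))^2 - nm (θ (bt i n))^2) +
      κ * d * Lam (C i) K n^2 / (2 * L) * (bt i n - bt i 0) := by
  have hk := S.kp
  induction n with
  | zero => simp [Cas.itp]
  | succ n ih =>
    have h0 := F.Lam_nonneg i hK n
    have h1 := F.Lam_nonneg i hK (n+1)
    have hc := (Cas.itp_cp (F.ok i) hφ n).1
    have hc1 := (Cas.itp_cp (F.ok i) hφ (n+1)).1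
    have a := F.stage S i n hc h0 (Cas.itp_lip (F.ok i) hK hl n) hL
    have b := F.pausing S i n hc1 h1 (Cas.itp_lip (F.ok i) hK hl (n+1)) hL
    rw [← Lam_succ] at a
    have hle : Lam (C i) K n ≤ Lam (C i) K (n+1) := by
      rw [Lam_succ]
      exact le_mul_of_one_le_right h0 (by linarith [(F.ok i).R3 n])
    have hm : κ * d * Lam (C i) K n^2 / (2 * L) * (bt i n - bt i 0) ≤
        κ * d * Lam (C i) K (n+1)^2 / (2 * L) * (bt i n - bt i 0) := by
      refine mlr ?_ (by linarith [bt_mono i (Nat.zero_le n)])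
      gcongr
    change _ - ip _ ((C i).itp φ (n+1)) ≤ _ at a
    have e : κ * d * Lam (C i) K (n+1)^2 / (2 * L) * (bt i (n+1) - bt i 0) =
       κ * d * Lam (C i) K (n+1)^2 / (2 * L) * (bt i n - bt i 0) +
       κ * d * Lam (C i) K (n+1)^2 / (2 * L) * tau i n +
       κ * d * Lam (C i) K (n+1)^2 / (2 * L) * (bt i (n+1) - (bt i n + tau i n)) := by ring
    rw [e]
    linarith

lemma chain' (F : Fam C M B α K0) (S : Sys (vf C) κ θin θ) (i : ℕ) {φ : Vd d → ℝ} (hφ : CP φ) {K : ℝ} (hK : 0 ≤ K)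
    (hl : Lip K φ) {L : ℝ} (hL : 0 < L) (n : ℕ) :
    ip (θ (bt i 0)) φ - ip (θ (bt i n + tau i n)) ((C i).itp φ (n+1)) ≤
    L/4 * nm (θ 0)^2 + d / (2 * L) * (κ * Lam (C i) K n^2 + κ * Lam (C i) K (n+1)^2 * tau i n) := by
  have hk := S.kp
  have a := F.chain S i hφ hK hl hL n
  have b := F.stage S i n (Cas.itp_cp (F.ok i) hφ n).1 (F.Lam_nonneg i hK n) (Cas.itp_lip (F.ok i) hK hl n) hL
  rw [← Lam_succ] at b
  change _ - ip _ ((C i).itp φ (n+1)) ≤ _ at b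
  have h1 : nm (θ (bt i 0))^2 ≤ nm (θ 0)^2 := S.E_anti le_rfl (bt_pos _ _).le (bt_le_one _ _)
  have h2 : bt i n - bt i 0 ≤1 := by linarith [bt_le_one i n, bt_pos i 0]
  have h3 : κ * d * Lam (C i) K n^2 / (2 * L) * (bt i n - bt i 0) ≤ κ * d * Lam (C i) K n^2 / (2 * L) :=
    mul_le_of_le_one_right pz h2
  have h4 : L/4 * (nm (θ (bt i 0))^2 - nm (θ (bt i n))^2) + L/4 * (nm (θ (bt i n))^2 - nm (θ (bt i n + tau i n))^2)
      ≤ L/4 * nm (θ 0)^2 := by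
    rw [← mul_add]
    refine mll ?_ pz
    nlinarith [sq_nonneg (nm (θ (bt i n + tau i n)))]
  have e : (d:ℝ) / (2 * L) * (κ * Lam (C i) K n^2 + κ * Lam (C i) K (n+1)^2 * tau i n) =
    κ * d * Lam (C i) K n^2 / (2 * L) + κ * d * Lam (C i) K (n+1)^2 / (2 * L) * tau i n := by ring
  rw [e]
  linarith

end Fam

end

section
variable {d : ℕ}

namespace Fam
variable {C : ℕ → Cas d} {M B : ℕ → ℕ} {α K0 : ℝ}
variable {κ : ℝ} {θin : Vd d → ℝ} {θ : ℝ → Vd d → ℝ}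

lemma one_kappa (F : Fam C M B α K0) (S : Sys (vf C) κ θin θ) (i n : ℕ) {φ0 f0 G : Vd d → ℝ} (hφ : CP φ0) {K : ℝ}
    (hK : 0 ≤ K) (hl : Lip K φ0) (hf0 : CP f0) {e b g : ℝ} (he : 0 < e) (hip : ip f0 φ0 = e^2/2) (hnm : nm φ0 ≤ e)
    (hdist : nm (fun x => θ (bt i 0) x - f0 x) ≤ e/8) (hb : 0 ≤ b) (hba : b * nm (θ 0) ≤ e^2/16)
    (ha : 0 < nm (θ 0)) (hG : CP G) (hsw : SW ((C i).itp φ0 (n+1)) G ((C i).dir (n+1)) b) (hg : nm G ≤ g)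
    (hgk : g^2 ≤ κ * e^2 * (1/2) ^ (i + n+3))
    (hκ : d / (2 * (e^2 / (4 * nm (θ 0)^2))) *
      (κ * Lam (C i) K n^2 + κ * Lam (C i) K (n+1)^2 * tau i n) ≤ e^2/16) :
    e^2/1280 ≤ κ * dissip θ := by
  by_contra hcon
  push Not at hcon
  rw [S.dissip_eq] at hcon
  have hk := S.kp
  have hbt := bt_tau i n
  have hlp : (0:ℝ) < (1/2) ^ (i + n+3) := by positivity
  have ht := tau_pos i n
  have hb0 := bt_pos i n
  have hb1 := bt_le_one i (n+1)
  have hch := F.chain' S i hφ hK hl (L := e^2 / (4 * nm (θ 0)^2)) pz n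
  have e1 : e^2 / (4 * nm (θ 0)^2)/4 * nm (θ 0)^2 = e^2/16 := by field_simp; norm_num
  rw [e1] at hch
  obtain ⟨s, hs, hs1, hs2⟩ := S.good_time (a := bt i n + tau i n) (b := bt i (n+1)) (by linarith) (by linarith) hb1
    (fun t h => pause i n h) (δ := e^2/1280) (by linarith) pz
  have hs01 : s ∈ Set.Ioo (0:ℝ) 1 := ⟨by linarith [hs.1], by linarith [hs.2]⟩
  have cpa := S.cp (t := bt i n + tau i n) ⟨by linarith, by linarith⟩
  have cps := S.cp (t := s) ⟨hs01.1.le, hs01.2.le⟩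
  have cp0 := S.cp (t := bt i 0) ⟨(bt_pos _ _).le, bt_le_one _ _⟩
  obtain ⟨cφ, nφ⟩ := Cas.itp_cp (F.ok i) hφ (n+1)
  set φ := (C i).itp φ0 (n+1) with hφd
  set j := (C i).dir (n+1)
  have hdual := SW.dual cφ hG hsw ((S.c2 hs01).of_le (by norm_num)) (S.sol.periodic s)
  -- gradient bound
  have hgr : nm (pd (θ s) j)^2 ≤ Sys.gr θ s := by
    unfold Sys.gr
    exact Finset.single_le_sum (f := fun i => nm (pd (θ s) i)^2) (fun i _ => sq_nonneg _) (Finset.mem_univ j)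
  have h1 : κ * (1/2) ^ (i + n+3) * nm (pd (θ s) j)^2 ≤2 * (e^2/1280) := by
    refine le_trans ?_ hs1
    have : (1/2 : ℝ) ^ (i + n+3) ≤ bt i (n+1) - (bt i n + tau i n) := by linarith
    gcongr
    exact mul_nonneg hk.le (by linarith)
  have hP := nm_nonneg (pd (θ s) j)
  have h2 : g * nm (pd (θ s) j) ≤ e^2/16 := by
    refine le_of_sq_le_sq ?_ pz
    rw [mul_pow]
    have h3 := mlr hgk (sq_nonneg (nm (pd (θ s) j)))
    have h4 := mll h1 (sq_nonneg e)
    have h5 : e^2 * (2 * (e^2/1280)) ≤ (e^2/16)^2 := by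
      have : 0 ≤ e^4 := by positivity
      nlinarith
    linarith
  have h3 : nm G * nm (pd (θ s) j) ≤ e^2/16 := (mlr hg hP).trans h2
  have h4 : b * nm (θ s) ≤ e^2/16 :=
    (mll (S.nm_anti le_rfl hs01.1.le hs01.2.le) hb).trans hba
  have h5 : nm (fun x => θ (bt i n + tau i n) x - θ s x) ≤ e/16 := by
    refine le_of_sq_le_sq (hs2.trans (le_of_eq ?_)) pz
    ring
  have h6 : ip (θ (bt i n + tau i n)) φ ≤ ip φ (θ s) + e^2/16 := by
    have := ip_le (cpa.sub cps).c cφ.c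
    rw [ip_sub cpa.c cps.c cφ.c] at this
    rw [ip_comm φ]
    have h7 : nm (fun x => θ (bt i n + tau i n) x - θ s x) * nm φ ≤ e/16 * e :=
      mul_le_mul h5 (by rw [nφ]; exact hnm) (nm_nonneg _) pz
    have : e/16 * e = e^2/16 := by ring
    linarith
  have h7 : e^2/2 - e^2/8 ≤ ip (θ (bt i 0)) φ0 := by
    have := ip_le (hf0.sub cp0).c hφ.c
    rw [ip_sub hf0.c cp0.c hφ.c, nm_sub_comm] at this
    have h8 : nm (fun x => θ (bt i 0) x - f0 x) * nm φ0 ≤ e/8 * e :=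
      mul_le_mul hdist hnm (nm_nonneg _) pz
    have : e/8 * e = e^2/8 := by ring
    linarith
  have : 0 < e^2 := by positivity
  linarith

lemma seq (F : Fam C M B α K0) (i : ℕ) {Q K e : ℝ} (hQ : 0 ≤ Q) (hK : 0 ≤ K) (he : 0 < e) :
    ∃ (g κ : ℕ → ℝ), (∀ n, Q * ∏ l ∈ Finset.range (n+1), 3 / (C i).R l ≤ g n) ∧ (∀ n, 0 < κ n) ∧
      (∀ n, g n^2 ≤ κ n * e^2 * (1/2) ^ (i + n+3)) ∧ Tendsto κ atTop (𝓝 0) ∧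
      Tendsto (fun n => κ n * Lam (C i) K n^2 + κ n * Lam (C i) K (n+1)^2 * tau i n) atTop (𝓝 0) := by
  set P : ℕ → ℝ := fun n => ∏ l ∈ Finset.range n, 3 / (C i).R l with hP
  have hR : ∀ l, 3 ≤ (C i).R l := (F.ok i).R3
  have hRp : ∀ l, 0 < (C i).R l := fun l => by linarith [hR l]
  have hPp : ∀ n, 0 < P n := fun n => Finset.prod_pos fun l _ => by have := hRp l; positivity
  have hPs : ∀ n, P (n+1) = P n * (3 / (C i).R n) := fun n => Finset.prod_range_succ _ _
  have hP1 : ∀ n, P n ≤1 := fun n => Finset.prod_le_one (fun l _ => by have := hRp l; positivity) fun l _ => by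
    rw [div_le_one (hRp l)]; exact hR l
  have h8 : ∀ n, 1 / (C i).R n ≤ (1/8) ^ n := fun n => by
    rw [one_div_pow]
    exact one_div_le_one_div_of_le pz (F.R8 i n)
  have hPL : ∀ n, P n * Lam (C i) K n ≤ K*4 ^ n := fun n => by
    induction n with
    | zero => simp [hP, Lam]
    | succ n ih =>
      rw [hPs, Lam_succ]
      have h1 : 3 / (C i).R n * (1 + (C i).R n) ≤4 := by
        rw [div_mul_eq_mul_div, div_le_iff₀ (hRp n)]; linarith [hR n]
      calc _ = (P n * Lam (C i) K n) * (3 / (C i).R n * (1 + (C i).R n)) := by ring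
        _ ≤ (K*4 ^ n)*4 := mul_le_mul ih h1 (by have := hRp n; positivity) pz
        _ = _ := by ring
  set A := (Q+1)^2*2 ^ (i+3) / e^2 with hA
  have hA0 : 0 < A := by positivity
  have hκe : ∀ n, A*2 ^ n * P (n+1)^2 * e^2 * (1/2) ^ (i + n+3) = ((Q+1) * P (n+1))^2 := fun n => by
    rw [hA, show i + n+3 = (i+3) + n by ring, pow_add (1/2 : ℝ), one_div, inv_pow, inv_pow]
    field_simp
  have hL := fun n => F.Lam_nonneg i hK n
  refine ⟨fun n => (Q+1) * P (n+1), fun n => A*2 ^ n * P (n+1)^2, fun n => ?_, fun n => ?_, fun n => ?_, ?_, ?_⟩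
  · exact mlr (by linarith) (hPp _).le
  · have := hPp (n+1); positivity
  · rw [hκe]
  · have hb : ∀ n, A*2 ^ n * P (n+1)^2 ≤ A*9 * (1/32) ^ n := fun n => by
      have h1 : P (n+1) ≤3 * (1/8) ^ n := by
        rw [hPs]
        have := h8 n
        have h2 := hRp n
        calc P n * (3 / (C i).R n) ≤1 * (3 / (C i).R n) := mlr (hP1 n) pz
          _ =3 * (1 / (C i).R n) := by ring
          _ ≤ _ := by linarith
      have h3 : P (n+1)^2 ≤ (3 * (1/8) ^ n)^2 := pow_le_pow_left₀ (hPp _).le h1 2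
      calc _ ≤ A*2 ^ n * (3 * (1/8) ^ n)^2 := by gcongr
        _ = A*9 * (2 * (1/8)^2) ^ n := by rw [mul_pow 2, ← pow_mul, mul_comm 2 n, pow_mul]; ring
        _ = _ := by norm_num
    refine squeeze_zero (fun n => by have := hPp (n+1); positivity) hb ?_
    have := (tendsto_pow_atTop_nhds_zero_of_lt_one (r := (1/32 : ℝ)) (by norm_num) (by norm_num)).const_mul (A*9)
    simpa using this
  · have hb : ∀ n, A*2 ^ n * P (n+1)^2 * Lam (C i) K n^2 + A*2 ^ n * P (n+1)^2 * Lam (C i) K (n+1)^2 * tau i n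
        ≤ A*9 * K^2 * (1/2) ^ n + A*16 * K^2 * (1/64) ^ n := fun n => by
      have h1 : (P n * Lam (C i) K n)^2 ≤ (K*4 ^ n)^2 :=
        pow_le_pow_left₀ (mul_nonneg (hPp _).le (hL n)) (hPL n) 2
      have h2 : (P (n+1) * Lam (C i) K (n+1))^2 ≤ (K*4 ^ (n+1))^2 :=
        pow_le_pow_left₀ (mul_nonneg (hPp _).le (hL _)) (hPL _) 2
      have h3 : (3 / (C i).R n)^2 ≤ (3 * (1/8) ^ n)^2 := by
        have h4 := hRp n
        refine pow_le_pow_left₀ pz ?_ 2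
        have := h8 n
        rw [show 3 / (C i).R n =3 * (1 / (C i).R n) by ring]
        linarith
      have h5 : tau i n ≤ (1/2) ^ (11 * n) := half_anti (by omega)
      refine add_le_add ?_ ?_
      · rw [hPs]
        calc _ = A*2 ^ n * (P n * Lam (C i) K n)^2 * (3 / (C i).R n)^2 := by ring
          _ ≤ A*2 ^ n * (K*4 ^ n)^2 * (3 * (1/8) ^ n)^2 := by gcongr
          _ = A*9 * K^2 * (2*4^2 * (1/8)^2) ^ n := by
            rw [mul_pow (2*4^2 : ℝ), mul_pow (2:ℝ), ← pow_mul, ← pow_mul, mul_comm 2 n, pow_mul, pow_mul]; ring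
          _ = _ := by norm_num
      · calc _ = A*2 ^ n * (P (n+1) * Lam (C i) K (n+1))^2 * tau i n := by ring
          _ ≤ A*2 ^ n * (K*4 ^ (n+1))^2 * (1/2) ^ (11 * n) := by
            have := (tau_pos i n).le
            gcongr
          _ = A*16 * K^2 * (2*4^2 * (1/2)^11) ^ n := by
            rw [mul_pow (2*4^2 : ℝ), mul_pow (2:ℝ), ← pow_mul, ← pow_mul, mul_comm 2 n, pow_mul 4, pow_mul]; ring
          _ = _ := by norm_num
    refine squeeze_zero (fun n => by have := hPp (n+1); have := tau_pos i n; positivity) hb ?_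
    have t1 := (tendsto_pow_atTop_nhds_zero_of_lt_one (r := (1/2 : ℝ)) (by norm_num) (by norm_num)).const_mul (A*9 * K^2)
    have t2 := (tendsto_pow_atTop_nhds_zero_of_lt_one (r := (1/64 : ℝ)) (by norm_num) (by norm_num)).const_mul (A*16 * K^2)
    simpa using t1.add t2
end Fam

end

section
variable {d : ℕ}

namespace Fam
variable {C : ℕ → Cas d} {M B : ℕ → ℕ} {α K0 : ℝ}

lemma toSys (F : Fam C M B α K0) {κ : ℝ} {θin : Vd d → ℝ} {θ : ℝ → Vd d → ℝ} (hk : 0 < κ)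
    (h : IsAdvDiffSol (vf C) κ θin θ) : Sys (vf C) κ θin θ := ⟨h, hk, F.vf_cont, F.shear⟩

lemma casc_lower (F : Fam C M B α K0) (i : ℕ) {θin f0 : Vd d → ℝ} (hθ : CP θin) (hf : ContDiff ℝ 2 f0)
    (hp : SpacePeriodic f0) (h0 : ∫ x in box d, f0 x =0) {Γ : ℝ} (hΓ : ∀ l, nm (pd f0 l) ≤ Γ) (hΓ0 : 0 ≤ Γ)
    (ha : 0 < nm θin) (hclose : nm (fun x => θin x - f0 x) ≤ nm θin / (1000 * d^2 * M i))
    (hbig : 144 * d^2 * Γ ≤1 / M i * B i * nm θin) {Θ : ℝ → ℝ → Vd d → ℝ}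
    (hsol : ∀ κ ∈ Set.Ioc (0:ℝ) 1, IsAdvDiffSol (vf C) κ θin (Θ κ)) :
    ∃ᶠ κ in 𝓝[>] (0:ℝ), nm θin^2 / (1000000 * (d^2 * M i)^2) ≤ κ * dissip (Θ κ) := by
  have hd1 : (1:ℝ) ≤ d := by have := (F.ok 0).d2; exact_mod_cast (by omega : 1 ≤ d)
  have hM1 : (1:ℝ) ≤ M i := by exact_mod_cast (F.ok i).M0
  have hB : (0:ℝ) < B i := by exact_mod_cast (F.ok i).B0
  have hdM : (1:ℝ) ≤ d^2 * M i := by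
    have : (1:ℝ) ≤ d^2 := one_le_pow₀ hd1
    nlinarith
  set W : ℝ := d^2 * M i with hW
  have hW0 : 0 < W := by linarith
  set a := nm θin with haD
  have hcf : CP f0 := ⟨hf.continuous, hp⟩
  rw [show (1000:ℝ) * d^2 * M i =1000 * W by rw [hW]; ring] at hclose
  have hc2 : a / (1000 * W) ≤ a/1000 := by
    apply div_le_div_of_nonneg_left ha.le (by norm_num) (by linarith)
  have hnf : 10/11 * a ≤ nm f0 := by
    have h1 := nm_add (f := fun x => θin x - f0 x) (g := f0) (hθ.c.sub hcf.c) hcf.c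
    simp only [sub_add_cancel] at h1
    have h1 : a ≤ nm (fun x => θin x - f0 x) + nm f0 := h1
    linarith
  have hnf0 : 0 < nm f0 := by linarith
  obtain ⟨e, φ0, Q, K, he, he0, cφ, hK, hl, hip, hnm, hQ, hall⟩ := Cas.main_test (F.ok i) hf hp h0 hΓ hΓ0 hnf0 (by
    have h1 : 1 / (M i:ℝ) * B i * (10/11 * a) ≤1 / (M i:ℝ) * B i * nm f0 := by gcongr
    have h2 : 0 ≤1 / (M i:ℝ) * B i * a := by positivity
    nlinarith)
  rw [show (24:ℝ) * d^2 * M i =24 * W by rw [hW]; ring, div_le_iff₀ pz] at he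
  have hae : a ≤26.4 * W * e := by norm_num; linarith
  have hcl : nm (fun x => θin x - f0 x) ≤ e/32 := by
    refine hclose.trans ?_
    rw [div_le_iff₀ pz]
    have : 0 < W * e := by positivity
    norm_num at hae
    nlinarith
  set b := e / (480 * d^2 * M i) with hb
  have hbe : b = e / (480 * W) := by rw [hb, hW]; ring
  have hba : b * a ≤ e^2/16 := by
    rw [hbe, div_mul_eq_mul_div, div_le_iff₀ pz]
    have h1 := mll hae he0.le
    have : 0 < W * e^2 := by positivity
    norm_num at h1
    nlinarith
  obtain ⟨g, κ, hg, hκ0, hgk, hκt, hLt⟩ := F.seq i hQ hK he0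
  set Z : ℝ := d / (2 * (e^2 / (4 * a^2))) with hZ
  have hev : ∀ᶠ n in atTop, e^2/1280 ≤ κ n * dissip (Θ (κ n)) := by
    have e1 := hLt.const_mul Z
    rw [mul_zero] at e1
    have e2 := hκt.mul_const (d * Γ^2)
    rw [zero_mul] at e2
    filter_upwards [e1.eventually_le_const (show 0 < e^2/16 by positivity),
      e2.eventually_le_const (show 0 < (e/32)^2 by positivity), hκt.eventually_le_const one_pos,
      eventually_ge_atTop d] with n n1 n2 n3 n4
    have S := F.toSys (hκ0 n) (hsol _ ⟨hκ0 n, n3⟩)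
    have hinit : Θ (κ n) 0 = θin := funext S.sol.init
    obtain ⟨G, cG, hsw, hgG⟩ := hall (n+1) (by omega)
    refine F.one_kappa S i n cφ hK hl hcf he0 hip hnm ?_ (b := b) pz (by rw [hinit]; exact hba)
      (by rw [hinit]; exact ha) cG hsw (hgG.trans (hg n)) (hgk n) (by rw [hinit]; exact n1)
    have hT : bt i 0 = (1/2) ^ (i+1) := bt_zero i
    have hM' : (0:ℝ) < M (i+1) := by exact_mod_cast (F.ok _).M0
    have hdis := S.disturb hf hp (T := bt i 0) (bt_pos _ _).le (bt_le_one _ _)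
      (U := 3/2*2 ^ (11 * d+3) * (2 ^ (i+1) / M (i+1))) pz hΓ hΓ0
      (fun t ht x l => F.sup i (by rw [← hT]; exact ht.2) x l)
    rw [hinit] at hdis
    refine hdis.trans ?_
    have h1 : √(nm (fun x => θin x - f0 x)^2 + κ n * d * Γ^2) ≤ e/16 := by
      rw [sqrt_le_left pz]
      have : nm (fun x => θin x - f0 x)^2 ≤ (e/32)^2 := pow_le_pow_left₀ (nm_nonneg _) hcl 2
      have : (e/16)^2 =4 * (e/32)^2 := by ring
      have : 0 ≤ (e/32)^2 := by positivity
      linarith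
    have h2 : 2 * (3/2*2 ^ (11 * d+3) * (2 ^ (i+1) / M (i+1))) * Γ * bt i 0 ≤ e/16 := by
      rw [hT]
      have e3 : 2 * (3/2*2 ^ (11 * d+3) * (2 ^ (i+1) / M (i+1))) * Γ * (1/2 : ℝ) ^ (i+1) =
          3*2 ^ (11 * d+3) * Γ / M (i+1) := by
        rw [one_div, inv_pow]; field_simp
      rw [e3, div_le_iff₀ hM']
      have h3 : (2:ℝ) ^ (11 * d+8) * B i ≤ M (i+1) := by exact_mod_cast F.MB i
      rw [show (2:ℝ) ^ (11 * d+8) =32*2 ^ (11 * d+3) by rw [pow_add, pow_add]; ring] at h3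
      have h4 : 144 * d^2 * Γ * M i ≤ B i * a := by
        have := mlr hbig (by linarith : (0:ℝ) ≤ M i)
        have e4 : 1 / (M i : ℝ) * B i * a * M i = B i * a := by field_simp
        linarith
      have h5 : Γ ≤ B i * e * (26.4/144) := by
        have h6 : B i * a ≤ B i * (26.4 * W * e) := by gcongr
        have h7 : W * Γ ≤ W * (B i * e * (26.4/144)) := by
          have : 144 * d^2 * Γ * M i =144 * (W * Γ) := by rw [hW]; ring
          norm_num at h6 ⊢
          linarith
        exact le_of_mul_le_mul_left h7 hW0
      have h8 := mll h3 (show 0 ≤ e/16 by positivity)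
      have h9 := mll h5 (show (0:ℝ) ≤3*2 ^ (11 * d+3) by positivity)
      have h10 : 0 ≤ (2:ℝ) ^ (11 * d+3) * (B i * e) := by positivity
      have h11 : e/16 * (32 * (2:ℝ) ^ (11 * d+3) * B i) =2 * ((2:ℝ) ^ (11 * d+3) * (B i * e)) := by ring
      have h12 : 3 * (2:ℝ) ^ (11 * d+3) * (B i * e * (26.4/144)) = (3*26.4/144) * ((2:ℝ) ^ (11 * d+3) * (B i * e)) := by ring
      rw [h11] at h8
      rw [h12] at h9
      have h13 : (3*26.4/144) * ((2:ℝ) ^ (11 * d+3) * (B i * e)) ≤2 * ((2:ℝ) ^ (11 * d+3) * (B i * e)) :=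
        mlr (by norm_num) h10
      exact (h9.trans h13).trans h8
    linarith
  have hκ' : Tendsto κ atTop (𝓝[>] 0) := tendsto_nhdsWithin_iff.2 ⟨hκt, Eventually.of_forall hκ0⟩
  refine hκ'.frequently (hev.frequently.mono fun n hn => le_trans ?_ hn)
  rw [div_le_div_iff₀ pz (by norm_num)]
  have h1 : a^2 ≤ (26.4 * W * e)^2 := pow_le_pow_left₀ ha.le hae 2
  have h2 : 0 ≤ W^2 * e^2 := by positivity
  norm_num at h1
  nlinarith

end Fam

end

section
variable {d : ℕ}

def casx (d : ℕ) (hd : 2 ≤ d) (Y q k c1 : ℕ) : Cas d where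
  D n := if n < d then 1 / ((c1 * Y ^ (q+2) : ℕ) : ℝ) else 1 / ((Y:ℝ)^2 ^ (n - d)) ^ (2 * q+3)
  N n := if n < d then (Y ^ (q+2)) ^ (k+3) else (Y^2 ^ (n - d)) ^ (2 * (k+3) * (q+2))
  dir n := if h : n < d then ⟨n, h⟩ else if (n - d) % 2 =0 then ⟨0, by omega⟩ else ⟨1, by omega⟩
  prof n := if h : n+1 < d then ⟨n+1, h⟩ else if n+1 = d then ⟨0, by omega⟩ else
    if (n - d) % 2 =0 then ⟨1, by omega⟩ else ⟨0, by omega⟩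

namespace casx
variable {hd : 2 ≤ d} {Y q k c1 : ℕ}

lemma R_lt {n : ℕ} (h : n < d) : (casx d hd Y q k c1).R n =
    2 * (((Y ^ (q+2)) ^ (k+3) : ℕ) : ℝ) / ((c1 * Y ^ (q+2) : ℕ) : ℝ) := by
  simp only [Cas.R, casx, if_pos h]; ring

lemma R_ge (hY : 0 < Y) (m : ℕ) : (casx d hd Y q k c1).R (d + m) =
    2 * ((Y:ℝ)^2 ^ m) ^ (2 * (q+2) * (k+2)+1) := by
  have : ¬ (d + m < d) := by omega
  simp only [Cas.R, casx, if_neg this, Nat.add_sub_cancel_left]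
  have hz : (0:ℝ) < (Y:ℝ)^2 ^ m := by positivity
  push_cast
  rw [show 2 * (k+3) * (q+2) = (2 * (q+2) * (k+2)+1) + (2 * q+3) by ring, pow_add _ (2 * (q+2) * (k+2)+1)]
  field_simp

lemma prodR (hY : 0 < Y) (m : ℕ) : ∏ l ∈ Finset.Ico d (d + m), 3 / (casx d hd Y q k c1).R l =
    (3/2) ^ m * ((Y:ℝ) / (Y:ℝ)^2 ^ m) ^ (2 * (q+2) * (k+2)+1) := by
  have hy : (0:ℝ) < Y := by exact_mod_cast hY
  induction m with
  | zero => simp [hy.ne']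
  | succ m ih =>
    rw [← add_assoc, Finset.prod_Ico_succ_top (by omega), ih, R_ge hY, pow_succ 2 m, pow_mul, pow_succ (3/2 : ℝ) m]
    generalize 2 * (q+2) * (k+2)+1 = ρ
    have hz : (0:ℝ) < (Y:ℝ)^2 ^ m := by positivity
    generalize (Y:ℝ)^2 ^ m = Z at hz
    rw [div_pow _ Z, div_pow _ (Z^2), ← pow_mul, mul_comm 2 ρ, pow_mul]
    field_simp

lemma pow_le_of {y : ℝ} {a : ℝ} {b : ℝ} {m : ℕ} (ha0 : 0 ≤ a) (hb0 : 0 ≤ b) (ha : a ≤ y) (hb : b ≤ y) (hy : 1 ≤ y) :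
    a * b ^ m ≤ y^2 ^ m := by
  calc a * b ^ m ≤ y * y ^ m := by gcongr
    _ = y ^ (m+1) := by ring
    _ ≤ y^2 ^ m := pow_le_pow_right₀ hy (by have := Nat.lt_two_pow_self (n := m); omega)

lemma T1 {y Z : ℝ} (hy : 1 ≤ y) (h : Z = y ∨ y^2 ≤ Z) :
    y ^ (2 * (q+2) * (k+2)+1 + (q+2)) * Z ^ (2 * (q+2)) ≤
      Z ^ (2 * (q+2) * (k+2)+1) * y ^ ((q+2) * (k+3)) := by
  rcases h with rfl | h
  · rw [← pow_add, ← pow_add]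
    refine pow_le_pow_right₀ hy ?_
    nlinarith [Nat.zero_le (q * k)]
  · have e : 2 * (q+2) * (k+2)+1 =2 * (q+2) + (2 * (q+2) * (k+1)+1) := by ring
    have h0 : 0 ≤ Z := le_trans pz h
    calc y ^ (2 * (q+2) * (k+2)+1 + (q+2)) * Z ^ (2 * (q+2))
        ≤ (y^2) ^ (2 * (q+2) * (k+1)+1) * y ^ ((q+2) * (k+3)) * Z ^ (2 * (q+2)) := by
          refine mlr ?_ pz
          rw [← pow_mul, ← pow_add]
          refine pow_le_pow_right₀ hy ?_
          nlinarith [Nat.zero_le (q * k)]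
      _ ≤ Z ^ (2 * (q+2) * (k+1)+1) * y ^ ((q+2) * (k+3)) * Z ^ (2 * (q+2)) := by gcongr
      _ = _ := by rw [e, pow_add]; ring

lemma T2 {y Z : ℝ} (hy : 1 ≤ y) (h : y ≤ Z) :
    y ^ ((q+2) * (k+3)) * Z ≤ Z ^ (2 * (q+2) * (k+2)+1) := by
  have h0 : 1 ≤ Z := hy.trans h
  calc y ^ ((q+2) * (k+3)) * Z ≤ Z ^ ((q+2) * (k+3)) * Z := by gcongr
    _ = Z ^ ((q+2) * (k+3)+1) := by ring
    _ ≤ _ := pow_le_pow_right₀ h0 (by nlinarith [Nat.zero_le (q * k)])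

lemma ok (hc : 1 ≤ c1) (hA : 2400 * d^2 * c1^2*2 ^ (d+1) ≤ Y) :
    (casx d hd Y q k c1).Ok (c1 * Y ^ (q+2)) ((Y ^ (q+2)) ^ (k+3)) := by
  have hd1 : 1 ≤ d^2 := Nat.one_le_pow _ _ (by omega)
  have h2d : 1 ≤2 ^ (d+1) := Nat.one_le_two_pow
  have hc2 : c1 ≤ c1^2 := by nlinarith
  have hA1 : 2400 * c1 ≤ Y := by
    refine le_trans ?_ hA
    calc 2400 * c1 =2400*1 * c1*1 := by ring
      _ ≤ _ := by gcongr
  have hY3 : 3 ≤ Y := by omega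
  have hY0 : 0 < Y := by omega
  have hy3 : (3:ℝ) ≤ Y := by exact_mod_cast hY3
  have hy1 : (1:ℝ) ≤ Y := by linarith
  have hy0 : (0:ℝ) < Y := by linarith
  have hc0 : (1:ℝ) ≤ c1 := by exact_mod_cast hc
  have hcy : 2400 * (c1:ℝ) ≤ Y := by exact_mod_cast hA1
  have hAr : 2400 * (d:ℝ)^2 * c1^2*2 ^ (d+1) ≤ Y := by exact_mod_cast hA
  have hdr : (1:ℝ) ≤ (d:ℝ)^2 := by exact_mod_cast hd1
  have hdr0 : (0:ℝ) < d := by exact_mod_cast (by omega : 0 < d)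
  have hBM : (c1:ℝ)^2 * ((Y:ℝ) ^ (q+2))^2 * (2400 * (d:ℝ)^2*2 ^ (d+1)) ≤ ((Y:ℝ) ^ (q+2)) ^ (k+3) := by
    calc (c1:ℝ)^2 * ((Y:ℝ) ^ (q+2))^2 * (2400 * (d:ℝ)^2*2 ^ (d+1)) =
        (2400 * (d:ℝ)^2 * c1^2*2 ^ (d+1)) * ((Y:ℝ) ^ (q+2))^2 := by ring
      _ ≤ (Y:ℝ) * ((Y:ℝ) ^ (q+2))^2 := by gcongr
      _ ≤ (Y:ℝ) ^ (q+2) * ((Y:ℝ) ^ (q+2))^2 := by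
        gcongr
        exact le_self_pow₀ hy1 (by omega)
      _ = ((Y:ℝ) ^ (q+2))^3 := by ring
      _ ≤ _ := pow_le_pow_right₀ (one_le_pow₀ hy1) (by omega)
  refine ⟨hd, by positivity, by positivity, ?_, ?_, ?_, ?_, ?_, ?_, ?_, ?_, ?_, ?_, ?_, ?_⟩
  · intro n
    simp only [casx]
    split_ifs <;> positivity
  · intro n
    simp only [casx]
    split_ifs <;> positivity
  · intro n
    rcases lt_or_ge n d with h | h
    · rw [R_lt h, le_div_iff₀ pz]
      push_cast
      set X := (Y:ℝ) ^ (q+2) with hX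
      have hX1 : 1 ≤ X := one_le_pow₀ hy1
      have h1 : (c1:ℝ) * X*2400 ≤ c1^2 * X^2 * (2400 * (d:ℝ)^2*2 ^ (d+1)) := by
        have : (1:ℝ) ≤2 ^ (d+1) := one_le_pow₀ (by norm_num)
        calc (c1:ℝ) * X*2400 = c1 * X * (2400*1*1) := by ring
          _ ≤ c1^2 * X^2 * (2400 * (d:ℝ)^2*2 ^ (d+1)) := by
            gcongr
            · exact le_self_pow₀ hc0 (by norm_num)
            · exact le_self_pow₀ hX1 (by norm_num)
      have : 0 ≤ (c1:ℝ) * X := by positivity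
      linarith
    · obtain ⟨m, rfl⟩ := Nat.exists_eq_add_of_le h
      rw [R_ge hY0]
      have h1 : (Y:ℝ) ≤ (Y:ℝ)^2 ^ m := le_self_pow₀ hy1 pz
      have h2 : (Y:ℝ)^2 ^ m ≤ ((Y:ℝ)^2 ^ m) ^ (2 * (q+2) * (k+2)+1) :=
        le_self_pow₀ (hy1.trans h1) (by omega)
      linarith
  · intro n h
    have h := congrArg Fin.val h
    simp only [casx] at h
    split_ifs at h <;> (try simp at h) <;> try omega
  · intro n
    apply Fin.ext
    simp only [casx]
    split_ifs <;> (try simp) <;> omega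
  · intro n h
    simp only [casx, dif_pos h]
  · intro n h
    simp only [casx, if_pos h]
  · intro n h
    simp only [casx, if_pos h]
  · simp [casx]
  · have : d - 1+1 = d := by omega
    simp [casx, this]
  · intro n h
    apply Fin.ext
    simp only [casx]
    split_ifs <;> (try simp) <;> omega
  · intro n
    rcases lt_or_ge n d with h | h
    · rw [Finset.Ico_eq_empty (by omega), Finset.prod_empty, R_lt h, Cas.ce, if_pos h]
      have hD : (casx d hd Y q k c1).D n =1 / ((c1 * Y ^ (q+2) : ℕ) : ℝ) := by simp only [casx, if_pos h]
      rw [hD]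
      push_cast
      set X := (Y:ℝ) ^ (q+2) with hX
      have hX0 : 0 < X := by positivity
      have e : 1 / (2 * X ^ (k+3) * (1 / (c1 * X)))+3*1 / (2 * X ^ (k+3) / (c1 * X)) =
          2 * (c1 * X) / X ^ (k+3) := by field_simp; norm_num
      rw [e, div_le_div_iff₀ pz pz]
      have h1 : (1/2:ℝ) ^ d ≤ (1/2) ^ (n+1) := pow_le_pow_of_le_one (by norm_num) (by norm_num) (by omega)
      have h2 : (1/2:ℝ) ^ d*2 ^ (d+1) =2 := by rw [pow_succ, ← mul_assoc, ← mul_pow]; norm_num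
      calc 2 * (c1 * X) * (480 * d^2 * (c1 * X)) = (2/5) * (c1^2 * X^2 * (2400 * d^2)) := by ring
        _ ≤2 * (c1^2 * X^2 * (2400 * d^2)) := by gcongr; norm_num
        _ = (1/2) ^ d * (c1^2 * X^2 * (2400 * d^2*2 ^ (d+1))) := by
          linear_combination (-(c1^2 * X^2 * (2400 * d^2))) * h2
        _ ≤ (1/2) ^ (n+1) * X ^ (k+3) := by gcongr
    · obtain ⟨m, rfl⟩ := Nat.exists_eq_add_of_le h
      rw [prodR hY0, R_ge hY0]
      have hD : (casx d hd Y q k c1).D (d + m) =1 / ((Y:ℝ)^2 ^ m) ^ (2 * q+3) := by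
        simp [casx]
      have hce : (casx d hd Y q k c1).ce (d + m) * (Y:ℝ) ^ (q+2) ≤3 * (Y:ℝ) ^ ((q+2) * (k+3)) := by
        have hle : (Y:ℝ) ^ (q+2) ≤ (Y:ℝ) ^ ((q+2) * (k+3)) :=
          pow_le_pow_right₀ hy1 (by nlinarith)
        rw [Cas.ce, if_neg (by omega)]
        rcases m with _ | m
        · rw [if_pos (by omega)]
          have hd0 : 0 < d := by omega
          simp only [casx, if_pos hd0]
          push_cast
          rw [add_mul, ← pow_mul]
          have : (Y:ℝ) ^ ((q+2) * (k+3)) * (1 / (c1 * Y ^ (q+2))) * Y ^ (q+2) = Y ^ ((q+2) * (k+3)) / c1 := by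
            field_simp
          rw [this]
          have := div_le_self (by positivity : 0 ≤ (Y:ℝ) ^ ((q+2) * (k+3))) hc0
          linarith
        · rw [if_neg (by omega), show d + (m+1) - 1 = d + m by omega, R_ge hY0]
          have : (1:ℝ) ≤ ((Y:ℝ)^2 ^ m) ^ (2 * (q+2) * (k+2)+1) := one_le_pow₀ (one_le_pow₀ hy1)
          have : 6 / (2 * ((Y:ℝ)^2 ^ m) ^ (2 * (q+2) * (k+2)+1)) ≤3 := by
            rw [div_le_iff₀ pz]; linarith
          gcongr
      rw [hD]
      have hZ : (Y:ℝ)^2 ^ m = Y ∨ (Y:ℝ)^2 ≤ (Y:ℝ)^2 ^ m := by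
        rcases m with _ | m
        · left; simp
        · right; exact pow_le_pow_right₀ hy1 (by rw [pow_succ]; have := Nat.one_le_two_pow (n := m); omega)
      have hZ1 : (Y:ℝ) ≤ (Y:ℝ)^2 ^ m := le_self_pow₀ hy1 pz
      have hfin : (2400 * (d:ℝ)^2 * c1^2*2 ^ (d+1))*3 ^ m ≤ (Y:ℝ)^2 ^ m :=
        pow_le_of pz (by norm_num) hAr hy3 hy1
      have t1 := T1 (q := q) (k := k) hy1 hZ
      have t2 := T2 (q := q) (k := k) hy1 hZ1
      push_cast
      rw [← pow_mul]
      generalize 2 * (q+2) * (k+2)+1 = ρ at *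
      set y := (Y:ℝ)
      generalize y^2 ^ m = Z at *
      have hZ0 : 0 < Z := by linarith
      set ce := (casx d hd Y q k c1).ce (d + m)
      rw [le_div_iff₀ pz]
      have u1 : (3/2) ^ m * (y / Z) ^ ρ / (2 * y ^ ((q+2) * (k+3)) * (1 / Z ^ (2 * q+3))) * y ^ (q+2) ≤
          (3/2) ^ m * (1/2) / Z := by
        have e : (3/2) ^ m * (y / Z) ^ ρ / (2 * y ^ ((q+2) * (k+3)) * (1 / Z ^ (2 * q+3))) * y ^ (q+2) =
          (3/2) ^ m * (1/2) / Z * ((y ^ (ρ + (q+2)) * Z ^ (2 * (q+2))) / (Z ^ ρ * y ^ ((q+2) * (k+3)))) := by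
          rw [div_pow y Z, pow_add y ρ, show 2 * (q+2) =2 * q+3+1 by ring, pow_succ Z (2 * q+3)]
          field_simp
        rw [e]
        refine mul_le_of_le_one_right pz ?_
        rw [div_le_one pz]
        exact t1
      have u2 : 3 * ce / (2 * Z ^ ρ) * y ^ (q+2) ≤9/2 / Z := by
        rw [div_mul_eq_mul_div, div_le_div_iff₀ pz hZ0]
        calc 3 * ce * y ^ (q+2) * Z =3 * (ce * y ^ (q+2)) * Z := by ring
          _ ≤3 * (3 * y ^ ((q+2) * (k+3))) * Z := by gcongr
          _ =9 * (y ^ ((q+2) * (k+3)) * Z) := by ring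
          _ ≤9 * Z ^ ρ := by gcongr
          _ = _ := by ring
      have u3 : 9/2 / Z ≤ (3/2) ^ m * (9/2) / Z := by
        gcongr
        have : (1:ℝ) ≤ (3/2) ^ m := one_le_pow₀ (by norm_num)
        linarith
      have u4 : ((3/2) ^ m * (y / Z) ^ ρ / (2 * y ^ ((q+2) * (k+3)) * (1 / Z ^ (2 * q+3)))+3 * ce / (2 * Z ^ ρ)) *
          y ^ (q+2) ≤ (3/2) ^ m*5 / Z := by
        rw [add_mul]
        have : (3/2:ℝ) ^ m * (1/2) / Z + (3/2) ^ m * (9/2) / Z = (3/2) ^ m*5 / Z := by ring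
        linarith
      calc _ = ((3/2) ^ m * (y / Z) ^ ρ / (2 * y ^ ((q+2) * (k+3)) * (1 / Z ^ (2 * q+3)))+3 * ce / (2 * Z ^ ρ)) *
          y ^ (q+2) * (480 * d^2 * c1) := by ring
        _ ≤ (3/2) ^ m*5 / Z * (480 * d^2 * c1) := by gcongr
        _ ≤ (1/2) ^ (d + m+1) := by
          rw [div_mul_eq_mul_div, div_le_iff₀ hZ0]
          calc (3/2:ℝ) ^ m*5 * (480 * d^2 * c1) = (1/2) ^ (d + m+1) *
              ((2400 * (d:ℝ)^2 * c1*2 ^ (d+1))*3 ^ m) := by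
                rw [show d + m+1 = (d+1) + m by ring, pow_add, div_pow 3 2, one_div, inv_pow, inv_pow]
                field_simp
                norm_num
            _ ≤ (1/2) ^ (d + m+1) * ((2400 * (d:ℝ)^2 * c1^2*2 ^ (d+1))*3 ^ m) := by
                gcongr
                exact le_self_pow₀ hc0 (by norm_num)
            _ ≤ _ := by gcongr

end casx

end

section
variable {d : ℕ}

namespace casx
variable {hd : 2 ≤ d} {Y q k c1 : ℕ}

lemma pow_rpow_comm {x : ℝ} (hx : 0 ≤ x) (n : ℕ) (s : ℝ) : (x ^ n) ^ s = (x ^ s) ^ n := by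
  rw [← rpow_natCast, ← rpow_mul hx, mul_comm, rpow_mul hx, rpow_natCast]

lemma bnd {z : ℝ} (hz : 1 ≤ z) {a b : ℕ} {α σ : ℝ} (h : b * α + σ ≤ a) :
    1 / z ^ a * (z ^ b) ^ α ≤1 / z ^ σ := by
  have h0 : 0 < z := by linarith
  rw [one_div_mul_eq_div, div_le_div_iff₀ pz pz, one_mul, ← rpow_natCast z b, ← rpow_mul h0.le,
    ← rpow_add h0, ← rpow_natCast z a]
  exact rpow_le_rpow_of_exponent_le hz h

lemma H (hY : 1 ≤ Y) (hc : 1 ≤ c1) {α σ : ℝ} (h1 : ((q+2) * (k+3) : ℕ) * α + σ ≤ (q+2 : ℕ))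
    (h2 : (2 * (k+3) * (q+2) : ℕ) * α + σ ≤ (2 * q+3 : ℕ)) {i : ℕ} (hσ : (2:ℝ) ^ (22 * (i+1)) ≤ (Y:ℝ) ^ σ) (n : ℕ) :
    (casx d hd Y q k c1).D n * ((casx d hd Y q k c1).N n : ℝ) ^ α ≤2 ^ (22 * d+6) * tau i n^2 := by
  have hy : (1:ℝ) ≤ Y := by exact_mod_cast hY
  have hcr : (1:ℝ) ≤ c1 := by exact_mod_cast hc
  have ht : tau i n^2 =1/2 ^ (2 * i+22 * n+6) := by
    rw [tau, one_div, inv_pow, inv_pow, ← pow_mul, one_div]; congr 2; ring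
  rw [ht, mul_one_div]
  rcases lt_or_ge n d with h | h
  · simp only [casx, if_pos h]
    push_cast
    have e := bnd hy h1
    have : (1:ℝ) / (c1 * Y ^ (q+2)) ≤1 / Y ^ (q+2) := by
      apply one_div_le_one_div_of_le pz
      nlinarith [pow_pos (by linarith : (0:ℝ) < Y) (q+2)]
    calc (1:ℝ) / (c1 * Y ^ (q+2)) * ((Y ^ (q+2)) ^ (k+3)) ^ α ≤1 / Y ^ (q+2) * ((Y ^ (q+2)) ^ (k+3)) ^ α := by
          gcongr
      _ ≤1 / Y ^ σ := by rw [← pow_mul]; exact e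
      _ ≤1/2 ^ (22 * (i+1)) := one_div_le_one_div_of_le pz hσ
      _ ≤ _ := by
        rw [div_le_div_iff₀ pz pz, one_mul, ← pow_add]
        exact pow_le_pow_right₀ (by norm_num) (by omega)
  · obtain ⟨m, rfl⟩ := Nat.exists_eq_add_of_le h
    simp only [casx, if_neg (show ¬ d + m < d by omega), Nat.add_sub_cancel_left]
    push_cast
    refine (bnd (one_le_pow₀ hy) h2).trans ?_
    rw [pow_rpow_comm (by linarith)]
    have h3 : ((2:ℝ) ^ (22 * (i+1)))^2 ^ m ≤ ((Y:ℝ) ^ σ)^2 ^ m := by gcongr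
    refine (one_div_le_one_div_of_le pz h3).trans ?_
    rw [div_le_div_iff₀ pz pz, one_mul, ← pow_mul, ← pow_add]
    refine pow_le_pow_right₀ (by norm_num) ?_
    have h4 : m+1 ≤2 ^ m := Nat.lt_two_pow_self
    have h5 : 22 * (i+1) * (m+1) ≤22 * (i+1)*2 ^ m := by gcongr
    nlinarith [Nat.zero_le (i * m)]

lemma D1 (hY : 2048 * c1 ≤ Y) (hc : 1 ≤ c1) (n : ℕ) :
    (casx d hd Y q k c1).D n*2 ^ (11 * n) ≤2 ^ (11 * d) / (c1 * Y ^ (q+2) : ℕ) := by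
  have hY1 : 1 ≤ Y := by omega
  have hy : (1:ℝ) ≤ Y := by exact_mod_cast hY1
  have hcr : (1:ℝ) ≤ c1 := by exact_mod_cast hc
  have hyc : (2048:ℝ) * c1 ≤ Y := by exact_mod_cast hY
  rcases lt_or_ge n d with h | h
  · simp only [casx, if_pos h]
    rw [one_div_mul_eq_div]
    gcongr
    norm_num
  · obtain ⟨m, rfl⟩ := Nat.exists_eq_add_of_le h
    simp only [casx, if_neg (show ¬ d + m < d by omega), Nat.add_sub_cancel_left]
    push_cast
    have h1 : (Y:ℝ) ≤ (Y:ℝ)^2 ^ m := le_self_pow₀ hy pz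
    have h2 : (c1:ℝ)*2048 ^ m ≤ (Y:ℝ)^2 ^ m := pow_le_of pz (by norm_num) (by linarith) (by linarith) hy
    generalize (Y:ℝ)^2 ^ m = Z at *
    have hZ : 1 ≤ Z := hy.trans h1
    rw [one_div_mul_eq_div, div_le_div_iff₀ pz pz, mul_add 11 d m, pow_add, pow_mul 2 11 m,
      show (2:ℝ)^11 =2048 by norm_num]
    calc (2:ℝ) ^ (11 * d)*2048 ^ m * (c1 * Y ^ (q+2)) =2 ^ (11 * d) * ((c1*2048 ^ m) * Y ^ (q+2)) := by ring
      _ ≤2 ^ (11 * d) * (Z * Z ^ (q+2)) := by gcongr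
      _ =2 ^ (11 * d) * Z ^ (q+3) := by ring
      _ ≤ _ := by
        refine mll (pow_le_pow_right₀ hZ (by omega)) pz

lemma R8 (hY : c1*8 ^ d ≤ Y) (hY' : 8 ≤ Y) (hc : 1 ≤ c1) (n : ℕ) : (8:ℝ) ^ n ≤ (casx d hd Y q k c1).R n := by
  have hY1 : 1 ≤ Y := by omega
  have hy : (1:ℝ) ≤ Y := by exact_mod_cast hY1
  have hy8 : (8:ℝ) ≤ Y := by exact_mod_cast hY'
  have hcr : (1:ℝ) ≤ c1 := by exact_mod_cast hc
  have hyc : c1 * (8:ℝ) ^ d ≤ Y := by exact_mod_cast hY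
  rcases lt_or_ge n d with h | h
  · rw [R_lt h, le_div_iff₀ pz]
    push_cast
    have hX : (Y:ℝ) ≤ Y ^ (q+2) := le_self_pow₀ hy (by omega)
    generalize (Y:ℝ) ^ (q+2) = X at *
    have hX1 : 1 ≤ X := hy.trans hX
    have h8 : (8:ℝ) ^ n ≤8 ^ d := pow_le_pow_right₀ (by norm_num) h.le
    calc (8:ℝ) ^ n * (c1 * X) ≤8 ^ d * (c1 * X) := by gcongr
      _ = (c1*8 ^ d) * X := by ring
      _ ≤ X * X := by gcongr; linarith
      _ = X^2 := by ring
      _ ≤ X ^ (k+3) := pow_le_pow_right₀ hX1 (by omega)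
      _ ≤ _ := by have : 0 ≤ X ^ (k+3) := by positivity
                  linarith
  · obtain ⟨m, rfl⟩ := Nat.exists_eq_add_of_le h
    rw [R_ge (by omega), pow_add]
    have h8 : (8:ℝ) ^ d ≤ Y := le_trans (by nlinarith [pow_pos (show (0:ℝ) <8 by norm_num) d]) hyc
    have h2 := pow_le_of (m := m) pz (by norm_num) h8 hy8 hy
    have h3 : (1:ℝ) ≤ (Y:ℝ)^2 ^ m := one_le_pow₀ hy
    have h4 : (Y:ℝ)^2 ^ m ≤ ((Y:ℝ)^2 ^ m) ^ (2 * (q+2) * (k+2)+1) := le_self_pow₀ h3 (by omega)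
    linarith

end casx

lemma exists_fam (hd : 2 ≤ d) {α : ℝ} (hα : α ∈ Set.Ioo (0:ℝ) (1/3)) :
    ∃ (C : ℕ → Cas d) (M B : ℕ → ℕ) (K0 : ℝ) (X : ℕ → ℕ) (k c1 : ℕ), Fam C M B α K0 ∧ 3 ≤ k ∧ 1 ≤ c1 ∧
      (2 * (k:ℝ) / (k - 1) <2 * (1 + α) / (1 - α)) ∧ (∀ i, 2 ≤ X i) ∧ (∀ i, M i = c1 * X i) ∧
      (∀ i, B i = X i ^ k) ∧ (∀ i, X (i+1) = X i ^ k) := by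
  obtain ⟨a0, a1⟩ := hα
  obtain ⟨k, hk1, hk2⟩ : ∃ k : ℕ, (1 + α) < (k+3 : ℕ) * (2 * α) ∧ (k+3 : ℕ) * α <1 := by
    have hx : 2 < (1 + α) / (2 * α) := by rw [lt_div_iff₀ pz]; linarith
    have h1 := Nat.lt_floor_add_one ((1 + α) / (2 * α))
    have h2 := Nat.floor_le (show 0 ≤ (1 + α) / (2 * α) by positivity)
    have h3 : 2 ≤ ⌊(1 + α) / (2 * α)⌋₊ := Nat.le_floor (by exact_mod_cast hx.le)
    obtain ⟨k, hk⟩ := Nat.exists_eq_add_of_le h3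
    refine ⟨k, ?_, ?_⟩
    · rw [div_lt_iff₀ pz] at h1
      rw [hk] at h1
      push_cast at h1 ⊢
      linarith
    · rw [le_div_iff₀ pz, hk] at h2
      push_cast at h2 ⊢
      nlinarith
  obtain ⟨q, hq⟩ : ∃ q : ℕ, 1 < (q:ℝ) * (2 - 2 * ((k+3 : ℕ) * α)) := by
    obtain ⟨q, hq⟩ := exists_nat_gt (1 / (2 - 2 * ((k+3 : ℕ) * α)))
    exact ⟨q, by rwa [div_lt_iff₀ (by linarith)] at hq⟩
  have hkα : (0:ℝ) < (k+3 : ℕ) * α := by positivity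
  obtain ⟨σ, hσ0, hσ1, hσ2⟩ : ∃ σ : ℝ, 0 < σ ∧ ((q+2) * (k+3) : ℕ) * α + σ ≤ (q+2 : ℕ) ∧
      (2 * (k+3) * (q+2) : ℕ) * α + σ ≤ (2 * q+3 : ℕ) := by
    refine ⟨min ((q+2 : ℕ) * (1 - (k+3 : ℕ) * α)) ((2 * q+3 : ℕ) - (2 * (k+3) * (q+2) : ℕ) * α), ?_, ?_, ?_⟩
    · refine lt_min (mul_pos pz (by linarith)) ?_
      push_cast at *
      nlinarith
    · refine (add_le_add_right (min_le_left _ _) _).trans ?_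
      push_cast
      linarith
    · refine (add_le_add_right (min_le_right _ _) _).trans ?_
      linarith
  set c1 := 2 ^ (11 * d+8) with hc1
  have hc : 1 ≤ c1 := Nat.one_le_two_pow
  obtain ⟨b, hb1, hb2⟩ : ∃ b : ℕ, 2400 * d^2 * c1^2*2 ^ (d+1) ≤ b ∧ (2:ℝ)^22 ≤ (b:ℝ) ^ σ := by
    have h1 : Tendsto (fun b : ℕ => (b:ℝ) ^ σ) atTop atTop := (tendsto_rpow_atTop hσ0).comp tendsto_natCast_atTop_atTop
    obtain ⟨b, h⟩ := ((h1.eventually_ge_atTop ((2:ℝ)^22)).and (eventually_ge_atTop (2400 * d^2 * c1^2*2 ^ (d+1)))).exists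
    exact ⟨b, h.2, h.1⟩
  have hbc : 2400 * c1^2 ≤ b := by
    refine le_trans ?_ hb1
    calc 2400 * c1^2 =2400*1 * c1^2*1 := by ring
      _ ≤ _ := by
        gcongr
        · exact Nat.one_le_pow _ _ (by omega)
        · exact Nat.one_le_two_pow
  have hcc : c1 ≤ c1^2 := by nlinarith
  have hb0 : 1 ≤ b := by omega
  set Y : ℕ → ℕ := fun i => b ^ (k+3) ^ i with hYd
  have hYb : ∀ i, b ≤ Y i := fun i => Nat.le_self_pow pz b
  have hYs : ∀ i, Y (i+1) = Y i ^ (k+3) := fun i => by simp only [hYd]; rw [pow_succ, pow_mul]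
  have hc8 : 8 ^ d ≤ c1 := by
    rw [hc1, show (8:ℕ) =2^3 by norm_num, ← pow_mul]
    exact Nat.pow_le_pow_right (by norm_num) (by omega)
  have hX2 : ∀ i, 2 ≤ Y i ^ (q+2) := fun i => by
    have h1 : Y i ≤ Y i ^ (q+2) := Nat.le_self_pow (by omega) _
    have := hYb i
    omega
  refine ⟨fun i => casx d hd (Y i) q k c1, fun i => c1 * Y i ^ (q+2), fun i => (Y i ^ (q+2)) ^ (k+3), 2 ^ (22 * d+6),
    fun i => Y i ^ (q+2), k+3, c1, ⟨?_, a0, by linarith, by positivity, ?_, ?_, ?_, ?_, ?_⟩, by omega, hc, ?_, hX2,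
    fun i => rfl, fun i => rfl, ?_⟩
  · exact fun i => casx.ok hc (hb1.trans (hYb i))
  · intro i n
    refine casx.H (hb0.trans (hYb i)) hc hσ1 hσ2 ?_ n
    simp only [hYd]
    push_cast
    rw [casx.pow_rpow_comm pz, pow_mul]
    have h1 : i+1 ≤ (k+3) ^ i := (Nat.lt_two_pow_self).trans_le (Nat.pow_le_pow_left (by omega) i)
    calc ((2:ℝ)^22) ^ (i+1) ≤ ((2:ℝ)^22) ^ (k+3) ^ i := pow_le_pow_right₀ (by norm_num) h1
      _ ≤ _ := by gcongr
  · exact fun i n => casx.D1 (by have := hYb i; omega) hc n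
  · intro i
    simp only [hYs]
    have h := hX2 i
    rw [← pow_mul (Y i), mul_comm (k+3), pow_mul (Y i)]
    generalize Y i ^ (q+2) = X at *
    calc 2 * (c1 * X) = c1 * (2 * X) := by ring
      _ ≤ c1 * (X * X) := by gcongr
      _ = c1 * X^2 := by ring
      _ ≤ _ := by gcongr <;> omega
  · intro i
    simp only [hYs]
    rw [← pow_mul (Y i), ← pow_mul (Y i), mul_comm (k+3)]
  · refine fun i n => casx.R8 ?_ ?_ hc n
    · calc c1*8 ^ d ≤ c1 * c1 := by gcongr
        _ = c1^2 := by ring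
        _ ≤ Y i := by have := hYb i; omega
    · have := hYb i; omega
  · have h3 : (3:ℝ) ≤ (k+3 : ℕ) := by push_cast; linarith [(Nat.cast_nonneg k : (0:ℝ) ≤ k)]
    rw [div_lt_div_iff₀ (by linarith) (by linarith)]
    nlinarith
  · intro i
    simp only [hYs]
    rw [← pow_mul (Y i), ← pow_mul (Y i), mul_comm (k+3)]

end

section
variable {d : ℕ}

lemma poin_grad {f : Vd d → ℝ} (hf : ContDiff ℝ 2 f) (hp : SpacePeriodic f) (h0 : ∫ x in box d, f x =0) {Γ : ℝ}
    (hΓ0 : 0 ≤ Γ) (hΓ : ∀ l, nm (pd f l) ≤ Γ) : nm f ≤ d * Γ := by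
  have hcf : CP f := ⟨hf.continuous, hp⟩
  have h1 : ∀ j, osc j f ≤ Γ := fun j => by
    refine le_of_sq_le_sq ((osc_le hcf j).trans ?_) hΓ0
    have hc : ∀ v ∈ Set.Icc (0:ℝ) 1, om j f v^2 ≤ Γ^2 := fun v hv => by
      have h := nm_line_diff (hf.of_le (by norm_num)) hp j hv.1
      have h2 : v * nm (pd f j) ≤1 * Γ := mul_le_mul hv.2 (hΓ j) (nm_nonneg _) (by norm_num)
      rw [one_mul] at h2
      exact pow_le_pow_left₀ (nm_nonneg _) (h.trans h2) 2
    by_cases hi : IntervalIntegrable (fun v => om j f v^2) volume 0 1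
    · have := intervalIntegral.integral_mono_on (by norm_num) hi (intervalIntegrable_const (c := Γ^2)) hc
      simpa using this
    · rw [intervalIntegral.integral_undef hi]; positivity
  refine (poin hcf h0).trans ((Finset.sum_le_sum fun j _ => h1 j).trans ?_)
  simp

lemma scal {X : ℕ → ℕ} {k : ℕ} {c1 D p A : ℝ} (hk : 3 ≤ k) (hX : ∀ i, 2 ≤ X i) (hs : ∀ i, X (i+1) = X i ^ k)
    (hA : 1 ≤ A) (hD : 1 ≤ D) (hp : 2 * (k:ℝ) / (k - 1) < p) {L : ℝ} (hL0 : 0 < L) (hL : L ≤ D) (hc : 0 < c1) :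
    ∃ i, A / L ≤ (X i : ℝ) ^ (k - 1) ∧ 1 / (1000000 * D^4 * c1^2 * X 0^2 * (A * D) ^ p) * L ^ p ≤
      1 / (1000000 * (D^2 * (c1 * X i))^2) := by
  have hkr : (3:ℝ) ≤ k := by exact_mod_cast hk
  have hp0 : 0 < p := lt_of_le_of_lt (div_nonneg (by linarith) (by linarith)) hp
  have hex : ∃ i, A / L ≤ (X i : ℝ) ^ (k - 1) := by
    have hge : ∀ i, i ≤ X i := by
      intro i
      induction i with
      | zero => omega
      | succ i ih =>
        rw [hs]
        have h1 : X i^2 ≤ X i ^ k := Nat.pow_le_pow_right (by have := hX i; omega) (by omega)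
        have := hX i
        nlinarith
    obtain ⟨i, hi⟩ := exists_nat_ge (A / L)
    refine ⟨i, hi.trans ?_⟩
    have h1 : (1:ℝ) ≤ X i := by exact_mod_cast (by have := hX i; omega : 1 ≤ X i)
    calc (i:ℝ) ≤ X i := by exact_mod_cast hge i
      _ ≤ _ := le_self_pow₀ h1 (by omega)
  classical
  set i := Nat.find hex with hi
  refine ⟨i, Nat.find_spec hex, ?_⟩
  set W := A * D / L with hW
  have hW1 : 1 ≤ W := by
    rw [hW, le_div_iff₀ hL0]; nlinarith
  have hAW : A / L ≤ W := by
    rw [hW]; gcongr; nlinarith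
  have hX0 : (1:ℝ) ≤ X 0 := by exact_mod_cast (by have := hX 0; omega : 1 ≤ X 0)
  have hXi : (1:ℝ) ≤ X i := by exact_mod_cast (by have := hX i; omega : 1 ≤ X i)
  have key : (X i : ℝ) ≤ X 0 * W ^ (p/2) := by
    have hWp : 1 ≤ W ^ (p/2) := one_le_rpow hW1 pz
    rcases hj : i with _ | j
    · exact le_mul_of_one_le_right (by linarith) hWp
    · have hmin := Nat.find_min hex (m := j) (by omega)
      rw [not_le] at hmin
      have hXj : (1:ℝ) ≤ X j := by exact_mod_cast (by have := hX j; omega : 1 ≤ X j)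
      rw [hs]
      push_cast
      have h1 : (X j : ℝ) ^ k = ((X j : ℝ) ^ (k - 1)) ^ ((k:ℝ) / (k - 1)) := by
        rw [← rpow_natCast _ (k - 1), ← rpow_mul (by linarith), ← rpow_natCast]
        congr 1
        rw [Nat.cast_sub (by omega)]
        push_cast
        exact (mul_div_cancel₀ _ (ne_of_gt (by linarith : (0:ℝ) < k - 1))).symm
      have h2 : (k:ℝ) / (k - 1) ≤ p/2 := by
        have : 2 * (k:ℝ) / (k - 1) =2 * ((k:ℝ) / (k - 1)) := by ring
        linarith
      have h3 : 0 ≤ (k:ℝ) / (k - 1) := div_nonneg (by linarith) (by linarith)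
      calc (X j : ℝ) ^ k ≤ W ^ ((k:ℝ) / (k - 1)) := by
            rw [h1]; exact rpow_le_rpow pz (hmin.le.trans hAW) h3
        _ ≤ W ^ (p/2) := rpow_le_rpow_of_exponent_le hW1 h2
        _ ≤ _ := le_mul_of_one_le_left (by linarith) hX0
  have key2 : (X i : ℝ)^2 ≤ X 0^2 * ((A * D) ^ p / L ^ p) := by
    calc (X i : ℝ)^2 ≤ (X 0 * W ^ (p/2))^2 := by gcongr
      _ = X 0^2 * W ^ p := by
        rw [mul_pow, ← rpow_natCast (W ^ (p/2)), ← rpow_mul (by linarith)]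
        congr 2; push_cast; ring
      _ = _ := by rw [hW, div_rpow pz hL0.le]
  have hLp : 0 < L ^ p := rpow_pos_of_pos hL0 p
  have hADp : 0 < (A * D) ^ p := rpow_pos_of_pos pz p
  rw [one_div_mul_eq_div, div_le_div_iff₀ pz pz, one_mul]
  rw [← mul_div_assoc, le_div_iff₀ hLp] at key2
  calc L ^ p * (1000000 * (D^2 * (c1 * X i))^2) =1000000 * D^4 * c1^2 * (X i^2 * L ^ p) := by ring
    _ ≤1000000 * D^4 * c1^2 * (X 0^2 * (A * D) ^ p) := by gcongr
    _ = _ := by ring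

lemma main_final
    (d : ℕ) (hd : 2 ≤ d) (α : ℝ) (hα : α ∈ Set.Ioo (0:ℝ) (1/3)) :
    ∃ u : ℝ → (Fin d → ℝ) → Fin d → ℝ,
      (∀ t i, SpacePeriodic fun x => u t x i) ∧
      HolderVF α u ∧ WeakDivFree u ∧
      ∀ ε : ℝ, 0 < ε → ∃ c : ℝ, 0 < c ∧
        ∀ (θin : (Fin d → ℝ) → ℝ) (g : (Fin d → ℝ) → Fin d → ℝ),
          SpacePeriodic θin →
          IntegrableOn (fun x => (θin x)^2) (box d) →
          IntegrableOn (fun x => ∑ i, (g x i)^2) (box d) →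
          HasWeakGradient θin g →
          (∫ x in box d, θin x) =0 →
          ∀ Θ : ℝ → ℝ → (Fin d → ℝ) → ℝ,
            (∀ κ ∈ Set.Ioc (0:ℝ) 1, IsAdvDiffSol u κ θin (Θ κ)) →
            c * (Real.sqrt (l2sq θin)
                  / Real.sqrt (∫ x in box d, ∑ i, (g x i)^2))
                ^ (2 * (1 + α) / (1 - α) + ε) * l2sq θin
              ≤ Filter.limsup (fun κ => κ * dissip (Θ κ)) (𝓝[>] (0:ℝ)) := by
  obtain ⟨C, M, B, K0, X, k, c1, F, hk, hc1, hexp, hX, hM, hB, hXs⟩ := exists_fam hd hα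
  have hdr : (1:ℝ) ≤ d := by exact_mod_cast (by omega : 1 ≤ d)
  have hcr : (1:ℝ) ≤ c1 := by exact_mod_cast hc1
  have hX0 : (1:ℝ) ≤ X 0 := by exact_mod_cast (by have := hX 0; omega : 1 ≤ X 0)
  refine ⟨vf C, fun t i => (F.shear t).per i, F.holder, F.divfree, fun ε hε => ?_⟩
  set p := 2 * (1 + α) / (1 - α) + ε with hp
  set A : ℝ := 144 * d^2 * c1 with hA
  have hA1 : 1 ≤ A := by
    have : (1:ℝ) ≤ (d:ℝ)^2 := one_le_pow₀ hdr
    rw [hA]; nlinarith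
  refine ⟨1 / (1000000 * (d:ℝ)^4 * c1^2 * X 0^2 * (A * d) ^ p), by positivity, ?_⟩
  intro θin g hper _ hg hw h0 Θ hsol
  have S1 := F.toSys one_pos (hsol 1 ⟨one_pos, le_rfl⟩)
  have hθ : CP θin := by
    have := S1.cp (t := 0) ⟨le_rfl, by norm_num⟩
    rwa [show Θ 1 0 = θin from funext fun x => S1.sol.init x] at this
  set Γ := √(∫ x in box d, ∑ i, (g x i)^2) with hΓ
  have hΓ0 : 0 ≤ Γ := sqrt_nonneg _
  have hbd : ∀ᶠ κ in 𝓝[>] (0:ℝ), κ * dissip (Θ κ) ≤ nm θin^2/2 := by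
    filter_upwards [Ioc_mem_nhdsGT (show (0:ℝ) <1 by norm_num)] with κ hκ
    have S := F.toSys hκ.1 (hsol κ hκ)
    rw [S.dissip_eq, show Θ κ 0 = θin from funext fun x => S.sol.init x]
    nlinarith [sq_nonneg (nm (Θ κ 1))]
  have hbdd : IsBoundedUnder (· ≤ ·) (𝓝[>] (0:ℝ)) (fun κ => κ * dissip (Θ κ)) := ⟨_, hbd⟩
  change _ * (nm θin / Γ) ^ p * _ ≤ _
  have hl2 : l2sq θin = nm θin^2 := by rw [nm_sq, l2sq_eq]
  rw [hl2]
  rcases (nm_nonneg θin).eq_or_lt with ha | ha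
  · rw [← ha]
    have e : ∀ v : ℝ, v * (0:ℝ)^2 =0 := fun v => by ring
    rw [e]
    refine le_limsup_of_frequently_le (Eventually.frequently ?_) hbdd
    filter_upwards [Ioc_mem_nhdsGT (show (0:ℝ) <1 by norm_num)] with κ hκ
    have S := F.toSys hκ.1 (hsol κ hκ)
    have h1 := S.nm_anti (a := 0) (b := 1) le_rfl (by norm_num) le_rfl
    rw [S.dissip_eq]
    have := pow_le_pow_left₀ (nm_nonneg _) h1 2
    linarith
  have hpoin : nm θin ≤ d * Γ := by
    refine le_of_forall_pos_le_add fun δ hδ => ?_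
    obtain ⟨f0, hf, hpf, hcl, hf0, hgr⟩ := prep hθ hg hw h0 hδ
    have h1 := poin_grad hf hpf hf0 hΓ0 hgr
    have h2 : nm (fun x => f0 x - θin x) ≤ δ := nm_le (hf.continuous.sub hθ.c) hcl
    have h3 := nm_sub hf.continuous (hf.continuous.sub hθ.c) (f := f0) (g := fun x => f0 x - θin x)
    simp only [sub_sub_cancel] at h3
    have h3 : nm θin ≤ _ := h3
    linarith
  have hΓp : 0 < Γ := by
    rcases hΓ0.eq_or_lt with h | h
    · rw [← h] at hpoin; linarith
    · exact h
  set a := nm θin with haD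
  obtain ⟨i, hi1, hi2⟩ := scal (c1 := c1) (D := d) (p := p) (A := A) hk hX hXs hA1 hdr (by rw [hp]; linarith)
    (show 0 < a / Γ by positivity) (by rw [div_le_iff₀ hΓp]; exact hpoin) (by linarith)
  have hXi : (1:ℝ) ≤ X i := by exact_mod_cast (by have := hX i; omega : 1 ≤ X i)
  have hMr : (M i : ℝ) = c1 * X i := by rw [hM]; push_cast; ring
  have hMp : (0:ℝ) < M i := by rw [hMr]; positivity
  obtain ⟨f0, hf, hpf, hcl, hf0, hgr⟩ := prep hθ hg hw h0 (ε := a / (1000 * d^2 * M i)) pz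
  have hfr := F.casc_lower i hθ hf hpf hf0 hgr hΓ0 ha (nm_le (hθ.c.sub hf.continuous) fun x => by
    have h := hcl x
    rw [abs_sub_comm] at h
    exact h) (by
      have hBr : (B i : ℝ) = X i ^ (k - 1) * X i := by
        rw [hB, ← pow_succ]; push_cast; congr 1; omega
      rw [hMr, hBr]
      rw [div_div_eq_mul_div, div_le_iff₀ ha] at hi1
      have e : 1 / ((c1:ℝ) * X i) * (X i ^ (k - 1) * X i) * nm θin = (X i ^ (k - 1) * a) / c1 := by
        field_simp
        rfl
      rw [e, le_div_iff₀ (by linarith)]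
      calc _ = A * Γ := by rw [hA]; ring
        _ ≤ _ := hi1) hsol
  refine le_limsup_of_frequently_le (hfr.mono fun κ h => le_trans ?_ h) hbdd
  have := mlr hi2 (sq_nonneg a)
  refine this.trans (le_of_eq ?_)
  rw [hMr, one_div_mul_eq_div]

end

/-- **Anomalous diffusion (main theorem).** For `d ≥ 2` and `α ∈ (0,1/3)` there
is a divergence-free vector field `u ∈ C^0_t C^α_x ∩ C^α_t C^0_x` on `[0,1] × T^d`
such that: for every `ε > 0` there is `c = c(d,α,ε) > 0` with the property that
for every zero-mean `θ_in ∈ H¹(T^d)` (with weak gradient `g`) and every family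
`(θ^κ)_{κ ∈ (0,1]}` of solutions of `∂_t θ^κ + u·∇θ^κ = κΔθ^κ`, `θ^κ(0,·) = θ_in`,
one has `limsup_{κ→0⁺} κ ∫_0^1 ∫_{T^d} |∇θ^κ|² ≥ ϱ ‖θ_in‖²_{L²}` with
`ϱ = c · L_in^{2(1+α)/(1−α)+ε}` and `L_in = ‖θ_in‖_{L²}/‖∇θ_in‖_{L²}`. -/
theorem anomalous_diffusion_main
    (d : ℕ) (hd : 2 ≤ d) (α : ℝ) (hα : α ∈ Set.Ioo (0:ℝ) (1/3)) :
    ∃ u : ℝ → (Fin d → ℝ) → Fin d → ℝ,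
      (∀ t i, SpacePeriodic fun x => u t x i) ∧
      HolderVF α u ∧ WeakDivFree u ∧
      ∀ ε : ℝ, 0 < ε → ∃ c : ℝ, 0 < c ∧
        ∀ (θin : (Fin d → ℝ) → ℝ) (g : (Fin d → ℝ) → Fin d → ℝ),
          SpacePeriodic θin →
          IntegrableOn (fun x => (θin x) ^ 2) (box d) →
          IntegrableOn (fun x => ∑ i, (g x i) ^ 2) (box d) →
          HasWeakGradient θin g →
          (∫ x in box d, θin x) = 0 →
          ∀ Θ : ℝ → ℝ → (Fin d → ℝ) → ℝ,
            (∀ κ ∈ Set.Ioc (0:ℝ) 1, IsAdvDiffSol u κ θin (Θ κ)) →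
            c * (Real.sqrt (l2sq θin)
                  / Real.sqrt (∫ x in box d, ∑ i, (g x i) ^ 2))
                ^ (2 * (1 + α) / (1 - α) + ε) * l2sq θin
              ≤ Filter.limsup (fun κ => κ * dissip (Θ κ)) (𝓝[>] (0:ℝ)) := by
  exact main_final d hd α hα
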